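/- Let $P_n(x)=\lambda_0+\lambda_1 x+\cdots+\lambda_n x^n$ with $n\ge 2$, where $\lambda_0,\ldots,\lambda_n$ are exchangeable real random variables. Then $\mathbb{E}[N^*(P_n)\,\mathbf{1}_{\{P_n\neq 0\}}] \le C\log n$ for an absolute constant $C$, where $N^*(P_n)$ is the number of zeroes of $P_n$ in $\mathbb{R}\setminus\{0\}$ counted with multiplicity. -/

import Mathlib

open Finset Polynomial MeasureTheory
open scoped ENNReal

section PartA1

section perms
variable {α : Type*} [DecidableEq α]

/-- `Ω` is stable under exchanging positions in `R`. -/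
def SwapInv (Ω : Finset (Equiv.Perm α)) (R : Finset α) : Prop :=
  ∀ σ ∈ Ω, ∀ p ∈ R, ∀ q ∈ R, σ * Equiv.swap p q ∈ Ω

lemma SwapInv.sum_swap {Ω : Finset (Equiv.Perm α)} {R : Finset α} (h : SwapInv Ω R)
    {p q : α} (hp : p ∈ R) (hq : q ∈ R) (f : Equiv.Perm α → ℝ) :
    ∑ σ ∈ Ω, f (σ * Equiv.swap p q) = ∑ σ ∈ Ω, f σ := by
  refine Finset.sum_nbij' (fun σ => σ * Equiv.swap p q) (fun σ => σ * Equiv.swap p q)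
    (fun σ hσ => h σ hσ p hp q hq) (fun σ hσ => h σ hσ p hp q hq) ?_ ?_ ?_
  · intro σ _; simp [mul_assoc]
  · intro σ _; simp [mul_assoc]
  · intro σ _; rfl

lemma SwapInv.swap_id {Ω : Finset (Equiv.Perm α)} {R : Finset α} (h : SwapInv Ω R)
    {p q : α} (hp : p ∈ R) (hq : q ∈ R) (g : α → ℝ) (F : Equiv.Perm α → ℝ) :
    ∑ σ ∈ Ω, (g (σ p) - g (σ q)) * (F (σ * Equiv.swap p q) - F σ)
      = -2 * ∑ σ ∈ Ω, (g (σ p) - g (σ q)) * F σ := by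
  have h1 := h.sum_swap hp hq (fun σ => (g (σ p) - g (σ q)) * F (σ * Equiv.swap p q))
  simp only [Equiv.Perm.mul_apply, Equiv.swap_apply_left, Equiv.swap_apply_right, mul_assoc,
    Equiv.swap_mul_self, mul_one] at h1
  have h2 : ∑ σ ∈ Ω, (g (σ q) - g (σ p)) * F σ = - ∑ σ ∈ Ω, (g (σ p) - g (σ q)) * F σ := by
    rw [← Finset.sum_neg_distrib]; refine Finset.sum_congr rfl fun σ _ => by ring
  have h3 : ∑ σ ∈ Ω, (g (σ p) - g (σ q)) * (F (σ * Equiv.swap p q) - F σ)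
      = ∑ σ ∈ Ω, (g (σ p) - g (σ q)) * F (σ * Equiv.swap p q)
        - ∑ σ ∈ Ω, (g (σ p) - g (σ q)) * F σ := by
    rw [← Finset.sum_sub_distrib]; refine Finset.sum_congr rfl fun σ _ => by ring
  rw [h3, ← h1, h2]; ring

/-- second moment of a linear statistic -/
lemma SwapInv.second_moment {Ω : Finset (Equiv.Perm α)} {R : Finset α} (h : SwapInv Ω R)
    (γ c : α → ℝ) (Γ s : ℝ) (hr : 2 ≤ R.card)
    (hΓ : ∀ σ ∈ Ω, ∑ p ∈ R, γ (σ p) ^ 2 = Γ) (hs : ∀ σ ∈ Ω, ∑ p ∈ R, γ (σ p) = s) :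
    (R.card : ℝ) * (R.card - 1) * ∑ σ ∈ Ω, (∑ p ∈ R, c p * γ (σ p)) ^ 2
      = Ω.card * ((s ^ 2 - Γ) * (∑ p ∈ R, c p) ^ 2
          + (R.card * Γ - s ^ 2) * ∑ p ∈ R, c p ^ 2) := by
  set r : ℝ := (R.card : ℝ) with hrdef
  have hr2 : (2:ℝ) ≤ r := by rw [hrdef]; exact_mod_cast hr
  have one : ∀ (f : α → ℝ) (v : ℝ), (∀ σ ∈ Ω, ∑ p ∈ R, f (σ p) = v) → ∀ p ∈ R,
      r * ∑ σ ∈ Ω, f (σ p) = Ω.card * v := by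
    intro f v hv p hp
    have h1 : ∀ q ∈ R, ∑ σ ∈ Ω, f (σ q) = ∑ σ ∈ Ω, f (σ p) := by
      intro q hq
      have := h.sum_swap hp hq (fun σ => f (σ p))
      simpa using this
    have h2 : ∑ q ∈ R, ∑ σ ∈ Ω, f (σ q) = Ω.card * v := by
      rw [Finset.sum_comm, Finset.sum_congr rfl hv]; simp
    rw [Finset.sum_congr rfl h1] at h2
    simpa [hrdef] using h2
  have m2 := one (fun z => γ z ^ 2) Γ hΓ
  have m1 := one γ s hs
  have m11 : ∀ p ∈ R, ∀ q ∈ R, p ≠ q →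
      r * (r - 1) * ∑ σ ∈ Ω, γ (σ p) * γ (σ q) = Ω.card * (s ^ 2 - Γ) := by
    intro p hp q hq hpq
    have h1 : ∀ q' ∈ R.erase p, ∑ σ ∈ Ω, γ (σ p) * γ (σ q') = ∑ σ ∈ Ω, γ (σ p) * γ (σ q) := by
      intro q' hq'
      have hq'' := Finset.mem_erase.1 hq'
      have := h.sum_swap hq hq''.2 (fun σ => γ (σ p) * γ (σ q))
      simp only [Equiv.Perm.mul_apply, Equiv.swap_apply_left] at this
      rw [Equiv.swap_apply_of_ne_of_ne hpq hq''.1.symm] at this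
      exact this
    have h2 : ∑ q' ∈ R.erase p, ∑ σ ∈ Ω, γ (σ p) * γ (σ q')
        = ∑ σ ∈ Ω, (s * γ (σ p) - γ (σ p) ^ 2) := by
      rw [Finset.sum_comm]
      refine Finset.sum_congr rfl fun σ hσ => ?_
      rw [← Finset.mul_sum]
      have := Finset.add_sum_erase R (fun p => γ (σ p)) hp
      simp only [hs σ hσ] at this
      have h3 : ∑ q' ∈ R.erase p, γ (σ q') = s - γ (σ p) := by linarith
      rw [h3]; ring
    rw [Finset.sum_congr rfl h1, Finset.sum_sub_distrib, ← Finset.mul_sum] at h2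
    simp only [Finset.sum_const, Finset.card_erase_of_mem hp, nsmul_eq_mul] at h2
    rw [Nat.cast_sub (by omega)] at h2
    push_cast at h2
    calc _ = r * ((r - 1) * ∑ σ ∈ Ω, γ (σ p) * γ (σ q)) := by ring
      _ = _ := by rw [h2]; linear_combination s * m1 p hp - m2 p hp
  have expand : ∑ σ ∈ Ω, (∑ p ∈ R, c p * γ (σ p)) ^ 2
      = ∑ p ∈ R, ∑ q ∈ R, c p * c q * ∑ σ ∈ Ω, γ (σ p) * γ (σ q) := by
    have e1 : ∀ σ ∈ Ω, (∑ p ∈ R, c p * γ (σ p)) ^ 2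
        = ∑ p ∈ R, ∑ q ∈ R, c p * c q * (γ (σ p) * γ (σ q)) := by
      intro σ _
      rw [pow_two, Finset.sum_mul_sum]
      refine Finset.sum_congr rfl fun p _ => Finset.sum_congr rfl fun q _ => by ring
    rw [Finset.sum_congr rfl e1, Finset.sum_comm]
    refine Finset.sum_congr rfl fun p _ => ?_
    rw [Finset.sum_comm]
    refine Finset.sum_congr rfl fun q _ => by rw [Finset.mul_sum]
  rw [expand, Finset.mul_sum]
  have key : ∀ p ∈ R, r * (r - 1) * ∑ q ∈ R, c p * c q * ∑ σ ∈ Ω, γ (σ p) * γ (σ q)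
      = Ω.card * ((s ^ 2 - Γ) * (c p * ∑ q ∈ R, c q) + (r * Γ - s ^ 2) * c p ^ 2) := by
    intro p hp
    rw [← Finset.add_sum_erase R _ hp, ← Finset.add_sum_erase R c hp, mul_add,
      Finset.mul_sum (R.erase p)]
    have : ∑ q ∈ R.erase p, r * (r - 1) * (c p * c q * ∑ σ ∈ Ω, γ (σ p) * γ (σ q))
        = ∑ q ∈ R.erase p, c p * (Ω.card * (s ^ 2 - Γ)) * c q := by
      refine Finset.sum_congr rfl fun q hq => ?_
      have hq' := Finset.mem_erase.1 hq
      linear_combination c p * c q * m11 p hp q hq'.2 hq'.1.symm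
    rw [this, ← Finset.mul_sum]
    have h5 := m2 p hp
    simp only [pow_two] at h5 ⊢
    linear_combination (r - 1) * c p * c p * h5
  rw [Finset.sum_congr rfl key, ← Finset.mul_sum, Finset.sum_add_distrib, ← Finset.mul_sum,
    ← Finset.mul_sum, ← Finset.sum_mul]
  ring

lemma SwapInv.second_moment_le {Ω : Finset (Equiv.Perm α)} {R : Finset α} (h : SwapInv Ω R)
    (γ c : α → ℝ) (Γ s : ℝ) (hr : 2 ≤ R.card) (hΓ0 : 0 ≤ Γ)
    (hΓ : ∀ σ ∈ Ω, ∑ p ∈ R, γ (σ p) ^ 2 = Γ) (hs : ∀ σ ∈ Ω, ∑ p ∈ R, γ (σ p) = s) :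
    ((R.card : ℝ) - 1) * ∑ σ ∈ Ω, (∑ p ∈ R, c p * γ (σ p)) ^ 2
      ≤ Ω.card * ((Γ + s ^ 2) * ∑ p ∈ R, c p ^ 2) := by
  have h1 := h.second_moment γ c Γ s hr hΓ hs
  have hr2 : (2:ℝ) ≤ R.card := by exact_mod_cast hr
  have hcs : (∑ p ∈ R, c p) ^ 2 ≤ R.card * ∑ p ∈ R, c p ^ 2 := sq_sum_le_card_mul_sum_sq
  have h2 : 0 ≤ ∑ p ∈ R, c p ^ 2 := Finset.sum_nonneg fun _ _ => sq_nonneg _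
  have h3 : (s ^ 2 - Γ) * (∑ p ∈ R, c p) ^ 2 + (R.card * Γ - s ^ 2) * ∑ p ∈ R, c p ^ 2
      ≤ R.card * ((Γ + s ^ 2) * ∑ p ∈ R, c p ^ 2) := by
    have := mul_le_mul_of_nonneg_left hcs (sq_nonneg s)
    have := mul_nonneg hΓ0 (sq_nonneg (∑ p ∈ R, c p))
    have := mul_nonneg (sq_nonneg s) h2
    linarith
  have h4 := mul_le_mul_of_nonneg_left h3 (Nat.cast_nonneg (α := ℝ) Ω.card)
  rw [← h1] at h4
  have : (0:ℝ) < R.card := by linarith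
  refine le_of_mul_le_mul_left ?_ this
  linarith

lemma SwapInv.second_moment_le' {Ω : Finset (Equiv.Perm α)} {R : Finset α} (h : SwapInv Ω R)
    (γ c : α → ℝ) (Γ s : ℝ) (hr : 2 ≤ R.card) (hc : ∑ p ∈ R, c p = 0)
    (hΓ : ∀ σ ∈ Ω, ∑ p ∈ R, γ (σ p) ^ 2 = Γ) (hs : ∀ σ ∈ Ω, ∑ p ∈ R, γ (σ p) = s) :
    ((R.card : ℝ) - 1) * ∑ σ ∈ Ω, (∑ p ∈ R, c p * γ (σ p)) ^ 2
      ≤ Ω.card * (Γ * ∑ p ∈ R, c p ^ 2) := by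
  have h1 := h.second_moment γ c Γ s hr hΓ hs
  have hr2 : (2:ℝ) ≤ R.card := by exact_mod_cast hr
  have h2 : 0 ≤ ∑ p ∈ R, c p ^ 2 := Finset.sum_nonneg fun _ _ => sq_nonneg _
  have h3 : (s ^ 2 - Γ) * (∑ p ∈ R, c p) ^ 2 + (R.card * Γ - s ^ 2) * ∑ p ∈ R, c p ^ 2
      ≤ R.card * (Γ * ∑ p ∈ R, c p ^ 2) := by
    have := mul_nonneg (sq_nonneg s) h2
    rw [hc]; linarith
  have h4 := mul_le_mul_of_nonneg_left h3 (Nat.cast_nonneg (α := ℝ) Ω.card)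
  rw [← h1] at h4
  have : (0:ℝ) < R.card := by linarith
  refine le_of_mul_le_mul_left ?_ this
  linarith

end perms

/-- The partial sums lemma. -/
lemma sum_div_sqrt_le {ι : Type*} [DecidableEq ι] (b : ι → ℝ) (s : Finset ι) :
    ∑ x ∈ s, b x ^ 2 / √(∑ z ∈ s with |b z| ≤ |b x|, b z ^ 2) ≤ 2 * √(∑ z ∈ s, b z ^ 2) := by
  induction s using Finset.induction_on_max_value (fun x => |b x|) with
  | empty => simp
  | insert a s ha hmax ih =>
    rw [Finset.sum_insert ha, Finset.sum_insert ha]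
    have h1 : (insert a s).filter (fun z => |b z| ≤ |b a|) = insert a s := by
      apply Finset.filter_true_of_mem
      intro x hx
      rcases Finset.mem_insert.1 hx with rfl | hx
      · exact le_rfl
      · exact hmax x hx
    rw [h1, Finset.sum_insert ha]
    have hle : ∑ x ∈ s, b x ^ 2 / √(∑ z ∈ insert a s with |b z| ≤ |b x|, b z ^ 2)
        ≤ ∑ x ∈ s, b x ^ 2 / √(∑ z ∈ s with |b z| ≤ |b x|, b z ^ 2) := by
      refine Finset.sum_le_sum fun x hx => ?_
      by_cases hx0 : b x = 0
      · simp [hx0]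
      have hpos : 0 < ∑ z ∈ s with |b z| ≤ |b x|, b z ^ 2 := by
        refine Finset.sum_pos' (fun _ _ => sq_nonneg _) ⟨x, by simp [hx], by positivity⟩
      apply div_le_div_of_nonneg_left (sq_nonneg _) (Real.sqrt_pos.2 hpos)
      apply Real.sqrt_le_sqrt
      refine Finset.sum_le_sum_of_subset_of_nonneg ?_ (fun _ _ _ => sq_nonneg _)
      exact Finset.filter_subset_filter _ (Finset.subset_insert _ _)
    set A := ∑ x ∈ s, b x ^ 2 with hA
    have hA0 : 0 ≤ A := Finset.sum_nonneg fun _ _ => sq_nonneg _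
    by_cases hb : b a = 0
    · simp only [hb]; norm_num; linarith
    have hb2 : 0 < b a ^ 2 := by positivity
    have hu : 0 < √(b a ^ 2 + A) := Real.sqrt_pos.2 (by linarith)
    have hv : 0 ≤ √A := Real.sqrt_nonneg _
    have hu2 := Real.sq_sqrt (show 0 ≤ b a ^ 2 + A by linarith)
    have hv2 := Real.sq_sqrt hA0
    have : b a ^ 2 / √(b a ^ 2 + A) ≤ 2 * √(b a ^ 2 + A) - 2 * √A := by
      rw [div_le_iff₀ hu]
      nlinarith [sq_nonneg (√(b a ^ 2 + A) - √A)]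
    linarith

end PartA1

section PartA2

section fourth
variable {α : Type*} [DecidableEq α] [Fintype α]

lemma swapInv_univ (R : Finset α) : SwapInv (Finset.univ : Finset (Equiv.Perm α)) R :=
  fun _ _ _ _ _ _ => Finset.mem_univ _

lemma fourth_moments (b : α → ℝ) (hb : ∑ x, b x = 0) (hK : 4 ≤ Fintype.card α)
    (K U : ℝ) (hKd : K = Fintype.card α)
    (hU : U = (Fintype.card (Equiv.Perm α) : ℝ) * (∑ x, b x ^ 2) ^ 2) :
    (∀ p q : α, p ≠ q → K * (K - 1) * ∑ σ : Equiv.Perm α, b (σ p) ^ 2 * b (σ q) ^ 2 ≤ U) ∧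
    (∀ p q r : α, p ≠ q → p ≠ r → q ≠ r →
      K * (K - 1) * (K - 2) * ∑ σ : Equiv.Perm α, b (σ p) ^ 2 * b (σ q) * b (σ r) ≤ U) ∧
    (∀ p q r s : α, p ≠ q → p ≠ r → q ≠ r → s ≠ p → s ≠ q → s ≠ r →
      K * (K - 1) * (K - 2) * (K - 3) *
        ∑ σ : Equiv.Perm α, b (σ p) * b (σ q) * b (σ r) * b (σ s) ≤ 3 * U) := by
  have hK4 : (4:ℝ) ≤ K := by rw [hKd]; exact_mod_cast hK
  have hsum : ∀ (f : α → ℝ) (σ : Equiv.Perm α), ∑ p, f (σ p) = ∑ x, f x := fun f σ =>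
    Equiv.sum_comp σ f
  have sw : ∀ (p q : α) (f : Equiv.Perm α → ℝ),
      ∑ σ : Equiv.Perm α, f (σ * Equiv.swap p q) = ∑ σ, f σ := fun p q f =>
    (swapInv_univ Finset.univ).sum_swap (Finset.mem_univ p) (Finset.mem_univ q) f
  set B4 := ∑ x, b x ^ 4 with hB4
  have hB40 : 0 ≤ B4 := Finset.sum_nonneg fun _ _ => by positivity
  have hB4le : B4 ≤ (∑ x, b x ^ 2) ^ 2 := by
    have := Finset.sum_sq_le_sq_sum_of_nonneg (s := Finset.univ) (f := fun x => b x ^ 2)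
      (fun _ _ => sq_nonneg _)
    calc B4 = ∑ x, (b x ^ 2) ^ 2 := Finset.sum_congr rfl fun _ _ => by ring
      _ ≤ _ := this
  set n : ℝ := (Fintype.card (Equiv.Perm α) : ℝ) with hn
  have hn0 : 0 ≤ n := Nat.cast_nonneg _
  have hU1 : n * B4 ≤ U := by rw [hU]; exact mul_le_mul_of_nonneg_left hB4le hn0
  have m4 : ∀ p : α, K * ∑ σ : Equiv.Perm α, b (σ p) ^ 4 = n * B4 := by
    intro p
    have h1 : ∀ q ∈ (Finset.univ : Finset α), ∑ σ : Equiv.Perm α, b (σ q) ^ 4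
        = ∑ σ : Equiv.Perm α, b (σ p) ^ 4 := by
      intro q _
      simpa using sw p q (fun σ => b (σ p) ^ 4)
    have h2 : ∑ q, ∑ σ : Equiv.Perm α, b (σ q) ^ 4 = n * B4 := by
      rw [Finset.sum_comm, Finset.sum_congr rfl fun σ _ => hsum (fun x => b x ^ 4) σ]
      simp [hn, hB4, Finset.card_univ]
    rw [Finset.sum_congr rfl h1] at h2
    simpa [hKd, Finset.card_univ] using h2
  have hrest1 : ∀ (f : α → ℝ) (σ : Equiv.Perm α) (p : α),
      ∑ q ∈ Finset.univ.erase p, f (σ q) = ∑ x, f x - f (σ p) := by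
    intro f σ p
    rw [← hsum f σ, ← Finset.add_sum_erase Finset.univ (fun q => f (σ q)) (Finset.mem_univ p)]
    ring
  have c1 : ∀ p : α, ((Finset.univ.erase p).card : ℝ) = K - 1 := by
    intro p
    rw [Finset.card_erase_of_mem (Finset.mem_univ p), Finset.card_univ,
      Nat.cast_sub (by omega), hKd]; simp
  have gen2 : ∀ (f g : α → ℝ) (p q : α), p ≠ q →
      (K - 1) * ∑ σ : Equiv.Perm α, f (σ p) * g (σ q)
        = ∑ σ : Equiv.Perm α, f (σ p) * (∑ x, g x - g (σ p)) := by
    intro f g p q hpq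
    have h1 : ∀ q' ∈ Finset.univ.erase p, ∑ σ : Equiv.Perm α, f (σ p) * g (σ q')
        = ∑ σ : Equiv.Perm α, f (σ p) * g (σ q) := by
      intro q' hq'
      have hq'' := Finset.mem_erase.1 hq'
      have := sw q q' (fun σ => f (σ p) * g (σ q))
      simp only [Equiv.Perm.mul_apply, Equiv.swap_apply_left] at this
      rw [Equiv.swap_apply_of_ne_of_ne hpq hq''.1.symm] at this
      exact this
    have h2 : ∑ q' ∈ Finset.univ.erase p, ∑ σ : Equiv.Perm α, f (σ p) * g (σ q')
        = ∑ σ : Equiv.Perm α, f (σ p) * (∑ x, g x - g (σ p)) := by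
      rw [Finset.sum_comm]
      refine Finset.sum_congr rfl fun σ _ => ?_
      rw [← Finset.mul_sum, hrest1 g σ p]
    rw [Finset.sum_congr rfl h1, Finset.sum_const, nsmul_eq_mul, c1] at h2
    exact h2
  have m22 : ∀ p q : α, p ≠ q → K * (K - 1) * ∑ σ : Equiv.Perm α, b (σ p) ^ 2 * b (σ q) ^ 2
      = U - n * B4 := by
    intro p q hpq
    have h1 := gen2 (fun x => b x ^ 2) (fun x => b x ^ 2) p q hpq
    have h2 : ∑ σ : Equiv.Perm α, b (σ p) ^ 2 * (∑ x, b x ^ 2 - b (σ p) ^ 2)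
        = (∑ x, b x ^ 2) * ∑ σ : Equiv.Perm α, b (σ p) ^ 2 - ∑ σ : Equiv.Perm α, b (σ p) ^ 4 := by
      rw [Finset.mul_sum, ← Finset.sum_sub_distrib]
      refine Finset.sum_congr rfl fun σ _ => by ring
    have h3 : K * ∑ σ : Equiv.Perm α, b (σ p) ^ 2 = n * ∑ x, b x ^ 2 := by
      have h1 : ∀ q ∈ (Finset.univ : Finset α), ∑ σ : Equiv.Perm α, b (σ q) ^ 2
          = ∑ σ : Equiv.Perm α, b (σ p) ^ 2 := by
        intro q _
        simpa using sw p q (fun σ => b (σ p) ^ 2)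
      have h2 : ∑ q, ∑ σ : Equiv.Perm α, b (σ q) ^ 2 = n * ∑ x, b x ^ 2 := by
        rw [Finset.sum_comm, Finset.sum_congr rfl fun σ _ => hsum (fun x => b x ^ 2) σ]
        simp [hn, Finset.card_univ]
      rw [Finset.sum_congr rfl h1] at h2
      simpa [hKd, Finset.card_univ] using h2
    rw [h2] at h1
    linear_combination K * h1 + (∑ x, b x ^ 2) * h3 - m4 p - hU
  have m31 : ∀ p q : α, p ≠ q → K * (K - 1) * ∑ σ : Equiv.Perm α, b (σ p) ^ 3 * b (σ q)
      = - (n * B4) := by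
    intro p q hpq
    have h1 := gen2 (fun x => b x ^ 3) b p q hpq
    simp only [hb] at h1
    have h2 : ∑ σ : Equiv.Perm α, b (σ p) ^ 3 * (0 - b (σ p))
        = - ∑ σ : Equiv.Perm α, b (σ p) ^ 4 := by
      rw [← Finset.sum_neg_distrib]
      refine Finset.sum_congr rfl fun σ _ => by ring
    rw [h2] at h1
    linear_combination K * h1 - m4 p
  have m211 : ∀ p q r : α, p ≠ q → p ≠ r → q ≠ r →
      K * (K - 1) * (K - 2) * ∑ σ : Equiv.Perm α, b (σ p) ^ 2 * b (σ q) * b (σ r)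
        = 2 * (n * B4) - U := by
    intro p q r hpq hpr hqr
    have hm : q ∈ Finset.univ.erase p := by simp [hpq.symm]
    have h1 : ∀ r' ∈ (Finset.univ.erase p).erase q,
        ∑ σ : Equiv.Perm α, b (σ p) ^ 2 * b (σ q) * b (σ r')
        = ∑ σ : Equiv.Perm α, b (σ p) ^ 2 * b (σ q) * b (σ r) := by
      intro r' hr'
      simp only [Finset.mem_erase] at hr'
      have := sw r r' (fun σ => b (σ p) ^ 2 * b (σ q) * b (σ r))
      simp only [Equiv.Perm.mul_apply, Equiv.swap_apply_left] at this
      rw [Equiv.swap_apply_of_ne_of_ne hpr hr'.2.1.symm,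
        Equiv.swap_apply_of_ne_of_ne hqr hr'.1.symm] at this
      exact this
    have h2 : ∑ r' ∈ (Finset.univ.erase p).erase q,
        ∑ σ : Equiv.Perm α, b (σ p) ^ 2 * b (σ q) * b (σ r')
        = - ∑ σ : Equiv.Perm α, b (σ p) ^ 3 * b (σ q)
          - ∑ σ : Equiv.Perm α, b (σ p) ^ 2 * b (σ q) ^ 2 := by
      rw [Finset.sum_comm, ← Finset.sum_neg_distrib, ← Finset.sum_sub_distrib]
      refine Finset.sum_congr rfl fun σ _ => ?_
      have h3 := Finset.add_sum_erase _ (fun q => b (σ q)) hm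
      rw [hrest1 b σ p, hb] at h3
      have h4 : ∑ r' ∈ (Finset.univ.erase p).erase q, b (σ r') = - b (σ p) - b (σ q) := by
        linarith
      rw [← Finset.mul_sum, h4]; ring
    rw [Finset.sum_congr rfl h1, Finset.sum_const, nsmul_eq_mul] at h2
    have c2 : (((Finset.univ.erase p).erase q).card : ℝ) = K - 2 := by
      rw [Finset.card_erase_of_mem hm, Nat.cast_sub (Finset.card_pos.2 ⟨q, hm⟩), c1]
      push_cast; ring
    rw [c2] at h2
    linear_combination K * (K - 1) * h2 - m31 p q hpq - m22 p q hpq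
  refine ⟨fun p q hpq => ?_, fun p q r hpq hpr hqr => ?_, ?_⟩
  · rw [m22 p q hpq]; nlinarith
  · rw [m211 p q r hpq hpr hqr]; nlinarith
  · intro p q r s hpq hpr hqr hsp hsq hsr
    have hm : q ∈ Finset.univ.erase p := by simp [hpq.symm]
    have hm2 : r ∈ (Finset.univ.erase p).erase q := by simp [hpr.symm, hqr.symm]
    have h1 : ∀ s' ∈ ((Finset.univ.erase p).erase q).erase r,
        ∑ σ : Equiv.Perm α, b (σ p) * b (σ q) * b (σ r) * b (σ s')
        = ∑ σ : Equiv.Perm α, b (σ p) * b (σ q) * b (σ r) * b (σ s) := by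
      intro s' hs'
      simp only [Finset.mem_erase] at hs'
      have := sw s s' (fun σ => b (σ p) * b (σ q) * b (σ r) * b (σ s))
      simp only [Equiv.Perm.mul_apply, Equiv.swap_apply_left] at this
      rw [Equiv.swap_apply_of_ne_of_ne hsp.symm hs'.2.2.1.symm,
        Equiv.swap_apply_of_ne_of_ne hsq.symm hs'.2.1.symm,
        Equiv.swap_apply_of_ne_of_ne hsr.symm hs'.1.symm] at this
      exact this
    have h2 : ∑ s' ∈ ((Finset.univ.erase p).erase q).erase r,
        ∑ σ : Equiv.Perm α, b (σ p) * b (σ q) * b (σ r) * b (σ s')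
        = - ∑ σ : Equiv.Perm α, b (σ p) ^ 2 * b (σ q) * b (σ r)
          - ∑ σ : Equiv.Perm α, b (σ q) ^ 2 * b (σ p) * b (σ r)
          - ∑ σ : Equiv.Perm α, b (σ r) ^ 2 * b (σ p) * b (σ q) := by
      rw [Finset.sum_comm, ← Finset.sum_neg_distrib, ← Finset.sum_sub_distrib,
        ← Finset.sum_sub_distrib]
      refine Finset.sum_congr rfl fun σ _ => ?_
      have h3 := Finset.add_sum_erase _ (fun q => b (σ q)) hm
      rw [hrest1 b σ p, hb] at h3
      have h5 := Finset.add_sum_erase _ (fun q => b (σ q)) hm2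
      have h4 : ∑ s' ∈ ((Finset.univ.erase p).erase q).erase r, b (σ s')
          = - b (σ p) - b (σ q) - b (σ r) := by
        linarith
      rw [← Finset.mul_sum, h4]; ring
    rw [Finset.sum_congr rfl h1, Finset.sum_const, nsmul_eq_mul] at h2
    have c2 : (((Finset.univ.erase p).erase q).card : ℝ) = K - 2 := by
      rw [Finset.card_erase_of_mem hm, Nat.cast_sub (Finset.card_pos.2 ⟨q, hm⟩), c1]
      push_cast; ring
    have c3 : ((((Finset.univ.erase p).erase q).erase r).card : ℝ) = K - 3 := by
      rw [Finset.card_erase_of_mem hm2, Nat.cast_sub (Finset.card_pos.2 ⟨r, hm2⟩), c2]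
      push_cast; ring
    rw [c3] at h2
    have e : K * (K - 1) * (K - 2) * (K - 3) *
        ∑ σ : Equiv.Perm α, b (σ p) * b (σ q) * b (σ r) * b (σ s)
        = -3 * (2 * (n * B4) - U) := by
      linear_combination K * (K - 1) * (K - 2) * h2 - m211 p q r hpq hpr hqr
        - m211 q p r hpq.symm hqr hpr - m211 r p q hpr.symm hqr.symm hpq
    rw [e]; nlinarith

end fourth

lemma Z_moment (L : ℕ) (hL : 2 ≤ L) (b : Fin (L + 2) → ℝ) (hb : ∑ x, b x = 0) :
    (L : ℝ) * ∑ σ : Equiv.Perm (Fin (L + 2)),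
      (∑ p : Fin L, b (σ (p.castAdd 2)) * b (σ (p.addNat 2))) ^ 2
    ≤ 10 * (Fintype.card (Equiv.Perm (Fin (L + 2))) * (∑ x, b x ^ 2) ^ 2) := by
  set U : ℝ := Fintype.card (Equiv.Perm (Fin (L + 2))) * (∑ x, b x ^ 2) ^ 2 with hU
  have hU0 : 0 ≤ U := by positivity
  obtain ⟨h22, h211, h1111⟩ := fourth_moments b hb (by simp; omega) (L + 2) U (by simp) hU
  have hL2 : (2:ℝ) ≤ L := by exact_mod_cast hL
  set x : ℝ := (L : ℝ) with hx
  set m2 := U / ((x + 2) * (x + 1)) with hm2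
  set m3 := U / ((x + 2) * (x + 1) * x) with hm3
  set m4 := 3 * U / ((x + 2) * (x + 1) * x * (x - 1)) with hm4
  have hx0 : 0 < x := by linarith
  have hx1 : 0 < x - 1 := by linarith
  have hm20 : 0 ≤ m2 := by positivity
  have hm30 : 0 ≤ m3 := by positivity
  have hm40 : 0 ≤ m4 := by positivity
  have e22 : ∀ p q : Fin (L + 2), p ≠ q →
      ∑ σ : Equiv.Perm (Fin (L + 2)), b (σ p) ^ 2 * b (σ q) ^ 2 ≤ m2 := by
    intro p q hpq
    rw [hm2, le_div_iff₀ (by positivity)]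
    have := h22 p q hpq
    linarith
  have e211 : ∀ p q r : Fin (L + 2), p ≠ q → p ≠ r → q ≠ r →
      ∑ σ : Equiv.Perm (Fin (L + 2)), b (σ p) ^ 2 * b (σ q) * b (σ r) ≤ m3 := by
    intro p q r h1 h2 h3
    rw [hm3, le_div_iff₀ (by positivity)]
    have := h211 p q r h1 h2 h3
    linarith
  have e1111 : ∀ p q r s : Fin (L + 2), p ≠ q → p ≠ r → q ≠ r → s ≠ p → s ≠ q → s ≠ r →
      ∑ σ : Equiv.Perm (Fin (L + 2)), b (σ p) * b (σ q) * b (σ r) * b (σ s) ≤ m4 := by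
    intro p q r s h1 h2 h3 h4 h5 h6
    rw [hm4, le_div_iff₀ (by positivity)]
    have := h1111 p q r s h1 h2 h3 h4 h5 h6
    linarith
  have expand : ∑ σ : Equiv.Perm (Fin (L + 2)),
      (∑ p : Fin L, b (σ (p.castAdd 2)) * b (σ (p.addNat 2))) ^ 2
      = ∑ p : Fin L, ∑ q : Fin L, ∑ σ : Equiv.Perm (Fin (L + 2)),
        (b (σ (p.castAdd 2)) * b (σ (p.addNat 2))) * (b (σ (q.castAdd 2)) * b (σ (q.addNat 2))) := by
    have e1 : ∀ σ ∈ (Finset.univ : Finset (Equiv.Perm (Fin (L + 2)))),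
        (∑ p : Fin L, b (σ (p.castAdd 2)) * b (σ (p.addNat 2))) ^ 2
        = ∑ p : Fin L, ∑ q : Fin L, (b (σ (p.castAdd 2)) * b (σ (p.addNat 2)))
          * (b (σ (q.castAdd 2)) * b (σ (q.addNat 2))) := by
      intro σ _
      rw [pow_two, Finset.sum_mul_sum]
    rw [Finset.sum_congr rfl e1, Finset.sum_comm]
    refine Finset.sum_congr rfl fun p _ => ?_
    rw [Finset.sum_comm]
  have bound : ∀ p q : Fin L, ∑ σ : Equiv.Perm (Fin (L + 2)),
        (b (σ (p.castAdd 2)) * b (σ (p.addNat 2))) * (b (σ (q.castAdd 2)) * b (σ (q.addNat 2)))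
      ≤ m4 + (if p = q then m2 else 0) + ((if (p : ℕ) + 2 = q then m3 else 0)
        + (if (q : ℕ) + 2 = p then m3 else 0)) := by
    intro p q
    have hne : ∀ p : Fin L, p.castAdd 2 ≠ p.addNat 2 := by
      intro p h; have := congrArg Fin.val h; simp at this
    by_cases h1 : p = q
    · subst h1
      simp only [if_true]
      have := e22 _ _ (hne p)
      have h2 : ∑ σ : Equiv.Perm (Fin (L + 2)), (b (σ (p.castAdd 2)) * b (σ (p.addNat 2)))
          * (b (σ (p.castAdd 2)) * b (σ (p.addNat 2)))
          = ∑ σ : Equiv.Perm (Fin (L + 2)), b (σ (p.castAdd 2)) ^ 2 * b (σ (p.addNat 2)) ^ 2 :=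
        Finset.sum_congr rfl fun σ _ => by ring
      rw [h2]
      split_ifs <;> linarith
    have h1' : (p : ℕ) ≠ q := fun h => h1 (Fin.ext h)
    simp only [h1, if_false]
    by_cases h2 : (p : ℕ) + 2 = q
    · have h3 : q.castAdd 2 = p.addNat 2 := Fin.ext (by simp [h2])
      have := e211 (p.addNat 2) (p.castAdd 2) (q.addNat 2) (hne p).symm
        (by rw [← h3]; exact hne q) (by intro h; have := congrArg Fin.val h; simp at this; omega)
      have h4 : ∑ σ : Equiv.Perm (Fin (L + 2)), (b (σ (p.castAdd 2)) * b (σ (p.addNat 2)))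
          * (b (σ (q.castAdd 2)) * b (σ (q.addNat 2)))
          = ∑ σ : Equiv.Perm (Fin (L + 2)), b (σ (p.addNat 2)) ^ 2 * b (σ (p.castAdd 2))
            * b (σ (q.addNat 2)) :=
        Finset.sum_congr rfl fun σ _ => by rw [h3]; ring
      rw [h4]; simp only [h2, if_true]
      split_ifs <;> linarith
    by_cases h5 : (q : ℕ) + 2 = p
    · have h3 : p.castAdd 2 = q.addNat 2 := Fin.ext (by simp [h5])
      have := e211 (q.addNat 2) (q.castAdd 2) (p.addNat 2) (hne q).symm
        (by rw [← h3]; exact hne p) (by intro h; have := congrArg Fin.val h; simp at this; omega)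
      have h4 : ∑ σ : Equiv.Perm (Fin (L + 2)), (b (σ (p.castAdd 2)) * b (σ (p.addNat 2)))
          * (b (σ (q.castAdd 2)) * b (σ (q.addNat 2)))
          = ∑ σ : Equiv.Perm (Fin (L + 2)), b (σ (q.addNat 2)) ^ 2 * b (σ (q.castAdd 2))
            * b (σ (p.addNat 2)) :=
        Finset.sum_congr rfl fun σ _ => by rw [h3]; ring
      rw [h4]; simp only [h5, if_true, h2, if_false]
      linarith
    · have := e1111 (p.castAdd 2) (p.addNat 2) (q.castAdd 2) (q.addNat 2) (hne p)
        (by intro h; have := congrArg Fin.val h; simp at this; omega)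
        (by intro h; have := congrArg Fin.val h; simp at this; omega)
        (by intro h; have := congrArg Fin.val h; simp at this; omega)
        (by intro h; have := congrArg Fin.val h; simp at this; omega)
        (hne q).symm
      have h4 : ∑ σ : Equiv.Perm (Fin (L + 2)), (b (σ (p.castAdd 2)) * b (σ (p.addNat 2)))
          * (b (σ (q.castAdd 2)) * b (σ (q.addNat 2)))
          = ∑ σ : Equiv.Perm (Fin (L + 2)), b (σ (p.castAdd 2)) * b (σ (p.addNat 2))
          * b (σ (q.castAdd 2)) * b (σ (q.addNat 2)) :=
        Finset.sum_congr rfl fun σ _ => by ring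
      rw [h4]; simp only [h5, h2, if_false]
      linarith
  have tot : ∑ p : Fin L, ∑ q : Fin L, (m4 + (if p = q then m2 else 0)
      + ((if (p : ℕ) + 2 = q then m3 else 0) + (if (q : ℕ) + 2 = p then m3 else 0)))
      ≤ x * (x * m4 + m2 + 2 * m3) := by
    have one : ∀ (p : Fin L) (φ : Fin L → Prop) [DecidablePred φ],
        (∀ a b, φ a → φ b → a = b) → ∑ q : Fin L, (if φ q then m3 else 0) ≤ m3 := by
      intro p φ _ hφ
      rw [← Finset.sum_filter, Finset.sum_const, nsmul_eq_mul]
      have : ((Finset.univ.filter φ).card : ℝ) ≤ 1 := by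
        exact_mod_cast Finset.card_le_one.2 (by simpa using fun a ha b hb => hφ a b ha hb)
      nlinarith
    have : ∀ p ∈ (Finset.univ : Finset (Fin L)), ∑ q : Fin L, (m4 + (if p = q then m2 else 0)
      + ((if (p : ℕ) + 2 = q then m3 else 0) + (if (q : ℕ) + 2 = p then m3 else 0)))
      ≤ x * m4 + m2 + 2 * m3 := by
      intro p _
      simp only [Finset.sum_add_distrib]
      have h1 := one p (fun q => (p : ℕ) + 2 = q) (fun a b ha hb => Fin.ext (by omega))
      have h2 := one p (fun q => (q : ℕ) + 2 = p) (fun a b ha hb => Fin.ext (by omega))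
      simp only [Finset.sum_ite_eq, Finset.mem_univ, if_true, Finset.sum_const, Finset.card_univ,
        Fintype.card_fin, nsmul_eq_mul]
      linarith
    refine (Finset.sum_le_sum this).trans ?_
    rw [Finset.sum_const, Finset.card_univ, Fintype.card_fin, nsmul_eq_mul]
  rw [expand]
  have step := (Finset.sum_le_sum fun p (_ : p ∈ Finset.univ) =>
    Finset.sum_le_sum fun q (_ : q ∈ Finset.univ) => bound p q).trans tot
  refine (mul_le_mul_of_nonneg_left step hx0.le).trans ?_
  have i2 : x * x * m2 ≤ U := by
    rw [hm2, ← mul_div_assoc, div_le_iff₀ (by positivity)]; nlinarith [mul_nonneg hU0 hx0.le]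
  have i3 : x * x * m3 ≤ U := by
    rw [hm3, ← mul_div_assoc, div_le_iff₀ (by positivity)]
    nlinarith [mul_nonneg hU0 hx0.le, mul_nonneg (mul_nonneg hU0 hx0.le) hx0.le,
      mul_nonneg (mul_nonneg (mul_nonneg hU0 hx0.le) hx0.le) hx0.le]
  have i4 : x * x * x * m4 ≤ 6 * U := by
    rw [hm4, ← mul_div_assoc, div_le_iff₀ (by positivity)]
    have : 0 ≤ U * ((x + 2) * (x + 1) * x * (x - 1) * 6 - 3 * (x * x * x)) := by
      apply mul_nonneg hU0
      have : x * x * x ≤ (x + 2) * (x + 1) * x * (x - 1) := by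
        have h : x * x ≤ (x+2) * (x+1) * (x-1) := by nlinarith [mul_pos hx0 hx0]
        nlinarith
      nlinarith [mul_pos (mul_pos hx0 hx0) hx0]
    nlinarith
  nlinarith

end PartA2

section PartA3

/-- truncation to `[-η, η]` -/
noncomputable def clip (η x : ℝ) : ℝ := max (-η) (min η x)

lemma clip_mono (η : ℝ) : Monotone (clip η) := fun _ _ h =>
  max_le_max le_rfl (min_le_min le_rfl h)

lemma clip_le {η x : ℝ} (h : 0 ≤ η) : clip η x ≤ η := max_le (by linarith) (min_le_left _ _)

lemma neg_le_clip (η x : ℝ) : -η ≤ clip η x := le_max_left _ _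

lemma abs_clip_le {η x : ℝ} (h : 0 ≤ η) : |clip η x| ≤ η :=
  abs_le.2 ⟨neg_le_clip _ _, clip_le h⟩

lemma clip_of_abs_le {η x : ℝ} (h : |x| ≤ η) : clip η x = x := by
  have := abs_le.1 h
  unfold clip
  rw [min_eq_right this.2, max_eq_right this.1]

lemma clip_of_ge {η x : ℝ} (hη : 0 ≤ η) (h : η ≤ x) : clip η x = η := by
  unfold clip
  rw [min_eq_left h, max_eq_right (by linarith)]

lemma clip_of_le {η x : ℝ} (h : x ≤ -η) : clip η x = -η := by
  unfold clip
  exact max_eq_left ((min_le_right _ _).trans h)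

lemma clip_sub_le {η x y : ℝ} (h : x ≤ y) : clip η y - clip η x ≤ y - x := by
  unfold clip
  rcases max_cases (-η) (min η x) with h1 | h1 <;> rcases max_cases (-η) (min η y) with h2 | h2 <;>
  rcases min_cases η x with h3 | h3 <;> rcases min_cases η y with h4 | h4 <;> linarith

lemma abs_clip_sub_le (η x y : ℝ) : |clip η x - clip η y| ≤ |x - y| := by
  rcases le_total x y with h | h
  · rw [abs_sub_comm, abs_sub_comm x y, abs_of_nonneg (by linarith [clip_mono η h]),
      abs_of_nonneg (by linarith)]
    exact clip_sub_le h
  · rw [abs_of_nonneg (by linarith [clip_mono η h]), abs_of_nonneg (by linarith)]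
    exact clip_sub_le h

lemma clip_between (η x y : ℝ) :
    0 ≤ (clip η x - clip η y) * ((x - y) - (clip η x - clip η y)) := by
  rcases le_total x y with h | h
  · have h1 := clip_mono η h
    have h2 := clip_sub_le (η := η) h
    exact mul_nonneg_of_nonpos_of_nonpos (by linarith) (by linarith)
  · have h1 := clip_mono η h
    have h2 := clip_sub_le (η := η) h
    exact mul_nonneg (by linarith) (by linarith)

lemma clip_step {ℓ t v z : ℝ} (h : 0 ≤ z * (v - z)) :
    0 ≤ z * (clip (2 * ℓ) (t + v) - clip (2 * ℓ) t) ∧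
    (|z| ≤ ℓ → |t| ≤ ℓ → z ^ 2 ≤ z * (clip (2 * ℓ) (t + v) - clip (2 * ℓ) t)) := by
  have aux : |z| ≤ ℓ → |t| ≤ ℓ → clip (2 * ℓ) t = t ∧ clip (2 * ℓ) (t + z) = t + z := by
    intro h1 h2
    have := abs_nonneg z
    have h3 := abs_add_le t z
    exact ⟨clip_of_abs_le (by linarith), clip_of_abs_le (by linarith)⟩
  rcases lt_trichotomy z 0 with hz | hz | hz
  · have hv : v ≤ z := by nlinarith
    have h1 : clip (2 * ℓ) (t + v) ≤ clip (2 * ℓ) (t + z) := clip_mono _ (by linarith)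
    have h2 : clip (2 * ℓ) (t + z) ≤ clip (2 * ℓ) t := clip_mono _ (by linarith)
    refine ⟨mul_nonneg_of_nonpos_of_nonpos hz.le (by linarith), fun h3 h4 => ?_⟩
    obtain ⟨h5, h6⟩ := aux h3 h4
    nlinarith
  · subst hz; simp
  · have hv : z ≤ v := by nlinarith
    have h1 : clip (2 * ℓ) (t + z) ≤ clip (2 * ℓ) (t + v) := clip_mono _ (by linarith)
    have h2 : clip (2 * ℓ) t ≤ clip (2 * ℓ) (t + z) := clip_mono _ (by linarith)
    refine ⟨mul_nonneg hz.le (by linarith), fun h3 h4 => ?_⟩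
    obtain ⟨h5, h6⟩ := aux h3 h4
    nlinarith

lemma sum_pair_sq_le {ι : Type*} (R : Finset ι) (g : ι → ℝ) :
    ∑ p ∈ R, ∑ q ∈ R, (g p - g q) ^ 2 ≤ 2 * R.card * ∑ p ∈ R, g p ^ 2 := by
  have : ∑ p ∈ R, ∑ q ∈ R, (g p - g q) ^ 2
      = 2 * R.card * ∑ p ∈ R, g p ^ 2 - 2 * (∑ p ∈ R, g p) ^ 2 := by
    have e : ∀ p ∈ R, ∑ q ∈ R, (g p - g q) ^ 2
        = R.card * g p ^ 2 + ∑ q ∈ R, g q ^ 2 - 2 * g p * ∑ q ∈ R, g q := by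
      intro p _
      rw [Finset.mul_sum]
      have : (R.card : ℝ) * g p ^ 2 = ∑ q ∈ R, g p ^ 2 := by simp
      rw [this, ← Finset.sum_add_distrib, ← Finset.sum_sub_distrib]
      exact Finset.sum_congr rfl fun q _ => by ring
    rw [Finset.sum_congr rfl e, Finset.sum_sub_distrib, Finset.sum_add_distrib, ← Finset.mul_sum,
      ← Finset.sum_mul, ← Finset.mul_sum]
    simp; ring
  rw [this]; nlinarith [sq_nonneg (∑ p ∈ R, g p)]

/-- Cauchy-Schwarz in the form used below. -/
lemma sum_mul_le_of_sq {ι : Type*} (s : Finset ι) (f g : ι → ℝ) (A B : ℝ) (hA : 0 ≤ A) (hB : 0 ≤ B)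
    (hf : ∑ i ∈ s, f i ^ 2 ≤ A ^ 2) (hg : ∑ i ∈ s, g i ^ 2 ≤ B ^ 2) :
    ∑ i ∈ s, f i * g i ≤ A * B := by
  have h := Finset.sum_mul_sq_le_sq_mul_sq s f g
  have h1 : (∑ i ∈ s, f i * g i) ^ 2 ≤ (A * B) ^ 2 := by
    refine h.trans ?_
    rw [mul_pow]
    exact mul_le_mul hf hg (Finset.sum_nonneg fun _ _ => sq_nonneg _) (sq_nonneg _)
  exact le_of_sq_le_sq h1 (mul_nonneg hA hB) 

section coarse
variable {α : Type*} [DecidableEq α]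

set_option maxHeartbeats 1600000 in
lemma coarse {Ω : Finset (Equiv.Perm α)} {R : Finset α} (h : SwapInv Ω R) (hr : 2 ≤ R.card)
    (b w : α → ℝ) (T y : Equiv.Perm α → ℝ) (η ℓ Kr V Bb β Q κ s : ℝ)
    (hη : 0 ≤ η) (hV0 : 0 ≤ V) (hBb0 : 0 ≤ Bb) (hβ0 : 0 ≤ β) (hκ : κ = 1 ∨ κ = -1)
    (hrK : (R.card : ℝ) ≤ Kr) (hw : ∀ p ∈ R, |w p| ≤ Kr)
    (hT : ∀ σ ∈ Ω, ∀ p ∈ R, ∀ q ∈ R,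
      T (σ * Equiv.swap p q) = T σ + (w q - w p) * (b (σ p) - b (σ q)))
    (hy0 : ∀ σ, 0 ≤ y σ)
    (hy : ∀ σ ∈ Ω, ∀ p ∈ R, ∀ q ∈ R, |y (σ * Equiv.swap p q) - y σ| ≤ 2 * |b (σ p) - b (σ q)|)
    (hℓ : 4 * Kr * η ≤ ℓ)
    (hβ : ∀ σ ∈ Ω, ∑ p ∈ R, clip η (b (σ p)) ^ 2 = β ^ 2)
    (hs : ∀ σ ∈ Ω, ∑ p ∈ R, clip η (b (σ p)) = s)
    (hBb : ∀ σ ∈ Ω, ∑ p ∈ R, b (σ p) ^ 2 ≤ Bb ^ 2)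
    (hV : ∑ σ ∈ Ω, (if κ * T σ ≤ 2 * ℓ then y σ ^ 2 else 0) ≤ Ω.card * V ^ 2)
    (hlow : ∀ σ ∈ Ω, Q * β ^ 2 ≤ ∑ p ∈ R, ∑ q ∈ R,
      ((w q - w p) * (clip η (b (σ p)) - clip η (b (σ q)))) ^ 2) :
    Q * β ^ 2 * ∑ σ ∈ Ω, (if |T σ| ≤ ℓ then y σ else 0)
      ≤ Ω.card * (48 * ℓ * Kr ^ 2 * β * (Bb + V)) := by
  have hr2 : (2:ℝ) ≤ R.card := by exact_mod_cast hr
  have hKr : 0 < Kr := by linarith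
  have hℓ0 : 0 ≤ ℓ := le_trans (by positivity) hℓ
  set r : ℝ := (R.card : ℝ) with hrdef
  set n : ℝ := (Ω.card : ℝ) with hn
  have hn0 : 0 ≤ n := Nat.cast_nonneg _
  set f : Equiv.Perm α → ℝ := fun σ => clip (2 * ℓ) (T σ) - κ * (2 * ℓ) with hf
  have hfb : ∀ σ, |f σ| ≤ 4 * ℓ := by
    intro σ
    have := abs_clip_le (η := 2 * ℓ) (x := T σ) (by linarith)
    rw [abs_le] at this ⊢
    rcases hκ with rfl | rfl <;> simp only [hf] <;> constructor <;> linarith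
  have hf0 : ∀ σ, ¬ (κ * T σ ≤ 2 * ℓ) → f σ = 0 := by
    intro σ hσ
    push Not at hσ
    rcases hκ with rfl | rfl
    · simp only [hf]; rw [clip_of_ge (by linarith) (by linarith)]; ring
    · simp only [hf]; rw [clip_of_le (by linarith)]; ring
  set γ : α → ℝ := fun z => clip η (b z) with hγ
  set W : ℝ := ∑ p ∈ R, w p with hW
  set c : α → ℝ := fun p => 2 * (W - r * w p) with hc
  -- the swap identity summed up
  have main : ∑ σ ∈ Ω, ∑ p ∈ R, ∑ q ∈ R, (w q - w p) * ((γ (σ p) - γ (σ q)) *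
        (y (σ * Equiv.swap p q) * f (σ * Equiv.swap p q) - y σ * f σ))
      = -2 * ∑ σ ∈ Ω, (y σ * f σ) * ∑ p ∈ R, c p * γ (σ p) := by
    have e1 : ∑ σ ∈ Ω, ∑ p ∈ R, ∑ q ∈ R, (w q - w p) * ((γ (σ p) - γ (σ q)) *
        (y (σ * Equiv.swap p q) * f (σ * Equiv.swap p q) - y σ * f σ))
        = ∑ p ∈ R, ∑ q ∈ R, (w q - w p) * ∑ σ ∈ Ω, (γ (σ p) - γ (σ q)) *
        (y (σ * Equiv.swap p q) * f (σ * Equiv.swap p q) - y σ * f σ) := by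
      rw [Finset.sum_comm]
      refine Finset.sum_congr rfl fun p _ => ?_
      rw [Finset.sum_comm]
      refine Finset.sum_congr rfl fun q _ => by rw [Finset.mul_sum]
    have e2 : ∑ p ∈ R, ∑ q ∈ R, (w q - w p) * ∑ σ ∈ Ω, (γ (σ p) - γ (σ q)) *
        (y (σ * Equiv.swap p q) * f (σ * Equiv.swap p q) - y σ * f σ)
        = ∑ p ∈ R, ∑ q ∈ R, ∑ σ ∈ Ω, -2 * (y σ * f σ) *
          ((w q - w p) * (γ (σ p) - γ (σ q))) := by
      refine Finset.sum_congr rfl fun p hp => Finset.sum_congr rfl fun q hq => ?_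
      rw [h.swap_id hp hq γ (fun σ => y σ * f σ), Finset.mul_sum, Finset.mul_sum]
      refine Finset.sum_congr rfl fun σ _ => by ring
    have e3 : ∑ p ∈ R, ∑ q ∈ R, ∑ σ ∈ Ω, -2 * (y σ * f σ) *
          ((w q - w p) * (γ (σ p) - γ (σ q)))
        = ∑ σ ∈ Ω, ∑ p ∈ R, ∑ q ∈ R, -2 * (y σ * f σ) *
          ((w q - w p) * (γ (σ p) - γ (σ q))) := by
      rw [Finset.sum_comm]
      symm
      rw [Finset.sum_comm]
      rw [Finset.sum_comm]
      symm
      rw [Finset.sum_comm]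
      have : ∀ x ∈ R, ∑ y_1 ∈ R, ∑ σ ∈ Ω, -2 * (y σ * f σ) * ((w y_1 - w x) * (γ (σ x) - γ (σ y_1)))
        = ∑ σ ∈ Ω, ∑ y_1 ∈ R, -2 * (y σ * f σ) * ((w y_1 - w x) * (γ (σ x) - γ (σ y_1))) :=
        fun x _ => Finset.sum_comm
      rw [Finset.sum_congr rfl this, Finset.sum_comm]
    rw [e1, e2, e3, Finset.mul_sum]
    refine Finset.sum_congr rfl fun σ _ => ?_
    have e4 : ∑ p ∈ R, ∑ q ∈ R, (w q - w p) * (γ (σ p) - γ (σ q)) = ∑ p ∈ R, c p * γ (σ p) := by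
      have : ∀ p ∈ R, ∑ q ∈ R, (w q - w p) * (γ (σ p) - γ (σ q))
          = W * γ (σ p) - ∑ q ∈ R, w q * γ (σ q) - r * (w p * γ (σ p))
            + w p * ∑ q ∈ R, γ (σ q) := by
        intro p _
        rw [hW, Finset.sum_mul, Finset.mul_sum]
        have : r * (w p * γ (σ p)) = ∑ q ∈ R, w p * γ (σ p) := by simp [hrdef]
        rw [this, ← Finset.sum_sub_distrib, ← Finset.sum_sub_distrib, ← Finset.sum_add_distrib]
        refine Finset.sum_congr rfl fun q _ => by ring
      rw [Finset.sum_congr rfl this, Finset.sum_add_distrib, Finset.sum_sub_distrib,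
        Finset.sum_sub_distrib, ← Finset.mul_sum, ← Finset.mul_sum, ← Finset.sum_mul,
        Finset.sum_const, nsmul_eq_mul]
      have : ∑ p ∈ R, c p * γ (σ p) = 2 * W * ∑ p ∈ R, γ (σ p)
          - 2 * r * ∑ p ∈ R, w p * γ (σ p) := by
        rw [Finset.mul_sum R (fun p => γ (σ p)) (2 * W),
          Finset.mul_sum R (fun p => w p * γ (σ p)) (2 * r), ← Finset.sum_sub_distrib]
        refine Finset.sum_congr rfl fun q _ => by simp only [hc]; ring
      rw [this]; ring
    simp only [← Finset.mul_sum]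
    rw [e4]; ring
  -- pointwise lower bound
  have low : ∀ σ ∈ Ω, Q * β ^ 2 * (if |T σ| ≤ ℓ then y σ else 0) - 32 * Kr ^ 2 * ℓ * β * Bb
      ≤ ∑ p ∈ R, ∑ q ∈ R, (w q - w p) * ((γ (σ p) - γ (σ q)) *
        (y (σ * Equiv.swap p q) * f (σ * Equiv.swap p q) - y σ * f σ)) := by
    intro σ hσ
    have hpair : ∀ p ∈ R, ∀ q ∈ R,
        (if |T σ| ≤ ℓ then y σ else 0) * ((w q - w p) * (γ (σ p) - γ (σ q))) ^ 2
          - 16 * Kr * ℓ * (|γ (σ p) - γ (σ q)| * |b (σ p) - b (σ q)|)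
        ≤ (w q - w p) * ((γ (σ p) - γ (σ q)) *
        (y (σ * Equiv.swap p q) * f (σ * Equiv.swap p q) - y σ * f σ)) := by
      intro p hp q hq
      set d := w q - w p with hd
      set u := b (σ p) - b (σ q) with hu
      set g := γ (σ p) - γ (σ q) with hg
      have hbt : 0 ≤ g * (u - g) := clip_between η (b (σ p)) (b (σ q))
      have hd2 : |d| ≤ 2 * Kr := by
        have := abs_le.1 (hw p hp); have := abs_le.1 (hw q hq)
        rw [abs_le]; constructor <;> linarith
      have hg2 : |g| ≤ 2 * η := by
        have h1 := abs_le.1 (abs_clip_le (x := b (σ p)) hη)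
        have h2 := abs_le.1 (abs_clip_le (x := b (σ q)) hη)
        rw [abs_le]; constructor <;> simp only [hg, hγ] <;> linarith
      have hz : |d * g| ≤ ℓ := by
        rw [abs_mul]
        have := mul_le_mul hd2 hg2 (abs_nonneg _) (by positivity)
        linarith
      have hst := clip_step (ℓ := ℓ) (t := T σ) (v := d * u) (z := d * g)
        (by nlinarith [sq_nonneg d, mul_nonneg (sq_nonneg d) hbt])
      set f' := f (σ * Equiv.swap p q) with hf'
      set y' := y (σ * Equiv.swap p q) with hy'
      have hff : f' - f σ = clip (2 * ℓ) (T σ + d * u) - clip (2 * ℓ) (T σ) := by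
        simp only [hf', hf, hT σ hσ p hp q hq, hd, hu]; ring
      rw [← hff] at hst
      have herr : |d * g * ((y' - y σ) * f')| ≤ 16 * Kr * ℓ * (|g| * |u|) := by
        rw [abs_mul, abs_mul, abs_mul]
        have h1 := hy σ hσ p hp q hq
        have h2 := hfb (σ * Equiv.swap p q)
        calc |d| * |g| * (|y' - y σ| * |f'|) ≤ (2 * Kr) * |g| * ((2 * |u|) * (4 * ℓ)) := by
              gcongr
          _ = _ := by ring
      have herr2 := (abs_le.1 herr).1
      have heq : d * (g * (y' * f' - y σ * f σ)) = y σ * (d * g * (f' - f σ))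
          + d * g * ((y' - y σ) * f') := by ring
      rw [heq]
      have : (if |T σ| ≤ ℓ then y σ else 0) * (d * g) ^ 2 ≤ y σ * (d * g * (f' - f σ)) := by
        split_ifs with hc
        · exact mul_le_mul_of_nonneg_left (hst.2 hz hc) (hy0 σ)
        · rw [zero_mul]; exact mul_nonneg (hy0 σ) hst.1
      linarith
    refine le_trans ?_ (Finset.sum_le_sum fun p hp => Finset.sum_le_sum fun q hq => hpair p hp q hq)
    simp only [Finset.sum_sub_distrib, ← Finset.mul_sum]
    have h1 := hlow σ hσ
    have h2 : 0 ≤ (if |T σ| ≤ ℓ then y σ else 0) := by split_ifs; exacts [hy0 σ, le_rfl]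
    have h3 := mul_le_mul_of_nonneg_left h1 h2
    have h4 : ∑ p ∈ R, ∑ q ∈ R, |γ (σ p) - γ (σ q)| * |b (σ p) - b (σ q)| ≤ 2 * Kr * β * Bb := by
      rw [← Finset.sum_product']
      have hs2 : 0 ≤ √(2 * Kr) := Real.sqrt_nonneg _
      have hs3 : √(2 * Kr) ^ 2 = 2 * Kr := Real.sq_sqrt (by positivity)
      refine (sum_mul_le_of_sq _ _ _ (√(2 * Kr) * β) (√(2 * Kr) * Bb) (by positivity)
        (by positivity) ?_ ?_).trans (le_of_eq ?_)
      · rw [Finset.sum_product' R R (fun p q => |γ (σ p) - γ (σ q)| ^ 2)]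
        simp only [sq_abs]
        refine (sum_pair_sq_le R (fun p => γ (σ p))).trans ?_
        rw [hβ σ hσ, mul_pow, hs3]
        gcongr
      · rw [Finset.sum_product' R R (fun p q => |b (σ p) - b (σ q)| ^ 2)]
        simp only [sq_abs]
        refine (sum_pair_sq_le R (fun p => b (σ p))).trans ?_
        rw [mul_pow, hs3]
        have := hBb σ hσ
        gcongr
      · linear_combination β * Bb * hs3
    have h5 : 16 * Kr * ℓ * ∑ p ∈ R, ∑ q ∈ R, |γ (σ p) - γ (σ q)| * |b (σ p) - b (σ q)|
        ≤ 16 * Kr * ℓ * (2 * Kr * β * Bb) := mul_le_mul_of_nonneg_left h4 (by positivity)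
    simp only [hγ] at h3 h5 ⊢
    linarith
  have low2 := Finset.sum_le_sum low
  rw [main, Finset.sum_sub_distrib, ← Finset.mul_sum, Finset.sum_const, nsmul_eq_mul] at low2
  -- the D term
  have hD2 : ∑ σ ∈ Ω, (∑ p ∈ R, c p * γ (σ p)) ^ 2 ≤ n * (6 * Kr ^ 2 * β) ^ 2 := by
    have hc0 : ∑ p ∈ R, c p = 0 := by
      simp only [hc]
      rw [← Finset.mul_sum, Finset.sum_sub_distrib, ← Finset.mul_sum, Finset.sum_const,
        nsmul_eq_mul]
      ring
    have h1 := h.second_moment_le' γ c (β ^ 2) s hr hc0 hβ hs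
    have h2 : ∑ p ∈ R, c p ^ 2 ≤ r * (4 * r * Kr) ^ 2 := by
      have : ∀ p ∈ R, c p ^ 2 ≤ (4 * r * Kr) ^ 2 := by
        intro p hp
        apply sq_le_sq'
        all_goals
          have hW2 : |W| ≤ r * Kr := by
            refine (Finset.abs_sum_le_sum_abs _ _).trans ?_
            refine (Finset.sum_le_sum hw).trans ?_
            simp [hrdef]
          have := abs_le.1 hW2
          have h3 := abs_le.1 (hw p hp)
          have := mul_le_mul_of_nonneg_left h3.1 (show 0 ≤ r by linarith)
          have := mul_le_mul_of_nonneg_left h3.2 (show 0 ≤ r by linarith)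
          simp only [hc]
          linarith
      refine (Finset.sum_le_sum this).trans ?_
      simp [hrdef]
    have hS0 : 0 ≤ ∑ σ ∈ Ω, (∑ p ∈ R, c p * γ (σ p)) ^ 2 :=
      Finset.sum_nonneg fun _ _ => sq_nonneg _
    set S2 := ∑ σ ∈ Ω, (∑ p ∈ R, c p * γ (σ p)) ^ 2 with hS2
    have h3 : (r - 1) * S2 ≤ n * (β ^ 2 * (r * (4 * r * Kr) ^ 2)) :=
      h1.trans (by gcongr)
    have h4 : r / 2 * S2 ≤ (r - 1) * S2 := by
      apply mul_le_mul_of_nonneg_right _ hS0; linarith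
    have h5 : r * S2 ≤ r * (n * β ^ 2 * (32 * r ^ 2 * Kr ^ 2)) := by nlinarith
    have h6 := le_of_mul_le_mul_left h5 (by linarith)
    refine h6.trans ?_
    have h7 : r ^ 2 ≤ Kr ^ 2 := by gcongr
    calc n * β ^ 2 * (32 * r ^ 2 * Kr ^ 2) ≤ n * β ^ 2 * (32 * Kr ^ 2 * Kr ^ 2) := by gcongr
      _ ≤ n * β ^ 2 * (36 * Kr ^ 2 * Kr ^ 2) := by gcongr; norm_num
      _ = _ := by ring
  have hterm : -2 * ∑ σ ∈ Ω, (y σ * f σ) * ∑ p ∈ R, c p * γ (σ p)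
      ≤ n * (48 * ℓ * Kr ^ 2 * β * V) := by
    have h1 : ∀ σ ∈ Ω, -2 * ((y σ * f σ) * ∑ p ∈ R, c p * γ (σ p))
        ≤ 8 * ℓ * ((if κ * T σ ≤ 2 * ℓ then y σ else 0) * |∑ p ∈ R, c p * γ (σ p)|) := by
      intro σ _
      set D := ∑ p ∈ R, c p * γ (σ p) with hD
      split_ifs with hA
      · have h2 : |y σ * f σ * D| ≤ y σ * (4 * ℓ) * |D| := by
          rw [abs_mul, abs_mul, abs_of_nonneg (hy0 σ)]
          have := hfb σ
          have := hy0 σ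
          gcongr
        have := (abs_le.1 h2).1
        linarith
      · rw [hf0 σ hA]; simp
    rw [Finset.mul_sum]
    refine (Finset.sum_le_sum h1).trans ?_
    rw [← Finset.mul_sum]
    have hn2 : √n ^ 2 = n := Real.sq_sqrt hn0
    have h3 := sum_mul_le_of_sq Ω (fun σ => if κ * T σ ≤ 2 * ℓ then y σ else 0)
      (fun σ => |∑ p ∈ R, c p * γ (σ p)|) (√n * V) (√n * (6 * Kr ^ 2 * β)) (by positivity)
      (by positivity) (by
        rw [mul_pow, hn2]
        refine le_trans (le_of_eq ?_) hV
        refine Finset.sum_congr rfl fun σ _ => ?_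
        split_ifs <;> simp) (by
        rw [mul_pow, hn2]; simpa only [sq_abs] using hD2)
    have h4 := mul_le_mul_of_nonneg_left h3 (show 0 ≤ 8 * ℓ by linarith)
    refine h4.trans (le_of_eq ?_)
    linear_combination 48 * ℓ * V * Kr ^ 2 * β * hn2
  have h9 : n * (32 * Kr ^ 2 * ℓ * β * Bb) ≤ n * (48 * ℓ * Kr ^ 2 * β * Bb) := by
    apply mul_le_mul_of_nonneg_left _ hn0
    have : 0 ≤ ℓ * Kr ^ 2 * β * Bb := by positivity
    linarith
  linarith

end coarse

end PartA3

section PartA4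

lemma lin_swap {α : Type*} [DecidableEq α] [Fintype α] (c f : α → ℝ) (σ : Equiv.Perm α) (p q : α) :
    ∑ i, c i * f ((σ * Equiv.swap p q) i) = ∑ i, c i * f (σ i) + (c q - c p) * (f (σ p) - f (σ q)) := by
  by_cases hpq : p = q
  · subst hpq; simp
  have h1 : ∑ i, c i * f ((σ * Equiv.swap p q) i) = ∑ i, c (Equiv.swap p q i) * f (σ i) := by
    rw [← Equiv.sum_comp (Equiv.swap p q)]
    refine Finset.sum_congr rfl fun i _ => by simp
  have hq : q ∈ (Finset.univ : Finset α).erase p := by simp [Ne.symm hpq]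
  rw [h1, ← Finset.add_sum_erase _ _ (Finset.mem_univ p),
    ← Finset.add_sum_erase _ _ hq,
    ← Finset.add_sum_erase Finset.univ (fun i => c i * f (σ i)) (Finset.mem_univ p),
    ← Finset.add_sum_erase _ (fun i => c i * f (σ i)) hq]
  have : ∀ i ∈ ((Finset.univ : Finset α).erase p).erase q,
      c (Equiv.swap p q i) * f (σ i) = c i * f (σ i) := by
    intro i hi
    simp only [Finset.mem_erase] at hi
    rw [Equiv.swap_apply_of_ne_of_ne hi.2.1 hi.1]
  rw [Finset.sum_congr rfl this]
  simp; ring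

lemma exists_median {α : Type*} [Fintype α] [Nonempty α] (a : α → ℝ) :
    ∃ m : ℝ, Fintype.card α ≤ 2 * (Finset.univ.filter fun x => m ≤ a x).card ∧
      Fintype.card α ≤ 2 * (Finset.univ.filter fun x => a x ≤ m).card := by
  classical
  set G := Finset.univ.filter fun x : α =>
    Fintype.card α ≤ 2 * (Finset.univ.filter fun z => a x ≤ a z).card with hG
  have hne : G.Nonempty := by
    obtain ⟨x, hx⟩ := Finite.exists_min a
    refine ⟨x, ?_⟩
    simp only [hG, Finset.mem_filter, Finset.mem_univ, true_and]
    rw [Finset.filter_true_of_mem (fun z _ => hx z), Finset.card_univ]; omega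
  obtain ⟨x0, hx0, hmax⟩ := Finset.exists_max_image G a hne
  refine ⟨a x0, (Finset.mem_filter.1 hx0).2, ?_⟩
  have hsplit := Finset.card_filter_add_card_filter_not (s := (Finset.univ : Finset α))
    (fun x => a x ≤ a x0)
  rw [Finset.card_univ] at hsplit
  by_contra hlt
  push Not at hlt
  set H := Finset.univ.filter (fun x => ¬ a x ≤ a x0) with hH
  have hHne : H.Nonempty := by
    rw [← Finset.card_pos]; omega
  obtain ⟨y, hy, hmin⟩ := Finset.exists_min_image H a hHne
  have hyH := (Finset.mem_filter.1 hy).2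
  have : y ∈ G := by
    simp only [hG, Finset.mem_filter, Finset.mem_univ, true_and]
    have hsub : H ⊆ Finset.univ.filter fun z => a y ≤ a z := by
      intro z hz
      simp only [Finset.mem_filter, Finset.mem_univ, true_and]
      exact hmin z hz
    have := Finset.card_le_card hsub
    omega
  exact hyH (hmax y this)

/-- for every point there are many points of opposite sign -/
lemma opp_card {α : Type*} [Fintype α] (b : α → ℝ)
    (h1 : Fintype.card α ≤ 2 * (Finset.univ.filter fun x => 0 ≤ b x).card)
    (h2 : Fintype.card α ≤ 2 * (Finset.univ.filter fun x => b x ≤ 0).card) (x : α) :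
    Fintype.card α ≤ 2 * (Finset.univ.filter fun z => b x * b z ≤ 0).card := by
  rcases le_total 0 (b x) with h | h
  · refine h2.trans (Nat.mul_le_mul le_rfl (Finset.card_le_card ?_))
    intro z hz
    simp only [Finset.mem_filter, Finset.mem_univ, true_and] at hz ⊢
    exact mul_nonpos_of_nonneg_of_nonpos h hz
  · refine h1.trans (Nat.mul_le_mul le_rfl (Finset.card_le_card ?_))
    intro z hz
    simp only [Finset.mem_filter, Finset.mem_univ, true_and] at hz ⊢
    exact mul_nonpos_of_nonpos_of_nonneg h hz

lemma median_sq {α : Type*} [Fintype α] [Nonempty α] (a : α → ℝ) (m u : ℝ)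
    (h1 : Fintype.card α ≤ 2 * (Finset.univ.filter fun x => 0 ≤ a x - m).card)
    (h2 : Fintype.card α ≤ 2 * (Finset.univ.filter fun x => a x - m ≤ 0).card) :
    ∑ x, (a x - m) ^ 2 ≤ 4 * ∑ x, (a x - u) ^ 2 := by
  have h3 := opp_card (fun x => a x - m) h1 h2
  have hup := sum_pair_sq_le Finset.univ (fun x => a x - u)
  have hK : (0:ℝ) < Fintype.card α := by exact_mod_cast Fintype.card_pos
  have hlow : ∀ x ∈ (Finset.univ : Finset α),
      (Fintype.card α : ℝ) / 2 * (a x - m) ^ 2 ≤ ∑ z, ((a x - u) - (a z - u)) ^ 2 := by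
    intro x _
    have h4 : (Fintype.card α : ℝ) ≤
        2 * ((Finset.univ.filter fun z => (a x - m) * (a z - m) ≤ 0).card : ℝ) := by
      exact_mod_cast h3 x
    calc (Fintype.card α : ℝ) / 2 * (a x - m) ^ 2
        ≤ ((Finset.univ.filter fun z => (a x - m) * (a z - m) ≤ 0).card : ℝ) * (a x - m) ^ 2 := by
          apply mul_le_mul_of_nonneg_right _ (sq_nonneg _); linarith
      _ = ∑ z ∈ Finset.univ.filter (fun z => (a x - m) * (a z - m) ≤ 0), (a x - m) ^ 2 := by
          rw [Finset.sum_const, nsmul_eq_mul]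
      _ ≤ ∑ z ∈ Finset.univ.filter (fun z => (a x - m) * (a z - m) ≤ 0),
          ((a x - u) - (a z - u)) ^ 2 := by
          refine Finset.sum_le_sum fun z hz => ?_
          simp only [Finset.mem_filter, Finset.mem_univ, true_and] at hz
          nlinarith [sq_nonneg (a z - m)]
      _ ≤ _ := Finset.sum_le_sum_of_subset_of_nonneg (Finset.filter_subset _ _)
          (fun _ _ _ => sq_nonneg _)
  have h5 := (Finset.sum_le_sum hlow).trans hup
  rw [← Finset.mul_sum, Finset.card_univ] at h5
  have : (Fintype.card α : ℝ) / 2 * ∑ x, (a x - m) ^ 2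
      ≤ (Fintype.card α : ℝ) / 2 * (4 * ∑ x, (a x - u) ^ 2) := by linarith
  exact le_of_mul_le_mul_left this (by linarith)

lemma near_card (K : ℕ) (p : Fin K) :
    ((Finset.univ.filter fun q : Fin K => 16 * |((p : ℕ) : ℝ) - (q : ℕ)| < K).card : ℝ)
      ≤ K / 8 + 1 := by
  have hsub : ((Finset.univ.filter fun q : Fin K => 16 * |((p : ℕ) : ℝ) - (q : ℕ)| < K).image
      (fun q : Fin K => (q : ℕ))) ⊆ Finset.Icc ((p : ℕ) - K / 16) ((p : ℕ) + K / 16) := by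
    intro x hx
    simp only [Finset.mem_image, Finset.mem_filter, Finset.mem_univ, true_and] at hx
    obtain ⟨q, hq, rfl⟩ := hx
    have h1 := (abs_le.1 (le_refl |((p : ℕ) : ℝ) - (q : ℕ)|))
    have h2 : 16 * ((p : ℕ) : ℝ) < K + 16 * (q : ℕ) := by linarith
    have h3 : 16 * ((q : ℕ) : ℝ) < K + 16 * (p : ℕ) := by linarith
    have h2' : 16 * (p : ℕ) < K + 16 * (q : ℕ) := by exact_mod_cast h2
    have h3' : 16 * (q : ℕ) < K + 16 * (p : ℕ) := by exact_mod_cast h3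
    rw [Finset.mem_Icc]; omega
  have h := Finset.card_le_card hsub
  rw [Finset.card_image_of_injective _ Fin.val_injective, Nat.card_Icc] at h
  have h' : 8 * (Finset.univ.filter fun q : Fin K => 16 * |((p : ℕ) : ℝ) - (q : ℕ)| < K).card
    ≤ K + 8 := by omega
  have h'' : (8:ℝ) * ((Finset.univ.filter fun q : Fin K =>
    16 * |((p : ℕ) : ℝ) - (q : ℕ)| < K).card : ℝ) ≤ K + 8 := by exact_mod_cast h'
  linarith

lemma clip_mul_nonpos {η x y : ℝ} (hη : 0 ≤ η) (h : x * y ≤ 0) : clip η x * clip η y ≤ 0 := by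
  have hz : clip η 0 = 0 := clip_of_abs_le (by simpa using hη)
  rcases le_total 0 x with hx | hx
  · rcases hx.eq_or_lt with rfl | hx'
    · simp [hz]
    have hy : y ≤ 0 := by by_contra hc; push Not at hc; nlinarith
    have h1 := clip_mono η hx; have h2 := clip_mono η hy
    rw [hz] at h1 h2
    exact mul_nonpos_of_nonneg_of_nonpos h1 h2
  · rcases hx.eq_or_lt with rfl | hx'
    · simp [hz]
    have hy : 0 ≤ y := by by_contra hc; push Not at hc; nlinarith
    have h1 := clip_mono η hx; have h2 := clip_mono η hy
    rw [hz] at h1 h2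
    exact mul_nonpos_of_nonpos_of_nonneg h1 h2

lemma low_pair (K : ℕ) (hK : 24 ≤ K) (b : Fin K → ℝ) (w : Fin K → ℝ) (η : ℝ) (hη : 0 ≤ η)
    (hw : ∀ p q : Fin K, |((p : ℕ) : ℝ) - (q : ℕ)| ≤ |w p - w q|)
    (h1 : Fintype.card (Fin K) ≤ 2 * (Finset.univ.filter fun x => 0 ≤ b x).card)
    (h2 : Fintype.card (Fin K) ≤ 2 * (Finset.univ.filter fun x => b x ≤ 0).card)
    (R : Finset (Fin K)) (hR : Rᶜ.card ≤ 2) (σ : Equiv.Perm (Fin K)) :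
    ((K : ℝ) ^ 3 / 1024) * ∑ p ∈ R, clip η (b (σ p)) ^ 2 ≤ ∑ p ∈ R, ∑ q ∈ R,
      ((w q - w p) * (clip η (b (σ p)) - clip η (b (σ q)))) ^ 2 := by
  rw [Finset.mul_sum]
  refine Finset.sum_le_sum fun p hp => ?_
  have hKr : (24:ℝ) ≤ K := by exact_mod_cast hK
  set O := Finset.univ.filter fun q : Fin K => b (σ p) * b (σ q) ≤ 0 with hO
  set N := Finset.univ.filter fun q : Fin K => 16 * |((p : ℕ) : ℝ) - (q : ℕ)| < K with hN
  have hOc : K ≤ 2 * O.card := by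
    have := opp_card b h1 h2 (σ p)
    rw [Fintype.card_fin] at this
    have e : (Finset.univ.filter fun z => b (σ p) * b z ≤ 0).card = O.card := by
      symm
      refine Finset.card_bij (fun q _ => σ q) ?_ ?_ ?_
      · intro q hq; simpa [hO] using hq
      · intro q _ q' _ h; exact σ.injective h
      · intro z hz; exact ⟨σ⁻¹ z, by simpa [hO] using hz, by simp⟩
    rwa [e] at this
  have hNc := near_card K p
  rw [← hN] at hNc
  set G := (O \ N) \ Rᶜ with hG
  have hGc : (K : ℝ) / 4 ≤ G.card := by
    have e1 := Finset.le_card_sdiff Rᶜ (O \ N)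
    have e2 := Finset.le_card_sdiff N O
    rw [← hG] at e1
    have e3 : (O.card : ℝ) ≤ G.card + N.card + 2 := by
      have : O.card ≤ G.card + N.card + 2 := by omega
      exact_mod_cast this
    have e4 : (K : ℝ) ≤ 2 * O.card := by exact_mod_cast hOc
    linarith
  have hGR : G ⊆ R := by
    intro q hq
    have := (Finset.mem_sdiff.1 hq).2
    simpa using this
  calc (K : ℝ) ^ 3 / 1024 * clip η (b (σ p)) ^ 2
      = (K : ℝ) / 4 * (((K : ℝ) / 16) ^ 2 * clip η (b (σ p)) ^ 2) := by ring
    _ ≤ G.card * (((K : ℝ) / 16) ^ 2 * clip η (b (σ p)) ^ 2) := by gcongr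
    _ = ∑ q ∈ G, (((K : ℝ) / 16) ^ 2 * clip η (b (σ p)) ^ 2) := by
        rw [Finset.sum_const, nsmul_eq_mul]
    _ ≤ ∑ q ∈ G, ((w q - w p) * (clip η (b (σ p)) - clip η (b (σ q)))) ^ 2 := by
        refine Finset.sum_le_sum fun q hq => ?_
        simp only [hG, hO, hN, Finset.mem_sdiff, Finset.mem_filter, Finset.mem_univ, true_and,
          not_lt] at hq
        rw [mul_pow]
        have e1 : (K : ℝ) / 16 ≤ |w q - w p| := by
          have := hw p q
          rw [abs_sub_comm (w q)]
          linarith [hq.1.2]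
        have e2 : ((K : ℝ) / 16) ^ 2 ≤ (w q - w p) ^ 2 := by
          rw [← sq_abs (w q - w p)]; gcongr
        have e3 : clip η (b (σ p)) ^ 2 ≤ (clip η (b (σ p)) - clip η (b (σ q))) ^ 2 := by
          have := clip_mul_nonpos hη hq.1.1
          nlinarith [sq_nonneg (clip η (b (σ q)))]
        gcongr
    _ ≤ _ := Finset.sum_le_sum_of_subset_of_nonneg hGR (fun _ _ _ => sq_nonneg _)

section fiber
variable {α : Type*} [DecidableEq α] [Fintype α]

/-- permutations with two prescribed values -/
def fib (i j x y : α) : Finset (Equiv.Perm α) := Finset.univ.filter fun σ => σ i = x ∧ σ j = y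

lemma fib_swapInv (i j x y : α) : SwapInv (fib i j x y) ({i, j}ᶜ : Finset α) := by
  intro σ hσ p hp q hq
  simp only [fib, Finset.mem_filter, Finset.mem_univ, true_and, Finset.mem_compl,
    Finset.mem_insert, Finset.mem_singleton, not_or] at *
  rw [Equiv.Perm.mul_apply, Equiv.Perm.mul_apply,
    Equiv.swap_apply_of_ne_of_ne (Ne.symm hp.1) (Ne.symm hq.1),
    Equiv.swap_apply_of_ne_of_ne (Ne.symm hp.2) (Ne.symm hq.2)]
  exact hσ

lemma fib_sum (i j x y : α) (hij : i ≠ j) (f : α → ℝ) (σ : Equiv.Perm α) (hσ : σ ∈ fib i j x y) :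
    ∑ p ∈ ({i, j}ᶜ : Finset α), f (σ p) = ∑ z, f z - f x - f y := by
  simp only [fib, Finset.mem_filter, Finset.mem_univ, true_and] at hσ
  have h := Finset.sum_add_sum_compl ({i, j} : Finset α) (fun p => f (σ p))
  rw [Finset.sum_pair hij, Equiv.sum_comp σ f, hσ.1, hσ.2] at h
  linarith

lemma fiber_moment (b : α → ℝ) (hb : ∑ x, b x = 0) (hK : 4 ≤ Fintype.card α) (c : α → ℝ) (M B : ℝ)
    (hM : ∀ p, |c p| ≤ M) (hB : 0 ≤ B) (hB2 : ∑ x, b x ^ 2 = B ^ 2) (i j x y : α) (hij : i ≠ j)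
    (hxy : x ≠ y) :
    ∑ σ ∈ fib i j x y, (∑ p, c p * b (σ p)) ^ 2 ≤ (fib i j x y).card * (20 * M ^ 2 * B ^ 2) := by
  set Ω := fib i j x y with hΩ
  set R : Finset α := {i, j}ᶜ with hR
  have hM0 : 0 ≤ M := (abs_nonneg _).trans (hM i)
  have hRc : R.card = Fintype.card α - 2 := by
    rw [hR, Finset.card_compl, Finset.card_pair hij]
  have hr : 2 ≤ R.card := by omega
  have hxB : ∀ z, |b z| ≤ B := by
    intro z
    apply abs_le_of_sq_le_sq _ hB
    rw [← hB2]
    exact Finset.single_le_sum (f := fun z => b z ^ 2) (fun _ _ => sq_nonneg _) (Finset.mem_univ z)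
  have hxy2 : b x ^ 2 + b y ^ 2 ≤ B ^ 2 := by
    rw [← hB2, ← Finset.sum_pair hxy (f := fun z => b z ^ 2)]
    exact Finset.sum_le_sum_of_subset_of_nonneg (Finset.subset_univ _) (fun _ _ _ => sq_nonneg _)
  have hm := (fib_swapInv i j x y).second_moment_le b c (B ^ 2 - b x ^ 2 - b y ^ 2)
    (0 - b x - b y) hr (by linarith)
    (fun σ hσ => by rw [fib_sum i j x y hij (fun z => b z ^ 2) σ hσ, hB2])
    (fun σ hσ => by rw [fib_sum i j x y hij b σ hσ, hb])
  rw [← hΩ, ← hR] at hm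
  have hc2 : ∑ p ∈ R, c p ^ 2 ≤ R.card * M ^ 2 := by
    have : ∀ p ∈ R, c p ^ 2 ≤ M ^ 2 := fun p _ => sq_le_sq' (abs_le.1 (hM p)).1 (abs_le.1 (hM p)).2
    refine (Finset.sum_le_sum this).trans ?_
    simp
  have hr2 : (2:ℝ) ≤ R.card := by exact_mod_cast hr
  set r : ℝ := (R.card : ℝ) with hrdef
  set S2 := ∑ σ ∈ Ω, (∑ p ∈ R, c p * b (σ p)) ^ 2 with hS2
  have hS20 : 0 ≤ S2 := Finset.sum_nonneg fun _ _ => sq_nonneg _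
  have hbnd : S2 ≤ Ω.card * (6 * M ^ 2 * B ^ 2) := by
    have h1 : (r - 1) * S2 ≤ Ω.card * ((3 * B ^ 2) * (r * M ^ 2)) := by
      refine hm.trans ?_
      gcongr
      nlinarith [sq_nonneg (b x - b y)]
    have h2 : r / 2 * S2 ≤ (r - 1) * S2 := by
      apply mul_le_mul_of_nonneg_right _ hS20; linarith
    have h3 : r * S2 ≤ r * (Ω.card * (6 * M ^ 2 * B ^ 2)) := by nlinarith
    exact le_of_mul_le_mul_left h3 (by linarith)
  have hpt : ∀ σ ∈ Ω, (∑ p, c p * b (σ p)) ^ 2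
      ≤ 8 * M ^ 2 * B ^ 2 + 2 * (∑ p ∈ R, c p * b (σ p)) ^ 2 := by
    intro σ _
    have h := Finset.sum_add_sum_compl ({i, j} : Finset α) (fun p => c p * b (σ p))
    rw [Finset.sum_pair hij] at h
    rw [← h]
    set u := c i * b (σ i) + c j * b (σ j) with hu
    have hu2 : |u| ≤ 2 * (M * B) := by
      refine (abs_add_le _ _).trans ?_
      rw [abs_mul, abs_mul]
      have e1 := mul_le_mul (hM i) (hxB (σ i)) (abs_nonneg _) hM0
      have e2 := mul_le_mul (hM j) (hxB (σ j)) (abs_nonneg _) hM0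
      linarith
    have hu3 : u ^ 2 ≤ (2 * (M * B)) ^ 2 := sq_le_sq' (abs_le.1 hu2).1 (abs_le.1 hu2).2
    nlinarith [sq_nonneg (u - ∑ p ∈ R, c p * b (σ p))]
  refine (Finset.sum_le_sum hpt).trans ?_
  rw [Finset.sum_add_distrib, Finset.sum_const, nsmul_eq_mul, ← Finset.mul_sum, ← hS2]
  linarith

end fiber

end PartA4

section PartA5

/-- the function `ψ` -/
noncomputable def psi {α : Type*} [Fintype α] (b : α → ℝ) (x : α) : ℝ :=
  b x ^ 2 / √(∑ z with |b z| ≤ |b x|, b z ^ 2)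

lemma psi_nonneg {α : Type*} [Fintype α] (b : α → ℝ) (x : α) : 0 ≤ psi b x := by
  unfold psi; positivity

set_option maxHeartbeats 1600000 in
lemma fiber_bound (K : ℕ) (hK : 24 ≤ K) (a : Fin K → ℝ) (m u B : ℝ) (ε w : Fin K → ℝ)
    (hε : ∀ p, |ε p| ≤ 1) (hwK : ∀ p, |w p| ≤ K)
    (hw : ∀ p q : Fin K, |((p : ℕ) : ℝ) - (q : ℕ)| ≤ |w p - w q|)
    (hst : ∑ p, ε p = 0 ∨ 2 * ∑ p, w p = (K + 1) * ∑ p, ε p)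
    (h1 : Fintype.card (Fin K) ≤ 2 * (Finset.univ.filter fun x => 0 ≤ a x - m).card)
    (h2 : Fintype.card (Fin K) ≤ 2 * (Finset.univ.filter fun x => a x - m ≤ 0).card)
    (hu : ∑ x, (a x - u) = 0) (hB0 : 0 ≤ B) (hB : ∑ x, (a x - u) ^ 2 = B ^ 2)
    (i j x y : Fin K) (hij : i ≠ j) (hxy : x ≠ y) (hyx : |a y - m| ≤ |a x - m|) :
    |a x - m| * ∑ σ ∈ fib i j x y, (if |∑ p, w p * a (σ p)| ≤ 12 * K * |a x - m| then
        (|∑ p, ε p * (a (σ p) - u)| + |(∑ p, ε p) * u| + B) else 0)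
      ≤ (fib i j x y).card * (3 * 10 ^ 8 * B * psi (fun z => a z - m) x) := by
  have hKr : (24:ℝ) ≤ K := by exact_mod_cast hK
  have : Nonempty (Fin K) := ⟨i⟩
  set b : Fin K → ℝ := fun z => a z - m with hb
  set b0 : Fin K → ℝ := fun z => a z - u with hb0
  set μ : ℝ := |a x - m| with hμ
  have hμ0 : 0 ≤ μ := abs_nonneg _
  set T : Equiv.Perm (Fin K) → ℝ := fun σ => ∑ p, w p * a (σ p) with hT
  set Y : Equiv.Perm (Fin K) → ℝ := fun σ => ∑ p, ε p * b0 (σ p) with hY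
  set X : Equiv.Perm (Fin K) → ℝ := fun σ => ∑ p, w p * b0 (σ p) with hX
  set A0 : ℝ := |(∑ p, ε p) * u| with hA0
  have hA00 : 0 ≤ A0 := abs_nonneg _
  set yy : Equiv.Perm (Fin K) → ℝ := fun σ => |Y σ| + A0 + B with hyy
  set Ω := fib i j x y with hΩ
  set n : ℝ := (Ω.card : ℝ) with hn
  have hn0 : 0 ≤ n := Nat.cast_nonneg _
  change μ * ∑ σ ∈ Ω, (if |T σ| ≤ 12 * K * μ then yy σ else 0) ≤ n * (3 * 10 ^ 8 * B * psi b x)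
  set ℓ : ℝ := 12 * K * μ with hℓ
  have hℓ0 : 0 ≤ ℓ := by positivity
  have hbB : ∑ z, b z ^ 2 ≤ (2 * B) ^ 2 := by
    have := median_sq a m u h1 h2
    rw [hB] at this
    calc _ ≤ _ := this
      _ = _ := by ring
  have hμB : μ ≤ 2 * B := by
    apply abs_le_of_sq_le_sq _ (by linarith)
    refine le_trans ?_ hbB
    exact Finset.single_le_sum (f := fun z => b z ^ 2) (fun _ _ => sq_nonneg _) (Finset.mem_univ x)
  -- the second moment of `yy` on one side
  have hTX : ∀ σ, T σ = X σ + (∑ p, w p) * u := by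
    intro σ
    simp only [hT, hX, hb0]
    rw [Finset.sum_mul, ← Finset.sum_add_distrib]
    exact Finset.sum_congr rfl fun p _ => by ring
  obtain ⟨κ, hκ, hκs⟩ : ∃ κ : ℝ, (κ = 1 ∨ κ = -1) ∧ κ * ((∑ p, w p) * u) = |(∑ p, w p) * u| := by
    rcases le_total 0 ((∑ p, w p) * u) with h | h
    · exact ⟨1, Or.inl rfl, by rw [abs_of_nonneg h]; ring⟩
    · exact ⟨-1, Or.inr rfl, by rw [abs_of_nonpos h]; ring⟩
  have hA0τ : ((K:ℝ) + 1) * A0 ≤ 2 * |(∑ p, w p) * u| := by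
    rcases hst with h | h
    · rw [hA0, h, zero_mul, abs_zero, mul_zero]; positivity
    · have e : 2 * |(∑ p, w p) * u| = |(2 * ∑ p, w p) * u| := by
        rw [mul_assoc, abs_mul 2]; norm_num
      rw [e, h, mul_assoc, abs_mul ((K:ℝ) + 1), abs_of_nonneg (show (0:ℝ) ≤ K + 1 by positivity)]
  have hyA : ∀ σ, κ * T σ ≤ 2 * ℓ → yy σ ≤ |Y σ| + 97 * B + 2 * |X σ| / K := by
    intro σ hσ
    rw [hTX, mul_add, hκs] at hσ
    have e1 : - |X σ| ≤ κ * X σ := by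
      have := abs_le.1 (le_refl |X σ|)
      rcases hκ with rfl | rfl <;> linarith
    have e2 : ((K:ℝ) + 1) * A0 ≤ 4 * ℓ + 2 * |X σ| := by linarith
    have e3 : (K:ℝ) * A0 ≤ 4 * ℓ + 2 * |X σ| := by linarith
    have e4 : A0 ≤ 96 * B + 2 * |X σ| / K := by
      have : (0:ℝ) < K := by linarith
      have e5 : (K:ℝ) * A0 ≤ K * (96 * B + 2 * |X σ| / K) := by
        have : (K:ℝ) * (96 * B + 2 * |X σ| / K) = 96 * K * B + 2 * |X σ| := by field_simp
        rw [this]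
        have : (K:ℝ) * μ ≤ K * (2 * B) := by gcongr
        linarith
      exact le_of_mul_le_mul_left e5 this
    simp only [hyy]; linarith
  have hc4 : 4 ≤ Fintype.card (Fin K) := by rw [Fintype.card_fin]; omega
  have mY : ∑ σ ∈ Ω, Y σ ^ 2 ≤ n * (20 * 1 ^ 2 * B ^ 2) :=
    fiber_moment b0 hu hc4 ε 1 B hε hB0 hB i j x y hij hxy
  have mX : ∑ σ ∈ Ω, X σ ^ 2 ≤ n * (20 * (K:ℝ) ^ 2 * B ^ 2) :=
    fiber_moment b0 hu hc4 w K B hwK hB0 hB i j x y hij hxy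
  have hyy0 : ∀ σ, 0 ≤ yy σ := fun σ => by simp only [hyy]; positivity
  have hV : ∑ σ ∈ Ω, (if κ * T σ ≤ 2 * ℓ then yy σ ^ 2 else 0) ≤ n * (169 * B) ^ 2 := by
    have hpt : ∀ σ ∈ Ω, (if κ * T σ ≤ 2 * ℓ then yy σ ^ 2 else 0)
        ≤ 3 * Y σ ^ 2 + 12 / K ^ 2 * X σ ^ 2 + 28227 * B ^ 2 := by
      intro σ _
      split_ifs with hc
      · have e1 := hyA σ hc
        have e2 : yy σ ^ 2 ≤ (|Y σ| + 97 * B + 2 * |X σ| / K) ^ 2 := by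
          have := hyy0 σ; gcongr
        have e3 : (2 * |X σ| / K) ^ 2 = 4 / K ^ 2 * X σ ^ 2 := by
          rw [div_pow, mul_pow, sq_abs]; ring
        have e4 : |Y σ| ^ 2 = Y σ ^ 2 := sq_abs _
        have e5 : ∀ p q r : ℝ, (p + q + r) ^ 2 ≤ 3 * (p ^ 2 + q ^ 2 + r ^ 2) := by
          intro p q r
          nlinarith [sq_nonneg (p - q), sq_nonneg (q - r), sq_nonneg (p - r)]
        have e6 := e5 (|Y σ|) (97 * B) (2 * |X σ| / K)
        rw [e3, e4] at e6
        have e7 : 12 / (K:ℝ) ^ 2 * X σ ^ 2 = 3 * (4 / K ^ 2 * X σ ^ 2) := by ring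
        rw [e7]
        linarith
      · positivity
    refine (Finset.sum_le_sum hpt).trans ?_
    rw [Finset.sum_add_distrib, Finset.sum_add_distrib, ← Finset.mul_sum, ← Finset.mul_sum,
      Finset.sum_const, nsmul_eq_mul]
    have e1 : 12 / (K:ℝ) ^ 2 * ∑ σ ∈ Ω, X σ ^ 2 ≤ 12 / (K:ℝ) ^ 2 * (n * (20 * (K:ℝ) ^ 2 * B ^ 2)) := by
      gcongr
    have e2 : 12 / (K:ℝ) ^ 2 * (n * (20 * (K:ℝ) ^ 2 * B ^ 2)) = 240 * (n * B ^ 2) := by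
      field_simp; ring
    have e3 : 0 ≤ n * B ^ 2 := by positivity
    linarith
  -- trivial bound
  set E := ∑ σ ∈ Ω, (if |T σ| ≤ ℓ then yy σ else 0) with hE
  have hE0 : 0 ≤ E := Finset.sum_nonneg fun σ _ => by split_ifs; exacts [hyy0 σ, le_rfl]
  have triv : E ≤ n * (169 * B) := by
    have hn2 : √n ^ 2 = n := Real.sq_sqrt hn0
    have e := sum_mul_le_of_sq Ω (fun σ => if |T σ| ≤ ℓ then yy σ else 0) (fun _ => 1)
      (√n * (169 * B)) (√n) (by positivity) (by positivity) (by
        rw [mul_pow, hn2]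
        refine le_trans (Finset.sum_le_sum fun σ _ => ?_) hV
        by_cases hc : |T σ| ≤ ℓ
        · have hc2 : κ * T σ ≤ 2 * ℓ := by
            have := abs_le.1 hc
            rcases hκ with rfl | rfl <;> linarith
          rw [if_pos hc, if_pos hc2]
        · rw [if_neg hc, zero_pow two_ne_zero]; split_ifs <;> positivity) (by rw [hn2]; simp [hn])
    simp only [mul_one] at e
    refine e.trans (le_of_eq ?_)
    linear_combination (169 * B) * hn2
  -- coarse bound
  set η : ℝ := 2 * μ with hη
  have hη0 : 0 ≤ η := by positivity
  set β2 : ℝ := ∑ z, clip η (b z) ^ 2 - clip η (b x) ^ 2 - clip η (b y) ^ 2 with hβ2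
  have hβ2' : β2 = ∑ z ∈ ({x, y}ᶜ : Finset (Fin K)), clip η (b z) ^ 2 := by
    have := Finset.sum_add_sum_compl ({x, y} : Finset (Fin K)) (fun z => clip η (b z) ^ 2)
    rw [Finset.sum_pair hxy] at this
    rw [hβ2]; linarith
  have hβ20 : 0 ≤ β2 := by rw [hβ2']; exact Finset.sum_nonneg fun _ _ => sq_nonneg _
  set β := √β2 with hβ
  have hβ0 : 0 ≤ β := Real.sqrt_nonneg _
  have hββ : β ^ 2 = β2 := Real.sq_sqrt hβ20
  set R : Finset (Fin K) := {i, j}ᶜ with hR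
  have hRc : R.card = K - 2 := by
    rw [hR, Finset.card_compl, Finset.card_pair hij, Fintype.card_fin]
  have hco := coarse (fib_swapInv i j x y) (by rw [← hR]; omega) b w T yy η ℓ K (169 * B) (2 * B) β
    ((K:ℝ) ^ 3 / 1024) κ (∑ z, clip η (b z) - clip η (b x) - clip η (b y)) hη0 (by linarith)
    (by linarith) hβ0 hκ (by
      have : R.card ≤ K := by omega
      exact_mod_cast this) (fun p _ => hwK p)
    (fun σ _ p _ q _ => by
      simp only [hT]
      rw [lin_swap w a σ p q]; simp only [hb]; ring)
    hyy0
    (fun σ _ p _ q _ => by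
      have e : Y (σ * Equiv.swap p q) - Y σ = (ε q - ε p) * (b (σ p) - b (σ q)) := by
        simp only [hY]; rw [lin_swap ε b0 σ p q]; simp only [hb, hb0]; ring
      have e2 : yy (σ * Equiv.swap p q) - yy σ = |Y (σ * Equiv.swap p q)| - |Y σ| := by
        simp only [hyy]; ring
      rw [e2]
      refine (abs_abs_sub_abs_le_abs_sub _ _).trans ?_
      rw [e, abs_mul]
      gcongr
      have := abs_le.1 (hε p); have := abs_le.1 (hε q)
      rw [abs_le]; constructor <;> linarith)
    (by rw [hη, hℓ]; nlinarith [mul_nonneg (show (0:ℝ) ≤ K by linarith) hμ0])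
    (fun σ hσ => by rw [fib_sum i j x y hij (fun z => clip η (b z) ^ 2) σ hσ, hββ])
    (fun σ hσ => by rw [fib_sum i j x y hij (fun z => clip η (b z)) σ hσ])
    (fun σ hσ => by
      rw [fib_sum i j x y hij (fun z => b z ^ 2) σ hσ]
      have := sq_nonneg (b x); have := sq_nonneg (b y)
      linarith)
    hV
    (fun σ hσ => by
      have := low_pair K hK b w η hη0 hw h1 h2 R (by
        rw [hR, compl_compl, Finset.card_pair hij]) σ
      rwa [fib_sum i j x y hij (fun z => clip η (b z) ^ 2) σ hσ, ← hβ2, ← hββ] at this)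
  rw [← hΩ, ← hE, ← hn] at hco
  -- conclusion
  rcases hμ0.eq_or_lt with h0 | hμpos
  · rw [← h0, zero_mul]
    have := psi_nonneg b x
    positivity
  set Φ : ℝ := ∑ z with |b z| ≤ |b x|, b z ^ 2 with hΦ
  have hbx : |b x| = μ := rfl
  have hbx2 : b x ^ 2 = μ ^ 2 := by rw [← hbx, sq_abs]
  have hΦμ : μ ^ 2 ≤ Φ := by
    rw [← hbx2]
    exact Finset.single_le_sum (f := fun z => b z ^ 2) (fun _ _ => sq_nonneg _)
      (by simp)
  have hΦ0 : 0 < Φ := lt_of_lt_of_le (by positivity) hΦμ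
  have hψ : psi b x = μ ^ 2 / √Φ := by unfold psi; rw [hbx2]
  have hsΦ : 0 < √Φ := Real.sqrt_pos.2 hΦ0
  have hsΦ2 : √Φ ^ 2 = Φ := Real.sq_sqrt hΦ0.le
  have hβΦ : Φ - 2 * μ ^ 2 ≤ β2 := by
    have e1 : Φ ≤ ∑ z ∈ ({x, y} : Finset (Fin K)), b z ^ 2
        + ∑ z ∈ ({x, y}ᶜ : Finset (Fin K)), clip η (b z) ^ 2 := by
      rw [hΦ, Finset.sum_filter, ← Finset.sum_add_sum_compl ({x, y} : Finset (Fin K))]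
      refine add_le_add (Finset.sum_le_sum fun z _ => ?_) (Finset.sum_le_sum fun z _ => ?_)
      · split_ifs
        · exact le_rfl
        · positivity
      · split_ifs with hz
        · rw [clip_of_abs_le]
          rw [hbx] at hz; linarith
        · positivity
    rw [Finset.sum_pair hxy, ← hβ2', hbx2] at e1
    have e2 : b y ^ 2 ≤ μ ^ 2 := by
      rw [← sq_abs (b y)]
      gcongr
    linarith
  rw [hψ]
  -- goal
  suffices hgoal : E * √Φ ≤ n * (3 * 10 ^ 8 * B * μ) by
    have : n * (3 * 10 ^ 8 * B * (μ ^ 2 / √Φ)) = μ * (n * (3 * 10 ^ 8 * B * μ)) / √Φ := by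
      ring
    rw [this, le_div_iff₀ hsΦ, mul_assoc]
    exact mul_le_mul_of_nonneg_left hgoal hμ0
  have hnB : 0 ≤ n * (B * μ) := by positivity
  by_cases hcase : Φ ≤ 4 * μ ^ 2
  · have : √Φ ≤ 2 * μ := by
      rw [Real.sqrt_le_left (by positivity)]; linarith
    calc E * √Φ ≤ n * (169 * B) * (2 * μ) := by gcongr
      _ ≤ _ := by linarith
  · push Not at hcase
    have hβh : Φ / 2 ≤ β ^ 2 := by rw [hββ]; linarith
    have hβpos : 0 < β := by
      rcases hβ0.eq_or_lt with h | h
      · rw [← h] at hβh; linarith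
      · exact h
    have hsβ : √Φ ≤ 2 * β := by
      rw [Real.sqrt_le_left (by positivity)]; nlinarith
    have e1 : (K:ℝ) ^ 3 * β * (β * E) ≤ (K:ℝ) ^ 3 * β * (n * (1024 * 48 * 12 * 171 * (B * μ))) := by
      rw [hℓ] at hco
      have e : (K:ℝ) ^ 3 * β * (β * E) = 1024 * ((K:ℝ) ^ 3 / 1024 * β ^ 2 * E) := by ring
      rw [e]
      refine (mul_le_mul_of_nonneg_left hco (by norm_num)).trans (le_of_eq ?_)
      ring
    have e2 := le_of_mul_le_mul_left e1 (by positivity)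
    have e3 : E * √Φ ≤ E * (2 * β) := by gcongr
    linarith

end PartA5

section PartA6

/-- the standing assumptions -/
structure Setup (K : ℕ) (a : Fin K → ℝ) (m u B : ℝ) (ε w : Fin K → ℝ) : Prop where
  hK : 102 ≤ K
  hε : ∀ p, |ε p| ≤ 1
  hwK : ∀ p, |w p| ≤ K
  hw : ∀ p q : Fin K, |((p : ℕ) : ℝ) - (q : ℕ)| ≤ |w p - w q|
  hst : ∑ p, ε p = 0 ∨ 2 * ∑ p, w p = (K + 1) * ∑ p, ε p
  h1 : Fintype.card (Fin K) ≤ 2 * (Finset.univ.filter fun x => 0 ≤ a x - m).card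
  h2 : Fintype.card (Fin K) ≤ 2 * (Finset.univ.filter fun x => a x - m ≤ 0).card
  hu : ∑ x, (a x - u) = 0
  hB0 : 0 ≤ B
  hB : ∑ x, (a x - u) ^ 2 = B ^ 2

/-- the main linear statistic -/
noncomputable def TT {K : ℕ} (a w : Fin K → ℝ) (σ : Equiv.Perm (Fin K)) : ℝ := ∑ p, w p * a (σ p)

/-- the weight -/
noncomputable def yw {K : ℕ} (a : Fin K → ℝ) (u B : ℝ) (ε : Fin K → ℝ)
    (σ : Equiv.Perm (Fin K)) : ℝ :=
  |∑ p, ε p * (a (σ p) - u)| + |(∑ p, ε p) * u| + B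

lemma perm_avg {α : Type*} [DecidableEq α] [Fintype α] (f : α → ℝ) (p : α) :
    (Fintype.card α : ℝ) * ∑ σ : Equiv.Perm α, f (σ p)
      = Fintype.card (Equiv.Perm α) * ∑ x, f x := by
  have h1 : ∀ q ∈ (Finset.univ : Finset α), ∑ σ : Equiv.Perm α, f (σ q)
      = ∑ σ : Equiv.Perm α, f (σ p) := by
    intro q _
    have := (swapInv_univ Finset.univ).sum_swap (Finset.mem_univ p) (Finset.mem_univ q)
      (fun σ => f (σ p))
    simpa using this
  have h2 : ∑ q, ∑ σ : Equiv.Perm α, f (σ q) = Fintype.card (Equiv.Perm α) * ∑ x, f x := by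
    rw [Finset.sum_comm, Finset.sum_congr rfl fun σ _ => Equiv.sum_comp σ f]
    simp [Finset.card_univ]
  rw [Finset.sum_congr rfl h1] at h2
  simpa [Finset.card_univ] using h2

variable {K : ℕ} {a : Fin K → ℝ} {m u B : ℝ} {ε w : Fin K → ℝ}

lemma Setup.yw_nonneg (H : Setup K a m u B ε w) (σ : Equiv.Perm (Fin K)) : 0 ≤ yw a u B ε σ := by
  have := H.hB0
  unfold yw; positivity

lemma Setup.big_delta (H : Setup K a m u B ε w) (i j : Fin K) (hij : i ≠ j) :
    (K : ℝ) * ∑ σ : Equiv.Perm (Fin K), |a (σ i) - a (σ j)| *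
      (if |TT a w σ| ≤ 6 * K * |a (σ i) - a (σ j)| then yw a u B ε σ else 0)
    ≤ 48 * 10 ^ 8 * (Fintype.card (Equiv.Perm (Fin K)) * B ^ 2) := by
  have hK24 : 24 ≤ K := by have := H.hK; omega
  have hB0 := H.hB0
  have hKr : (24:ℝ) ≤ K := by exact_mod_cast hK24
  have : Nonempty (Fin K) := ⟨i⟩
  set b : Fin K → ℝ := fun z => a z - m with hb
  have half : ∀ i j x y : Fin K, i ≠ j → x ≠ y → |b y| ≤ |b x| →
      ∑ σ ∈ fib i j x y, |a (σ i) - a (σ j)| *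
        (if |TT a w σ| ≤ 6 * K * |a (σ i) - a (σ j)| then yw a u B ε σ else 0)
      ≤ ∑ σ ∈ fib i j x y, 6 * 10 ^ 8 * B * (psi b (σ i) + psi b (σ j)) := by
    intro i j x y hij hxy hyx
    have hfb := fiber_bound K hK24 a m u B ε w H.hε H.hwK H.hw H.hst H.h1 H.h2 H.hu H.hB0 H.hB
      i j x y hij hxy hyx
    have e1 : ∑ σ ∈ fib i j x y, |a (σ i) - a (σ j)| *
        (if |TT a w σ| ≤ 6 * K * |a (σ i) - a (σ j)| then yw a u B ε σ else 0)
        ≤ 2 * (|a x - m| * ∑ σ ∈ fib i j x y, (if |∑ p, w p * a (σ p)| ≤ 12 * K * |a x - m| then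
        (|∑ p, ε p * (a (σ p) - u)| + |(∑ p, ε p) * u| + B) else 0)) := by
      rw [← mul_assoc, Finset.mul_sum]
      refine Finset.sum_le_sum fun σ hσ => ?_
      simp only [fib, Finset.mem_filter, Finset.mem_univ, true_and] at hσ
      rw [hσ.1, hσ.2]
      have hd : |a x - a y| ≤ 2 * |a x - m| := by
        have e : a x - a y = (a x - m) - (a y - m) := by ring
        rw [e]
        have := abs_sub (a x - m) (a y - m)
        simp only [hb] at hyx
        linarith
      have hnn := H.yw_nonneg σ
      have hcond : (if |TT a w σ| ≤ 6 * K * |a x - a y| then yw a u B ε σ else 0)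
          ≤ (if |TT a w σ| ≤ 12 * K * |a x - m| then yw a u B ε σ else 0) := by
        split_ifs with h3 h4
        · exact le_rfl
        · exfalso; apply h4
          refine h3.trans ?_
          have : 6 * (K:ℝ) * |a x - a y| ≤ 6 * K * (2 * |a x - m|) := by gcongr
          linarith
        · exact hnn
        · exact le_rfl
      exact mul_le_mul hd hcond (by split_ifs; exacts [hnn, le_rfl]) (by positivity)
    refine e1.trans ?_
    refine (mul_le_mul_of_nonneg_left hfb (by norm_num)).trans ?_
    have e2 : ∑ σ ∈ fib i j x y, 6 * 10 ^ 8 * B * (psi b (σ i) + psi b (σ j))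
        = (fib i j x y).card * (6 * 10 ^ 8 * B * (psi b x + psi b y)) := by
      rw [← nsmul_eq_mul, ← Finset.sum_const]
      refine Finset.sum_congr rfl fun σ hσ => ?_
      simp only [fib, Finset.mem_filter, Finset.mem_univ, true_and] at hσ
      rw [hσ.1, hσ.2]
    rw [e2]
    have := psi_nonneg b y
    have h5 : 0 ≤ ((fib i j x y).card : ℝ) * (B * psi b y) := by positivity
    simp only [← hb]
    linarith
  have hfibw : ∀ xy : Fin K × Fin K,
      ∑ σ ∈ (Finset.univ : Finset (Equiv.Perm (Fin K))) with (σ i, σ j) = xy,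
        |a (σ i) - a (σ j)| *
        (if |TT a w σ| ≤ 6 * K * |a (σ i) - a (σ j)| then yw a u B ε σ else 0)
      ≤ ∑ σ ∈ (Finset.univ : Finset (Equiv.Perm (Fin K))) with (σ i, σ j) = xy,
        6 * 10 ^ 8 * B * (psi b (σ i) + psi b (σ j)) := by
    rintro ⟨x, y⟩
    have e : (Finset.univ.filter fun σ : Equiv.Perm (Fin K) => (σ i, σ j) = (x, y))
        = fib i j x y := by
      unfold fib; simp only [Prod.mk.injEq]
    rw [e]
    by_cases hxy : x = y
    · have : fib i j x y = ∅ := by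
        rw [Finset.eq_empty_iff_forall_notMem]
        intro σ hσ
        simp only [fib, Finset.mem_filter, Finset.mem_univ, true_and] at hσ
        exact hij (σ.injective (by rw [hσ.1, hσ.2, hxy]))
      rw [this]; simp
    rcases le_total (|b y|) (|b x|) with h | h
    · exact half i j x y hij hxy h
    · have := half j i y x hij.symm (Ne.symm hxy) h
      have e2 : fib j i y x = fib i j x y := by
        unfold fib; ext σ; simp [and_comm]
      rw [e2] at this
      convert this using 2 with σ hσ σ hσ
      · rw [abs_sub_comm]
      · ring
  have htot := Finset.sum_le_sum fun xy (_ : xy ∈ Finset.univ) => hfibw xy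
  rw [Finset.sum_fiberwise, Finset.sum_fiberwise] at htot
  refine (mul_le_mul_of_nonneg_left htot (by positivity)).trans ?_
  rw [← Finset.mul_sum, Finset.sum_add_distrib]
  have p1 := perm_avg (psi b) i
  have p2 := perm_avg (psi b) j
  rw [Fintype.card_fin] at p1 p2
  have hps : ∑ x, psi b x ≤ 2 * √(∑ z, b z ^ 2) := sum_div_sqrt_le b Finset.univ
  have hbB : ∑ z, b z ^ 2 ≤ (2 * B) ^ 2 := by
    have := median_sq a m u H.h1 H.h2
    rw [H.hB] at this
    calc _ ≤ _ := this
      _ = _ := by ring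
  have hsq : √(∑ z, b z ^ 2) ≤ 2 * B := by
    rw [Real.sqrt_le_left (by linarith)]; exact hbB
  have hps2 : ∑ x, psi b x ≤ 4 * B := by linarith
  calc (K:ℝ) * (6 * 10 ^ 8 * B * (∑ σ : Equiv.Perm (Fin K), psi b (σ i)
        + ∑ σ : Equiv.Perm (Fin K), psi b (σ j)))
      = 6 * 10 ^ 8 * B * (K * ∑ σ : Equiv.Perm (Fin K), psi b (σ i)
        + K * ∑ σ : Equiv.Perm (Fin K), psi b (σ j)) := by ring
    _ = 12 * 10 ^ 8 * B * (Fintype.card (Equiv.Perm (Fin K)) * ∑ x, psi b x) := by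
        rw [p1, p2]; ring
    _ ≤ 12 * 10 ^ 8 * B * (Fintype.card (Equiv.Perm (Fin K)) * (4 * B)) := by gcongr
    _ = _ := by ring

lemma Setup.full_moment (H : Setup K a m u B ε w) (c : Fin K → ℝ) (M : ℝ) (hM : ∀ p, |c p| ≤ M) :
    ∑ σ : Equiv.Perm (Fin K), (∑ p, c p * (a (σ p) - u)) ^ 2
      ≤ Fintype.card (Equiv.Perm (Fin K)) * (2 * M ^ 2 * B ^ 2) := by
  have hK := H.hK
  have hm := (swapInv_univ (Finset.univ : Finset (Fin K))).second_moment_le (fun z => a z - u) c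
    (B ^ 2) 0 (by simp; omega) (sq_nonneg _)
    (fun σ _ => by rw [Equiv.sum_comp σ (fun z => (a z - u) ^ 2), H.hB])
    (fun σ _ => by rw [Equiv.sum_comp σ (fun z => (a z - u)), H.hu])
  have hc2 : ∑ p, c p ^ 2 ≤ K * M ^ 2 := by
    have : ∀ p ∈ (Finset.univ : Finset (Fin K)), c p ^ 2 ≤ M ^ 2 :=
      fun p _ => sq_le_sq' (abs_le.1 (hM p)).1 (abs_le.1 (hM p)).2
    refine (Finset.sum_le_sum this).trans ?_
    simp
  have hKr : (102:ℝ) ≤ K := by exact_mod_cast hK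
  simp only [Finset.card_univ, Fintype.card_fin] at hm
  set n : ℝ := (Fintype.card (Equiv.Perm (Fin K)) : ℝ) with hn
  set S2 := ∑ σ : Equiv.Perm (Fin K), (∑ p, c p * (a (σ p) - u)) ^ 2 with hS2
  have hS20 : 0 ≤ S2 := Finset.sum_nonneg fun _ _ => sq_nonneg _
  have hn0 : 0 ≤ n := Nat.cast_nonneg _
  have h1 : ((K:ℝ) - 1) * S2 ≤ n * (B ^ 2 * (K * M ^ 2)) := by
    refine hm.trans ?_
    have : B ^ 2 + 0 ^ 2 = B ^ 2 := by ring
    rw [this]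
    gcongr
  have h2 : (K:ℝ) / 2 * S2 ≤ ((K:ℝ) - 1) * S2 := by
    apply mul_le_mul_of_nonneg_right _ hS20; linarith
  have h3 : (K:ℝ) * S2 ≤ K * (n * (2 * M ^ 2 * B ^ 2)) := by nlinarith
  exact le_of_mul_le_mul_left h3 (by linarith)

lemma Setup.yw_moment (H : Setup K a m u B ε w) :
    ∑ σ : Equiv.Perm (Fin K), (if |TT a w σ| ≤ 6 * yw a u B ε σ then yw a u B ε σ ^ 2 else 0)
      ≤ Fintype.card (Equiv.Perm (Fin K)) * (132 * B ^ 2) := by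
  have hKr : (102:ℝ) ≤ K := by exact_mod_cast H.hK
  have hB0 := H.hB0
  have mY := H.full_moment ε 1 H.hε
  have mX := H.full_moment w K H.hwK
  set X : Equiv.Perm (Fin K) → ℝ := fun σ => ∑ p, w p * (a (σ p) - u) with hX
  set Y : Equiv.Perm (Fin K) → ℝ := fun σ => ∑ p, ε p * (a (σ p) - u) with hY
  set A0 : ℝ := |(∑ p, ε p) * u| with hA0
  have hTX : ∀ σ, TT a w σ = X σ + (∑ p, w p) * u := by
    intro σ
    simp only [TT, hX]
    rw [Finset.sum_mul, ← Finset.sum_add_distrib]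
    exact Finset.sum_congr rfl fun p _ => by ring
  have hA0τ : ((K:ℝ) + 1) * A0 ≤ 2 * |(∑ p, w p) * u| := by
    rcases H.hst with h | h
    · rw [hA0, h, zero_mul, abs_zero, mul_zero]; positivity
    · have e : 2 * |(∑ p, w p) * u| = |(2 * ∑ p, w p) * u| := by
        rw [mul_assoc, abs_mul 2]; norm_num
      rw [e, h, mul_assoc, abs_mul ((K:ℝ) + 1), abs_of_nonneg (show (0:ℝ) ≤ K + 1 by positivity)]
  have hpt : ∀ σ ∈ (Finset.univ : Finset (Equiv.Perm (Fin K))),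
      (if |TT a w σ| ≤ 6 * yw a u B ε σ then yw a u B ε σ ^ 2 else 0)
      ≤ 12 * Y σ ^ 2 + 48 / K ^ 2 * X σ ^ 2 + 12 * B ^ 2 := by
    intro σ _
    split_ifs with hc
    · have hy : yw a u B ε σ = |Y σ| + A0 + B := rfl
      have e1 : |(∑ p, w p) * u| ≤ |TT a w σ| + |X σ| := by
        have : (∑ p, w p) * u = TT a w σ - X σ := by rw [hTX]; ring
        rw [this]; exact abs_sub _ _
      have hA00 : 0 ≤ A0 := abs_nonneg _
      have hY0 := abs_nonneg (Y σ)
      have e2 : (K:ℝ) / 2 * A0 ≤ 12 * |Y σ| + 12 * B + 2 * |X σ| := by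
        have : (K:ℝ) / 2 * A0 ≤ ((K:ℝ) + 1 - 12) * A0 := by
          apply mul_le_mul_of_nonneg_right _ hA00; linarith
        rw [hy] at hc
        linarith
      have e3 : A0 ≤ |Y σ| + B + 4 * |X σ| / K := by
        have hK0 : (0:ℝ) < K := by linarith
        have e5 : (K:ℝ) * A0 ≤ K * (|Y σ| + B + 4 * |X σ| / K) := by
          have : (K:ℝ) * (|Y σ| + B + 4 * |X σ| / K) = K * |Y σ| + K * B + 4 * |X σ| := by
            field_simp
          rw [this]
          have : 24 * |Y σ| ≤ (K:ℝ) * |Y σ| := by gcongr; linarith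
          have : 24 * B ≤ (K:ℝ) * B := by gcongr; linarith
          linarith
        exact le_of_mul_le_mul_left e5 hK0
      have e4 : yw a u B ε σ ≤ 2 * |Y σ| + 2 * B + 4 * |X σ| / K := by rw [hy]; linarith
      have e6 : yw a u B ε σ ^ 2 ≤ (2 * |Y σ| + 2 * B + 4 * |X σ| / K) ^ 2 := by
        have := H.yw_nonneg σ; gcongr
      have e7 : (4 * |X σ| / K) ^ 2 = 16 / K ^ 2 * X σ ^ 2 := by
        rw [div_pow, mul_pow, sq_abs]; ring
      have e8 : |Y σ| ^ 2 = Y σ ^ 2 := sq_abs _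
      have e5 : ∀ p q r : ℝ, (p + q + r) ^ 2 ≤ 3 * (p ^ 2 + q ^ 2 + r ^ 2) := by
        intro p q r
        nlinarith [sq_nonneg (p - q), sq_nonneg (q - r), sq_nonneg (p - r)]
      have e9 := e5 (2 * |Y σ|) (2 * B) (4 * |X σ| / K)
      rw [e7, mul_pow, e8] at e9
      have e10 : 48 / (K:ℝ) ^ 2 * X σ ^ 2 = 3 * (16 / K ^ 2 * X σ ^ 2) := by ring
      rw [e10]
      linarith
    · positivity
  refine (Finset.sum_le_sum hpt).trans ?_
  rw [Finset.sum_add_distrib, Finset.sum_add_distrib, ← Finset.mul_sum, ← Finset.mul_sum,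
    Finset.sum_const, nsmul_eq_mul, Finset.card_univ]
  set n : ℝ := (Fintype.card (Equiv.Perm (Fin K)) : ℝ) with hn
  have e1 : 48 / (K:ℝ) ^ 2 * ∑ σ, X σ ^ 2 ≤ 48 / (K:ℝ) ^ 2 * (n * (2 * (K:ℝ) ^ 2 * B ^ 2)) := by
    gcongr
  have e2 : 48 / (K:ℝ) ^ 2 * (n * (2 * (K:ℝ) ^ 2 * B ^ 2)) = 96 * (n * B ^ 2) := by
    field_simp; ring
  linarith

/-- the contribution of a pair of end points -/
lemma Setup.end_bound (H : Setup K a m u B ε w) (i j : Fin K) (hij : i ≠ j) (hεij : ε i = ε j)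
    (hwij : |w j - w i| ≤ K) :
    (K : ℝ) * (2 * ∑ σ : Equiv.Perm (Fin K), ε i * (a (σ i) - a (σ j)) *
      clip (5 * yw a u B ε σ) (TT a w σ))
    ≤ 49 * 10 ^ 9 * (Fintype.card (Equiv.Perm (Fin K)) * B ^ 2) := by
  have hKr : (102:ℝ) ≤ K := by exact_mod_cast H.hK
  set F : Equiv.Perm (Fin K) → ℝ := fun σ => clip (5 * yw a u B ε σ) (TT a w σ) with hF
  have hsw := (swapInv_univ (Finset.univ : Finset (Fin K))).swap_id (Finset.mem_univ i)
    (Finset.mem_univ j) a F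
  have e1 : 2 * ∑ σ : Equiv.Perm (Fin K), ε i * (a (σ i) - a (σ j)) * F σ
      = ∑ σ : Equiv.Perm (Fin K), -ε i * ((a (σ i) - a (σ j)) * (F (σ * Equiv.swap i j) - F σ)) := by
    rw [← Finset.mul_sum, hsw, Finset.mul_sum, Finset.mul_sum, Finset.mul_sum]
    exact Finset.sum_congr rfl fun σ _ => by ring
  rw [e1, Finset.mul_sum]
  have hpt : ∀ σ ∈ (Finset.univ : Finset (Equiv.Perm (Fin K))),
      (K:ℝ) * (-ε i * ((a (σ i) - a (σ j)) * (F (σ * Equiv.swap i j) - F σ)))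
      ≤ 10 * (if |TT a w σ| ≤ 6 * yw a u B ε σ then yw a u B ε σ ^ 2 else 0)
        + 10 * (K * (|a (σ i) - a (σ j)| *
          (if |TT a w σ| ≤ 6 * K * |a (σ i) - a (σ j)| then yw a u B ε σ else 0))) := by
    intro σ _
    have hy : yw a u B ε (σ * Equiv.swap i j) = yw a u B ε σ := by
      unfold yw
      rw [lin_swap ε (fun z => a z - u) σ i j, hεij]; simp
    have hT : TT a w (σ * Equiv.swap i j) = TT a w σ + (w j - w i) * (a (σ i) - a (σ j)) :=
      lin_swap w a σ i j
    set y := yw a u B ε σ with hyd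
    set t := TT a w σ with ht
    set d := |a (σ i) - a (σ j)| with hd
    have hd0 : 0 ≤ d := abs_nonneg _
    have hy0 : 0 ≤ y := H.yw_nonneg σ
    have hFd : F (σ * Equiv.swap i j) - F σ
        = clip (5 * y) (t + (w j - w i) * (a (σ i) - a (σ j))) - clip (5 * y) t := by
      simp only [hF, hy, hT, ← hyd, ← ht]
    rw [hFd]
    set v := (w j - w i) * (a (σ i) - a (σ j)) with hv
    have hv1 : |v| ≤ K * d := by
      rw [hv, abs_mul]; gcongr
    have hbase : -ε i * ((a (σ i) - a (σ j)) * (clip (5 * y) (t + v) - clip (5 * y) t))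
        ≤ d * |clip (5 * y) (t + v) - clip (5 * y) t| := by
      refine (le_abs_self _).trans ?_
      rw [abs_mul, abs_mul, abs_neg]
      have := H.hε i
      calc |ε i| * (d * |clip (5 * y) (t + v) - clip (5 * y) t|)
          ≤ 1 * (d * |clip (5 * y) (t + v) - clip (5 * y) t|) := by gcongr
        _ = _ := one_mul _
    have hcl : |clip (5 * y) (t + v) - clip (5 * y) t| ≤ 10 * y := by
      have h1 := abs_le.1 (abs_clip_le (η := 5 * y) (x := t + v) (by positivity))
      have h2 := abs_le.1 (abs_clip_le (η := 5 * y) (x := t) (by positivity))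
      rw [abs_le]; constructor <;> linarith
    have hK0 : (0:ℝ) ≤ K := by linarith
    refine (mul_le_mul_of_nonneg_left hbase hK0).trans ?_
    by_cases hbig : |t| ≤ 5 * y + K * d
    · have hm : (K:ℝ) * (d * |clip (5 * y) (t + v) - clip (5 * y) t|) ≤ K * (d * (10 * y)) := by
        gcongr
      refine hm.trans ?_
      rcases le_total ((K:ℝ) * d) y with hc | hc
      · rw [if_pos (show |t| ≤ 6 * y by linarith)]
        have h3 : (0:ℝ) ≤ 10 * (K * (d * (if |t| ≤ 6 * K * d then y else 0))) := by
          split_ifs <;> positivity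
        nlinarith
      · rw [if_pos (show |t| ≤ 6 * K * d by linarith)]
        have h3 : (0:ℝ) ≤ 10 * (if |t| ≤ 6 * y then y ^ 2 else 0) := by
          split_ifs <;> positivity
        linarith
    · push Not at hbig
      have hz : clip (5 * y) (t + v) - clip (5 * y) t = 0 := by
        have hv2 := abs_le.1 hv1
        have hKd : 0 ≤ (K:ℝ) * d := by positivity
        rcases le_total 0 t with ht0 | ht0
        · rw [abs_of_nonneg ht0] at hbig
          rw [clip_of_ge (by positivity) (by linarith), clip_of_ge (by positivity) (by linarith)]
          ring
        · rw [abs_of_nonpos ht0] at hbig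
          rw [clip_of_le (by linarith), clip_of_le (by linarith)]; ring
      rw [hz, abs_zero, mul_zero, mul_zero]
      split_ifs <;> positivity
  refine (Finset.sum_le_sum hpt).trans ?_
  rw [Finset.sum_add_distrib, ← Finset.mul_sum, ← Finset.mul_sum, ← Finset.mul_sum]
  have h1 := H.yw_moment
  have h2 := H.big_delta i j hij
  have h3 : 0 ≤ (Fintype.card (Equiv.Perm (Fin K)) : ℝ) * B ^ 2 := by positivity
  linarith

end PartA6

section PartA7

lemma tele2 (L : ℕ) (v : Fin (L+2) → ℝ) :
    ∑ p : Fin L, (v (p.castAdd 2) - v (p.addNat 2))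
      = v 0 + v 1 - v (Fin.last L).castSucc - v (Fin.last (L+1)) := by
  have h1 : ∑ q, v q = ∑ p : Fin L, v (p.castAdd 2) + v (Fin.last L).castSucc + v (Fin.last (L+1)) := by
    rw [Fin.sum_univ_castSucc, Fin.sum_univ_castSucc]; rfl
  have h2 : ∑ q, v q = v 0 + (v 1 + ∑ p : Fin L, v (p.addNat 2)) := by
    rw [Fin.sum_univ_succ, Fin.sum_univ_succ]; rfl
  rw [Finset.sum_sub_distrib]; linarith

lemma sq_le_B {K : ℕ} {b : Fin K → ℝ} {B : ℝ} (hB0 : 0 ≤ B) (hB : ∑ x, b x ^ 2 = B ^ 2) (x : Fin K) :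
    |b x| ≤ B := by
  apply abs_le_of_sq_le_sq _ hB0
  rw [← hB]
  exact Finset.single_le_sum (f := fun x => b x ^ 2) (fun _ _ => sq_nonneg _) (Finset.mem_univ x)

section
variable {L : ℕ} {a : Fin (L+2) → ℝ} {m u B e : ℝ} {ε w : Fin (L+2) → ℝ}

lemma Setup.step (H : Setup (L+2) a m u B ε w) (he : e ^ 2 = 1)
    (hεe : ∀ p, ε p = e ^ (p:ℕ)) (hwe : ∀ p, w p = (((L+2:ℕ):ℝ) - (p:ℕ)) * e ^ (p:ℕ)) (p : Fin L) :
    ∑ σ : Equiv.Perm (Fin (L+2)), (if |TT a w σ| ≤ yw a u B ε σ then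
        2 * (a (σ (p.castAdd 2)) - a (σ (p.addNat 2))) ^ 2 else 0)
    ≤ 2 * ∑ σ : Equiv.Perm (Fin (L+2)),
        (ε (p.castAdd 2) * a (σ (p.castAdd 2)) - ε (p.addNat 2) * a (σ (p.addNat 2)))
          * clip (5 * yw a u B ε σ) (TT a w σ) := by
  set i : Fin (L+2) := p.castAdd 2 with hi
  set j : Fin (L+2) := p.addNat 2 with hj
  have hiv : (i:ℕ) = p := rfl
  have hjv : (j:ℕ) = p + 2 := rfl
  have hεij : ε j = ε i := by rw [hεe, hεe, hiv, hjv, pow_add, he, mul_one]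
  have hwij : w j - w i = -2 * ε i := by
    rw [hwe, hwe, hεe, hiv, hjv, pow_add, he]; push_cast; ring
  have hε2 : ε i ^ 2 = 1 := by rw [hεe, ← pow_mul, mul_comm, pow_mul, he, one_pow]
  have hyw : ∀ σ, yw a u B ε (σ * Equiv.swap i j) = yw a u B ε σ := by
    intro σ
    unfold yw
    have := lin_swap ε (fun x => a x - u) σ i j
    rw [this, hεij]; simp
  have hTT : ∀ σ, TT a w (σ * Equiv.swap i j) = TT a w σ + (-2 * ε i) * (a (σ i) - a (σ j)) := by
    intro σ
    unfold TT
    rw [lin_swap w a σ i j, hwij]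
  have hs := (swapInv_univ (Finset.univ : Finset (Fin (L+2)))).swap_id (Finset.mem_univ i)
    (Finset.mem_univ j) a (fun σ => clip (5 * yw a u B ε σ) (TT a w σ))
  have e1 : 2 * ∑ σ : Equiv.Perm (Fin (L+2)), (ε i * a (σ i) - ε j * a (σ j))
          * clip (5 * yw a u B ε σ) (TT a w σ)
      = ∑ σ : Equiv.Perm (Fin (L+2)), (-ε i * (a (σ i) - a (σ j))) *
        (clip (5 * yw a u B ε (σ * Equiv.swap i j)) (TT a w (σ * Equiv.swap i j))
          - clip (5 * yw a u B ε σ) (TT a w σ)) := by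
    have e2 : ∀ σ : Equiv.Perm (Fin (L+2)), (-ε i * (a (σ i) - a (σ j))) *
        (clip (5 * yw a u B ε (σ * Equiv.swap i j)) (TT a w (σ * Equiv.swap i j))
          - clip (5 * yw a u B ε σ) (TT a w σ)) = -ε i * ((a (σ i) - a (σ j)) *
        (clip (5 * yw a u B ε (σ * Equiv.swap i j)) (TT a w (σ * Equiv.swap i j))
          - clip (5 * yw a u B ε σ) (TT a w σ))) := fun σ => by ring
    simp only [e2]
    rw [← Finset.mul_sum, hs, hεij]
    rw [← mul_assoc, Finset.mul_sum, Finset.mul_sum]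
    refine Finset.sum_congr rfl fun σ _ => by ring
  rw [e1]
  refine Finset.sum_le_sum fun σ _ => ?_
  rw [hyw, hTT]
  set d := a (σ i) - a (σ j) with hd
  have hy := H.yw_nonneg σ
  split_ifs with hwin
  · have hyB : B ≤ yw a u B ε σ := by
      unfold yw; have := abs_nonneg (∑ p, ε p * (a (σ p) - u)); have := abs_nonneg ((∑ p, ε p) * u)
      linarith
    have b1 := sq_le_B (b := fun x => a x - u) H.hB0 H.hB (σ i)
    have b2 := sq_le_B (b := fun x => a x - u) H.hB0 H.hB (σ j)
    have hd2 : |d| ≤ 2 * B := by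
      have : d = (a (σ i) - u) - (a (σ j) - u) := by rw [hd]; ring
      rw [this]; refine (abs_sub _ _).trans ?_; linarith
    have hεa : |ε i| ≤ 1 := H.hε i
    have h5 : |TT a w σ + -2 * ε i * d| ≤ 5 * yw a u B ε σ := by
      refine (abs_add_le _ _).trans ?_
      rw [abs_mul, abs_mul]
      have : |(-2:ℝ)| * |ε i| * |d| ≤ 2 * 1 * (2 * B) := by
        rw [abs_neg, abs_two]; gcongr
      linarith
    rw [clip_of_abs_le h5, clip_of_abs_le (by linarith)]
    have : -ε i * d * (TT a w σ + -2 * ε i * d - TT a w σ) = 2 * ε i ^ 2 * d ^ 2 := by ring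
    rw [this, hε2]; simp
  · rcases le_total 0 (-ε i * d) with h | h
    · apply mul_nonneg h
      have := clip_mono (5 * yw a u B ε σ) (show TT a w σ ≤ TT a w σ + -2 * ε i * d by linarith)
      linarith
    · apply mul_nonneg_of_nonpos_of_nonpos h
      have := clip_mono (5 * yw a u B ε σ) (show TT a w σ + -2 * ε i * d ≤ TT a w σ by linarith)
      linarith

lemma Setup.upper (H : Setup (L+2) a m u B ε w) (he : e ^ 2 = 1)
    (hεe : ∀ p, ε p = e ^ (p:ℕ)) (hwe : ∀ p, w p = (((L+2:ℕ):ℝ) - (p:ℕ)) * e ^ (p:ℕ)) :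
    ((L+2:ℕ):ℝ) * ∑ σ : Equiv.Perm (Fin (L+2)), (if |TT a w σ| ≤ yw a u B ε σ then
        ∑ p : Fin L, 2 * (a (σ (p.castAdd 2)) - a (σ (p.addNat 2))) ^ 2 else 0)
    ≤ 98 * 10 ^ 9 * (Fintype.card (Equiv.Perm (Fin (L+2))) * B ^ 2) := by
  have hK := H.hK
  have h1 := Finset.sum_le_sum fun p (_ : p ∈ (Finset.univ : Finset (Fin L))) => H.step he hεe hwe p
  have h2 : ∑ p : Fin L, ∑ σ : Equiv.Perm (Fin (L+2)), (if |TT a w σ| ≤ yw a u B ε σ then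
        2 * (a (σ (p.castAdd 2)) - a (σ (p.addNat 2))) ^ 2 else 0)
      = ∑ σ : Equiv.Perm (Fin (L+2)), (if |TT a w σ| ≤ yw a u B ε σ then
        ∑ p : Fin L, 2 * (a (σ (p.castAdd 2)) - a (σ (p.addNat 2))) ^ 2 else 0) := by
    rw [Finset.sum_comm]
    refine Finset.sum_congr rfl fun σ _ => ?_
    split_ifs <;> simp
  rw [h2, ← Finset.mul_sum, Finset.sum_comm] at h1
  set F : Equiv.Perm (Fin (L+2)) → ℝ := fun σ => clip (5 * yw a u B ε σ) (TT a w σ) with hF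
  have h3 : ∀ σ : Equiv.Perm (Fin (L+2)), ∑ p : Fin L,
      (ε (p.castAdd 2) * a (σ (p.castAdd 2)) - ε (p.addNat 2) * a (σ (p.addNat 2)))
          * clip (5 * yw a u B ε σ) (TT a w σ)
      = (ε 0 * a (σ 0) + ε 1 * a (σ 1) - ε (Fin.last L).castSucc * a (σ (Fin.last L).castSucc)
          - ε (Fin.last (L+1)) * a (σ (Fin.last (L+1)))) * F σ := by
    intro σ
    rw [← Finset.sum_mul]
    exact congrArg (· * F σ) (tele2 L (fun q => ε q * a (σ q)))
  simp only [h3] at h1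
  have key : ∀ i j : Fin (L+2), i ≠ j → ε i = ε j →
      ((L+2:ℕ):ℝ) * (2 * ∑ σ : Equiv.Perm (Fin (L+2)), ε i * (a (σ i) - a (σ j)) * F σ)
        ≤ 49 * 10 ^ 9 * (Fintype.card (Equiv.Perm (Fin (L+2))) * B ^ 2) := by
    intro i j hij hεij
    refine H.end_bound i j hij hεij ?_
    have : w j - w i = ((i:ℕ) - (j:ℕ) : ℝ) * ε i := by
      have e1 := hεe i
      have e2 := hεe j
      rw [hwe, hwe, ← e1, ← e2, hεij]; ring
    rw [this, abs_mul]
    have h1 : |((i:ℕ):ℝ) - (j:ℕ)| ≤ ((L+2:ℕ):ℝ) := by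
      have hi : ((i:ℕ):ℝ) ≤ ((L+2:ℕ):ℝ) := by exact_mod_cast i.2.le
      have hj : ((j:ℕ):ℝ) ≤ ((L+2:ℕ):ℝ) := by exact_mod_cast j.2.le
      have hi0 : (0:ℝ) ≤ ((i:ℕ):ℝ) := by positivity
      have hj0 : (0:ℝ) ≤ ((j:ℕ):ℝ) := by positivity
      rw [abs_le]; constructor <;> linarith
    calc _ ≤ ((L+2:ℕ):ℝ) * 1 := mul_le_mul h1 (H.hε i) (abs_nonneg _) (by positivity)
      _ = _ := mul_one _
  have fin2 : ∀ x y : Fin (L+2), x ≠ y → ε x = ε y → ∀ x' y' : Fin (L+2), x' ≠ y' → ε x' = ε y' →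
      (∀ f : Fin (L+2) → ℝ, f x + f x' - f y - f y' = f 0 + f 1 - f (Fin.last L).castSucc - f (Fin.last (L+1))) →
      ((L+2:ℕ):ℝ) * (2 * ∑ σ : Equiv.Perm (Fin (L+2)), (ε 0 * a (σ 0) + ε 1 * a (σ 1) - ε (Fin.last L).castSucc * a (σ (Fin.last L).castSucc)
          - ε (Fin.last (L+1)) * a (σ (Fin.last (L+1)))) * F σ)
      ≤ 98 * 10 ^ 9 * (Fintype.card (Equiv.Perm (Fin (L+2))) * B ^ 2) := by
    intro x y hxy hε x' y' hxy' hε' hf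
    have k1 := key x y hxy hε
    have k2 := key x' y' hxy' hε'
    have : ∑ σ : Equiv.Perm (Fin (L+2)), (ε 0 * a (σ 0) + ε 1 * a (σ 1) - ε (Fin.last L).castSucc * a (σ (Fin.last L).castSucc)
          - ε (Fin.last (L+1)) * a (σ (Fin.last (L+1)))) * F σ
        = ∑ σ : Equiv.Perm (Fin (L+2)), ε x * (a (σ x) - a (σ y)) * F σ
          + ∑ σ : Equiv.Perm (Fin (L+2)), ε x' * (a (σ x') - a (σ y')) * F σ := by
      rw [← Finset.sum_add_distrib]
      refine Finset.sum_congr rfl fun σ _ => ?_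
      rw [← hf (fun q => ε q * a (σ q))]
      rw [← hε, ← hε']; ring
    rw [this]; linarith
  refine (mul_le_mul_of_nonneg_left h1 (by positivity)).trans ?_
  have hl : (((Fin.last L).castSucc : Fin (L+2)) : ℕ) = L := rfl
  have hl1 : ((Fin.last (L+1) : Fin (L+2)) : ℕ) = L + 1 := rfl
  have h0 : ((0 : Fin (L+2)) : ℕ) = 0 := rfl
  have h1' : ((1 : Fin (L+2)) : ℕ) = 1 := by simp
  rcases Nat.even_or_odd' L with ⟨k, hk | hk⟩
  · refine fin2 0 (Fin.last L).castSucc ?_ ?_ 1 (Fin.last (L+1)) ?_ ?_ ?_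
    · intro h; have := congrArg Fin.val h; rw [hl, h0] at this; omega
    · rw [hεe, hεe, hl, h0, hk, pow_mul, he]; simp
    · intro h; have := congrArg Fin.val h; rw [hl1, h1'] at this; omega
    · rw [hεe, hεe, hl1, h1', hk, pow_add, pow_mul, he]; simp
    · intro f; ring
  · refine fin2 0 (Fin.last (L+1)) ?_ ?_ 1 (Fin.last L).castSucc ?_ ?_ ?_
    · intro h; have := congrArg Fin.val h; rw [hl1, h0] at this; omega
    · rw [hεe, hεe, hl1, h0, hk, show 2*k+1+1 = 2*(k+1) by ring, pow_mul, he]; simp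
    · intro h; have := congrArg Fin.val h; rw [hl, h1'] at this; omega
    · rw [hεe, hεe, hl, h1', hk, pow_add, pow_mul, he]; simp
    · intro f; ring

lemma Setup.lower (H : Setup (L+2) a m u B ε w) (σ : Equiv.Perm (Fin (L+2))) :
    B ^ 4 - 4 * (∑ p : Fin L, (a (σ (p.castAdd 2)) - u) * (a (σ (p.addNat 2)) - u)) ^ 2
      ≤ B ^ 2 * ∑ p : Fin L, 2 * (a (σ (p.castAdd 2)) - a (σ (p.addNat 2))) ^ 2 := by
  have hK := H.hK
  set b : Fin (L+2) → ℝ := fun q => a (σ q) - u with hb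
  have hs : ∑ q, b q ^ 2 = B ^ 2 := by
    rw [← H.hB]; exact Equiv.sum_comp σ (fun z => (a z - u) ^ 2)
  set Z := ∑ p : Fin L, (a (σ (p.castAdd 2)) - u) * (a (σ (p.addNat 2)) - u) with hZ
  have h1 : ∑ q, b q ^ 2 = ∑ p : Fin L, b (p.castAdd 2) ^ 2 + b (Fin.last L).castSucc ^ 2 + b (Fin.last (L+1)) ^ 2 := by
    rw [Fin.sum_univ_castSucc, Fin.sum_univ_castSucc]; rfl
  have h2 : ∑ q, b q ^ 2 = b 0 ^ 2 + (b 1 ^ 2 + ∑ p : Fin L, b (p.addNat 2) ^ 2) := by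
    rw [Fin.sum_univ_succ, Fin.sum_univ_succ]; rfl
  have h3 : ∑ p : Fin L, 2 * (a (σ (p.castAdd 2)) - a (σ (p.addNat 2))) ^ 2
      = 2 * (∑ p : Fin L, b (p.castAdd 2) ^ 2 + ∑ p : Fin L, b (p.addNat 2) ^ 2) - 4 * Z := by
    rw [hZ, Finset.mul_sum, ← Finset.sum_add_distrib, Finset.mul_sum, ← Finset.sum_sub_distrib]
    refine Finset.sum_congr rfl fun p _ => ?_
    simp only [hb]; ring
  have h4 : b 0 ^ 2 + b 1 ^ 2 + b (Fin.last L).castSucc ^ 2 + b (Fin.last (L+1)) ^ 2 ≤ B ^ 2 := by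
    have hsub := Finset.sum_le_sum_of_subset_of_nonneg
      (Finset.subset_univ ({0, 1, (Fin.last L).castSucc, Fin.last (L+1)} : Finset (Fin (L+2))))
      (f := fun q => b q ^ 2) (fun _ _ _ => sq_nonneg _)
    have hl : (((Fin.last L).castSucc : Fin (L+2)) : ℕ) = L := rfl
    have hl1 : ((Fin.last (L+1) : Fin (L+2)) : ℕ) = L + 1 := rfl
    have h0 : ((0 : Fin (L+2)) : ℕ) = 0 := rfl
    have h1' : ((1 : Fin (L+2)) : ℕ) = 1 := by simp
    rw [Finset.sum_insert, Finset.sum_insert, Finset.sum_insert, Finset.sum_singleton, hs] at hsub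
    · linarith
    · simp only [Finset.mem_singleton, Fin.ext_iff, hl, hl1]; omega
    · simp only [Finset.mem_insert, Finset.mem_singleton, Fin.ext_iff, hl, hl1, h1']; omega
    · simp only [Finset.mem_insert, Finset.mem_singleton, Fin.ext_iff, hl, hl1, h1', h0]; omega
  have h5 : 2 * B ^ 2 - 4 * Z ≤ ∑ p : Fin L, 2 * (a (σ (p.castAdd 2)) - a (σ (p.addNat 2))) ^ 2 := by
    rw [h3]; linarith
  have h6 := mul_le_mul_of_nonneg_left h5 (sq_nonneg B)
  nlinarith [sq_nonneg (B ^ 2 - 2 * Z)]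

lemma Setup.main (H : Setup (L+2) a m u B ε w) (he : e ^ 2 = 1) (hBpos : 0 < B)
    (hεe : ∀ p, ε p = e ^ (p:ℕ)) (hwe : ∀ p, w p = (((L+2:ℕ):ℝ) - (p:ℕ)) * e ^ (p:ℕ)) :
    ((L+2:ℕ):ℝ) * ((Finset.univ.filter fun σ : Equiv.Perm (Fin (L+2)) =>
        |TT a w σ| ≤ yw a u B ε σ).card : ℝ)
    ≤ 10 ^ 11 * Fintype.card (Equiv.Perm (Fin (L+2))) := by
  have hK := H.hK
  have hU := H.upper he hεe hwe
  have hZ := Z_moment L (by omega) (fun x => a x - u) H.hu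
  rw [H.hB] at hZ
  set N : ℝ := ((Fintype.card (Equiv.Perm (Fin (L+2))) : ℕ) : ℝ) with hN
  have hN0 : 0 ≤ N := by positivity
  set Zs := ∑ σ : Equiv.Perm (Fin (L + 2)),
      (∑ p : Fin L, (a (σ (p.castAdd 2)) - u) * (a (σ (p.addNat 2)) - u)) ^ 2 with hZs
  set Us := ∑ σ : Equiv.Perm (Fin (L+2)), (if |TT a w σ| ≤ yw a u B ε σ then
        ∑ p : Fin L, 2 * (a (σ (p.castAdd 2)) - a (σ (p.addNat 2))) ^ 2 else 0) with hUs
  set c : ℝ := ((Finset.univ.filter fun σ : Equiv.Perm (Fin (L+2)) =>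
        |TT a w σ| ≤ yw a u B ε σ).card : ℝ) with hc
  have hLr : (100:ℝ) ≤ L := by
    have : 100 ≤ L := by omega
    exact_mod_cast this
  have key : B ^ 4 * c ≤ 4 * Zs + B ^ 2 * Us := by
    have : B ^ 4 * c = ∑ σ : Equiv.Perm (Fin (L+2)), (if |TT a w σ| ≤ yw a u B ε σ then B ^ 4 else 0) := by
      rw [← Finset.sum_filter, Finset.sum_const, nsmul_eq_mul, mul_comm]
    rw [this, hZs, hUs, Finset.mul_sum, Finset.mul_sum, ← Finset.sum_add_distrib]
    refine Finset.sum_le_sum fun σ _ => ?_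
    have hl := H.lower σ
    split_ifs
    · linarith
    · have := sq_nonneg (∑ p : Fin L, (a (σ (p.castAdd 2)) - u) * (a (σ (p.addNat 2)) - u))
      linarith
  have hB4 : 0 < B ^ 4 := by positivity
  have hZ2 : ((L+2:ℕ):ℝ) * Zs ≤ 20 * (N * B ^ 4) := by
    have hZ0 : 0 ≤ Zs := Finset.sum_nonneg fun _ _ => sq_nonneg _
    have : ((L+2:ℕ):ℝ) * Zs ≤ 2 * (L * Zs) := by push_cast; nlinarith
    have e4 : (B ^ 2) ^ 2 = B ^ 4 := by ring
    rw [e4] at hZ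
    linarith
  have hK0 : (0:ℝ) ≤ ((L+2:ℕ):ℝ) := by positivity
  have k2 := mul_le_mul_of_nonneg_left key hK0
  have k3 := mul_le_mul_of_nonneg_left hU (sq_nonneg B)
  have : B ^ 4 * (((L+2:ℕ):ℝ) * c) ≤ B ^ 4 * (10 ^ 11 * N) := by
    have : 0 ≤ N * B ^ 4 := by positivity
    nlinarith
  exact le_of_mul_le_mul_left this hB4
end

/-- main probabilistic estimate -/
lemma main_count (K : ℕ) (hK : 2 ≤ K) (a : Fin K → ℝ) (e : ℝ) (he : e = 1 ∨ e = -1) :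
    (K:ℝ) * ((Finset.univ.filter fun σ : Equiv.Perm (Fin K) =>
        (∑ p : Fin K, e ^ (p:ℕ) * a (σ p)) ≠ 0 ∧
        |∑ p : Fin K, ((K:ℝ) - (p:ℕ)) * e ^ (p:ℕ) * a (σ p)| ≤ |∑ p : Fin K, e ^ (p:ℕ) * a (σ p)|).card : ℝ)
    ≤ 10 ^ 11 * Fintype.card (Equiv.Perm (Fin K)) := by
  by_cases hK2 : K < 102
  · have h1 : (K:ℝ) ≤ 10 ^ 11 := by
      have : (K:ℝ) ≤ 102 := by exact_mod_cast hK2.le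
      linarith
    refine mul_le_mul h1 ?_ (by positivity) (by positivity)
    exact_mod_cast Finset.card_le_univ _
  push Not at hK2
  obtain ⟨L, rfl⟩ : ∃ L, K = L + 2 := ⟨K - 2, by omega⟩
  have he2 : e ^ 2 = 1 := by rcases he with rfl | rfl <;> norm_num
  have hea : |e| = 1 := by rcases he with rfl | rfl <;> norm_num
  have hpow : ∀ k : ℕ, |e ^ k| = 1 := fun k => by rw [abs_pow, hea, one_pow]
  set ε : Fin (L+2) → ℝ := fun p => e ^ (p:ℕ) with hε
  set w : Fin (L+2) → ℝ := fun p => (((L+2:ℕ):ℝ) - (p:ℕ)) * e ^ (p:ℕ) with hw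
  set u : ℝ := (∑ x, a x) / ((L+2:ℕ):ℝ) with hu
  set B : ℝ := √(∑ x, (a x - u) ^ 2) with hB
  have hBsq : ∑ x, (a x - u) ^ 2 = B ^ 2 := by
    rw [hB, Real.sq_sqrt (Finset.sum_nonneg fun _ _ => sq_nonneg _)]
  have hB0 : 0 ≤ B := Real.sqrt_nonneg _
  obtain ⟨m, hm1, hm2⟩ := exists_median a
  have hKpos : (0:ℝ) < ((L+2:ℕ):ℝ) := by positivity
  have hlt : ∀ p : Fin (L+2), ((p:ℕ):ℝ) ≤ ((L+2:ℕ):ℝ) := fun p => by exact_mod_cast p.2.le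
  have hwabs : ∀ p : Fin (L+2), |w p| = ((L+2:ℕ):ℝ) - (p:ℕ) := by
    intro p
    simp only [hw]
    rw [abs_mul, hpow, mul_one, abs_of_nonneg]
    linarith [hlt p]
  have H : Setup (L+2) a m u B ε w := by
    refine ⟨hK2, fun p => (hpow _).le, ?_, ?_, ?_, ?_, ?_, ?_, hB0, hBsq⟩
    · intro p; rw [hwabs]; have : (0:ℝ) ≤ ((p:ℕ):ℝ) := by positivity
      linarith
    · intro p q
      have := abs_abs_sub_abs_le (w p) (w q)
      rw [hwabs, hwabs] at this
      rw [abs_sub_comm]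
      have e1 : ((q:ℕ):ℝ) - (p:ℕ) = ((L+2:ℕ):ℝ) - (p:ℕ) - (((L+2:ℕ):ℝ) - (q:ℕ)) := by ring
      rw [e1]; exact this
    · have hrev : ∀ p : Fin (L+2), ε p.rev = e ^ (L+1) * ε p := by
        intro p
        simp only [hε, Fin.val_rev]
        have h1 : e ^ ((p:ℕ) + p) = 1 := by rw [← two_mul, pow_mul, he2, one_pow]
        have h2 : L + 1 = (L + 2 - ((p:ℕ) + 1)) + p := by have := p.2; omega
        calc e ^ (L + 2 - ((p:ℕ) + 1)) = e ^ (L + 2 - ((p:ℕ) + 1)) * e ^ ((p:ℕ) + p) := by rw [h1, mul_one]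
          _ = _ := by
            rw [congrArg (fun k => e ^ k) h2]
            simp only [pow_add]; ring
      have hcase : e ^ (L+1) = 1 ∨ e ^ (L+1) = -1 := by
        rcases he with rfl | rfl
        · left; simp
        · exact neg_one_pow_eq_or ℝ _
      rcases hcase with h | h
      · right
        have hs : ∑ p, w p = ∑ p : Fin (L+2), ((p:ℕ) + 1 : ℝ) * ε p := by
          rw [← Equiv.sum_comp Fin.revPerm w]
          refine Finset.sum_congr rfl fun p _ => ?_
          have := hrev p
          rw [h, one_mul] at this
          simp only [hε] at this
          simp only [hw, Fin.revPerm_apply, hε]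
          rw [this]
          congr 1
          rw [Fin.val_rev, Nat.cast_sub (by have := p.2; omega)]
          push_cast; ring
        rw [two_mul]
        nth_rewrite 1 [hs]
        rw [← Finset.sum_add_distrib, Finset.mul_sum]
        refine Finset.sum_congr rfl fun p _ => ?_
        simp only [hw, hε]; ring
      · left
        have : ∑ p, ε p = - ∑ p, ε p := by
          conv_lhs => rw [← Equiv.sum_comp Fin.revPerm ε]
          rw [← Finset.sum_neg_distrib]
          refine Finset.sum_congr rfl fun p _ => ?_
          rw [Fin.revPerm_apply, hrev, h]; ring
        linarith
    · simpa only [sub_nonneg] using hm1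
    · simpa only [sub_nonpos] using hm2
    · rw [Finset.sum_sub_distrib]
      simp only [Finset.sum_const, Finset.card_univ, Fintype.card_fin, nsmul_eq_mul]
      rw [hu]; field_simp; ring
  rcases hB0.eq_or_lt with hB00 | hBpos
  · have hau : ∀ x, a x = u := by
      intro x
      have := sq_le_B (b := fun x => a x - u) hB0 hBsq x
      rw [← hB00] at this
      have := abs_nonpos_iff.1 this
      linarith
    rw [Finset.filter_false_of_mem]
    · simp
    · rintro σ _ ⟨h1, h2⟩
      simp only [hau] at h1 h2
      have e1 : ∑ p : Fin (L+2), (((L+2:ℕ):ℝ) - (p:ℕ)) * e ^ (p:ℕ) * u = (∑ p, w p) * u := by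
        rw [Finset.sum_mul]
      have e2 : ∑ p : Fin (L+2), e ^ (p:ℕ) * u = (∑ p, ε p) * u := by rw [Finset.sum_mul]
      rw [e1, e2] at h2
      rw [e2] at h1
      have hK3 : (102:ℝ) ≤ ((L+2:ℕ):ℝ) := by exact_mod_cast hK2
      rcases H.hst with h | h
      · rw [h] at h1; simp at h1
      · have h3 : 2 * ((∑ p, w p) * u) = (((L+2:ℕ):ℝ) + 1) * ((∑ p, ε p) * u) := by
          rw [← mul_assoc, h, mul_assoc]
        have h4 := congrArg abs h3
        rw [abs_mul, abs_mul (((L+2:ℕ):ℝ) + 1), abs_two, abs_of_pos (by linarith : (0:ℝ) < ((L+2:ℕ):ℝ) + 1)] at h4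
        have h5 := abs_pos.2 h1
        nlinarith
  · refine le_trans ?_ (H.main he2 hBpos (fun p => rfl) (fun p => rfl))
    refine mul_le_mul_of_nonneg_left ?_ hKpos.le
    rw [Nat.cast_le]
    refine Finset.card_le_card ?_
    intro σ hσ
    simp only [Finset.mem_filter, Finset.mem_univ, true_and] at hσ ⊢
    refine hσ.2.trans ?_
    unfold yw
    have : ∑ p : Fin (L+2), e ^ (p:ℕ) * a (σ p) = ∑ p, ε p * (a (σ p) - u) + (∑ p, ε p) * u := by
      rw [Finset.sum_mul, ← Finset.sum_add_distrib]
      refine Finset.sum_congr rfl fun p _ => by simp only [hε]; ring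
    rw [this]
    refine (abs_add_le _ _).trans ?_
    linarith

end PartA7

section PartB1

/-- weak sign change between consecutive terms -/
def XX (q : ℕ → ℝ) (k : ℕ) : Prop := q (k-1) * q k ≤ 0 ∧ q (k-1) ≠ q k

noncomputable instance (q : ℕ → ℝ) : DecidablePred (XX q) := fun _ => Classical.dec _

lemma signVar_le (d : ℕ) : ∀ Q : ℝ[X], Q.natDegree ≤ d →
    Q.signVariations ≤ ((Finset.Ioc 0 d).filter (XX Q.coeff)).card := by
  induction d using Nat.strong_induction_on with
  | _ d ih =>
    intro Q hQ
    by_cases h0 : Q = 0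
    · simp [h0]
    by_cases hE : Q.eraseLead = 0
    · rw [signVariations_eq_eraseLead_add_ite h0, hE]
      have : Q.leadingCoeff ≠ 0 := leadingCoeff_ne_zero.2 h0
      simp [this]
    have hlt : Q.eraseLead.natDegree < Q.natDegree :=
      eraseLead_natDegree_lt_or_eraseLead_eq_zero Q |>.resolve_right hE
    set D := Q.natDegree with hD
    have h1 := ih (D-1) (by omega) Q.eraseLead (by omega)
    have h2 : (Finset.Ioc 0 (D-1)).filter (XX Q.eraseLead.coeff)
        = (Finset.Ioc 0 (D-1)).filter (XX Q.coeff) := by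
      apply Finset.filter_congr
      intro k hk
      rw [Finset.mem_Ioc] at hk
      unfold XX
      rw [eraseLead_coeff_of_ne _ (by omega), eraseLead_coeff_of_ne _ (by omega)]
    rw [h2] at h1
    rw [signVariations_eq_eraseLead_add_ite h0]
    have hsub : (Finset.Ioc 0 (D-1)).filter (XX Q.coeff) ⊆ (Finset.Ioc 0 d).filter (XX Q.coeff) := by
      apply Finset.filter_subset_filter
      apply Finset.Ioc_subset_Ioc_right; omega
    split_ifs with hs
    · have hDX : XX Q.coeff D := by
        have hl : Q.coeff D ≠ 0 := leadingCoeff_ne_zero.2 h0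
        have hel : Q.eraseLead.leadingCoeff ≠ 0 := leadingCoeff_ne_zero.2 hE
        have hprod : Q.coeff (D-1) * Q.coeff D ≤ 0 := by
          by_cases hd1 : Q.eraseLead.natDegree = D - 1
          · have e1 : Q.eraseLead.leadingCoeff = Q.coeff (D-1) := by
              rw [leadingCoeff, hd1, eraseLead_coeff_of_ne _ (by omega)]
            rw [e1] at hs hel
            have e2 : Q.leadingCoeff = Q.coeff D := rfl
            rw [e2] at hs
            rcases lt_or_gt_of_ne hl with h | h
            · rw [sign_neg h] at hs
              have : 0 < Q.coeff (D-1) := by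
                rcases lt_or_gt_of_ne hel with h' | h'
                · rw [sign_neg h'] at hs; simp at hs
                · exact h'
              nlinarith
            · rw [sign_pos h] at hs
              have : Q.coeff (D-1) < 0 := by
                rcases lt_or_gt_of_ne hel with h' | h'
                · exact h'
                · rw [sign_pos h'] at hs; simp at hs
              nlinarith
          · have : Q.coeff (D-1) = 0 := by
              rw [← eraseLead_coeff_of_ne (f := Q) (D-1) (by omega)]
              apply coeff_eq_zero_of_natDegree_lt; omega
            rw [this]; simp
        refine ⟨hprod, ?_⟩
        intro h
        rw [h] at hprod
        have := mul_self_pos.2 hl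
        linarith
      have hmem : D ∉ (Finset.Ioc 0 (D-1)).filter (XX Q.coeff) := by
        simp only [Finset.mem_filter, Finset.mem_Ioc]; omega
      have h3 := Finset.card_le_card (Finset.insert_subset
        (show D ∈ (Finset.Ioc 0 d).filter (XX Q.coeff) from
          Finset.mem_filter.2 ⟨Finset.mem_Ioc.2 ⟨by omega, hQ⟩, hDX⟩) hsub)
      rw [Finset.card_insert_of_notMem hmem] at h3
      omega
    · have := Finset.card_le_card hsub
      omega

lemma XX_split (M a b : ℕ) (hM : M ≤ a + b) (Q : ℝ[X]) :
    ((Finset.Ioc 0 M).filter (XX Q.coeff)).card ≤ ((Finset.Ioc 0 a).filter (XX Q.coeff)).card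
      + ((Finset.Ioc 0 b).filter (XX (reflect M Q).coeff)).card := by
  classical
  have h1 : (Finset.Ioc 0 M).filter (XX Q.coeff) ⊆ (Finset.Ioc 0 a).filter (XX Q.coeff)
      ∪ (Finset.Ioc a M).filter (XX Q.coeff) := by
    intro k hk
    simp only [Finset.mem_filter, Finset.mem_Ioc, Finset.mem_union] at hk ⊢
    rcases Nat.lt_or_ge a k with h | h
    · right; exact ⟨⟨h, hk.1.2⟩, hk.2⟩
    · left; exact ⟨⟨hk.1.1, h⟩, hk.2⟩
  refine (Finset.card_le_card h1).trans ((Finset.card_union_le _ _).trans ?_)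
  refine Nat.add_le_add_left ?_ _
  refine Finset.card_le_card_of_injOn (fun k => M + 1 - k) ?_ ?_
  · intro k hk
    simp only [Finset.coe_filter, Finset.mem_Ioc, Set.mem_ofPred_eq] at hk ⊢
    obtain ⟨⟨hk1, hk2⟩, hk3, hk4⟩ := hk
    refine ⟨⟨by omega, by omega⟩, ?_⟩
    unfold XX
    rw [coeff_reflect, coeff_reflect, revAt_le (by omega), revAt_le (by omega)]
    have e1 : M - (M + 1 - k - 1) = k := by omega
    have e2 : M - (M + 1 - k) = k - 1 := by omega
    rw [e1, e2, mul_comm]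
    exact ⟨hk3, hk4.symm⟩
  · intro k hk k' hk' h
    simp only [Finset.coe_filter, Finset.mem_Ioc, Set.mem_ofPred_eq] at hk hk' h
    omega

/-- partial sums of coefficients -/
noncomputable def SS (P : ℝ[X]) (k : ℕ) : ℝ := ∑ j ∈ Finset.range (k+1), P.coeff j
/-- double partial sums -/
noncomputable def TS (P : ℝ[X]) (k : ℕ) : ℝ := ∑ j ∈ Finset.range (k+1), SS P j
/-- the bad event -/
def WW (P : ℝ[X]) (k : ℕ) : Prop := SS P k ≠ 0 ∧ |TS P k| ≤ |SS P k|

noncomputable instance (P : ℝ[X]) : DecidablePred (WW P) := fun _ => Classical.dec _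

lemma TS_succ (P : ℝ[X]) (k : ℕ) : TS P (k+1) = TS P k + SS P (k+1) := by
  unfold TS; rw [Finset.sum_range_succ]

lemma SS_succ (P : ℝ[X]) (k : ℕ) : SS P (k+1) = SS P k + P.coeff (k+1) := by
  unfold SS; rw [Finset.sum_range_succ]

lemma SS_const (P : ℝ[X]) {n k : ℕ} (hP : P.natDegree ≤ n) (hk : n ≤ k) : SS P k = P.eval 1 := by
  rw [eval_eq_sum_range' (n := k+1) (by omega)]
  unfold SS; simp

lemma TS_lin (P : ℝ[X]) {n : ℕ} (hP : P.natDegree ≤ n) (i : ℕ) :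
    TS P (n+i) = TS P n + i * P.eval 1 := by
  induction i with
  | zero => simp
  | succ i ih =>
    rw [← Nat.add_assoc, TS_succ, ih, SS_const P hP (by omega)]; push_cast; ring

/-- `XX` for `TS` implies `WW` -/
lemma WW_of_XX (P : ℝ[X]) (q : ℕ → ℝ) (k : ℕ) (hk : 0 < k) (h1 : q k = TS P k)
    (h2 : q (k-1) = TS P (k-1)) (h : XX q k) : WW P k := by
  obtain ⟨h3, h4⟩ := h
  rw [h1, h2] at h3 h4
  obtain ⟨j, rfl⟩ : ∃ j, k = j + 1 := ⟨k - 1, by omega⟩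
  rw [Nat.add_sub_cancel] at h3 h4
  have e := TS_succ P j
  have e' : SS P (j+1) = TS P (j+1) - TS P j := by linarith
  refine ⟨by rw [e']; exact sub_ne_zero.2 h4.symm, ?_⟩
  rw [e']
  apply sq_le_sq.1
  nlinarith [sq_nonneg (TS P j)]

lemma ps_T (P : ℝ[X]) : (P : PowerSeries ℝ) = PowerSeries.mk (TS P) * (1 - PowerSeries.X) ^ 2 := by
  have h1 : (P : PowerSeries ℝ) = PowerSeries.mk (SS P) * (1 - PowerSeries.X) := by
    ext k
    rw [mul_sub, mul_one, map_sub]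
    cases k with
    | zero => simp [SS]
    | succ k => simp [PowerSeries.coeff_succ_mul_X, SS_succ]
  have h2 : PowerSeries.mk (SS P) = PowerSeries.mk (TS P) * (1 - PowerSeries.X) := by
    ext k
    rw [mul_sub, mul_one, map_sub]
    cases k with
    | zero => simp [TS]
    | succ k => simp [PowerSeries.coeff_succ_mul_X, TS_succ]
  rw [h1, h2, sq, mul_assoc]

/-- geometric polynomial -/
noncomputable def GG (N : ℕ) : ℝ[X] := ∑ i ∈ Finset.range (N+1), X ^ i

lemma GG_mul (N : ℕ) : (GG N : ℝ[X]) * (1 - X) = 1 - X ^ (N+1) := by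
  have := geom_sum_mul_neg (X : ℝ[X]) (N+1)
  exact this

lemma GG_deg (N : ℕ) : (GG N).natDegree ≤ N := by
  unfold GG
  refine natDegree_sum_le_of_forall_le _ _ fun i hi => ?_
  rw [Finset.mem_range] at hi
  rw [natDegree_X_pow]; omega

lemma GG_ne (N : ℕ) : GG N ≠ 0 := by
  intro h
  have := GG_mul N
  rw [h, zero_mul] at this
  have := congrArg (eval 0) this
  simp at this

lemma GG_reflect (N : ℕ) : reflect N (GG N) = GG N := by
  ext k
  have : ∀ k, (GG N).coeff k = if k ≤ N then 1 else 0 := by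
    intro k
    unfold GG
    simp only [finsetSum_coeff, coeff_X_pow]
    rw [Finset.sum_ite_eq]
    simp only [Finset.mem_range, Nat.lt_succ_iff]
  rw [coeff_reflect, this, this]
  by_cases h : k ≤ N
  · rw [revAt_le h]; simp [h]
  · rw [revAt_eq_self_of_lt (by omega)]

lemma coeff_PGG (P : ℝ[X]) (N k : ℕ) (hk : k ≤ 2 * N + 1) :
    (P * GG N * GG N).coeff k = TS P k - 2 * (if N + 1 ≤ k then TS P (k - (N+1)) else 0) := by
  have h1 : ((P * GG N * GG N : ℝ[X]) : PowerSeries ℝ)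
      = PowerSeries.mk (TS P) - (2 : ℝ) • (PowerSeries.mk (TS P) * PowerSeries.X ^ (N+1))
        + PowerSeries.mk (TS P) * PowerSeries.X ^ (2*N+2) := by
    have hG := congrArg (fun p : ℝ[X] => (p : PowerSeries ℝ)) (GG_mul N)
    simp only [Polynomial.coe_mul, Polynomial.coe_sub, Polynomial.coe_one, Polynomial.coe_X,
      Polynomial.coe_pow] at hG
    rw [Polynomial.coe_mul, Polynomial.coe_mul, ps_T P]
    calc _ = PowerSeries.mk (TS P) * ((GG N : PowerSeries ℝ) * (1 - PowerSeries.X)) ^ 2 := by ring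
      _ = _ := by
        rw [hG, show (2*N+2) = (N+1) + (N+1) by ring, pow_add _ (N+1) (N+1)]
        have : (2:ℝ) • (PowerSeries.mk (TS P) * PowerSeries.X ^ (N+1))
            = 2 * (PowerSeries.mk (TS P) * PowerSeries.X ^ (N+1)) := by
          rw [two_smul, two_mul]
        rw [this]; ring
  rw [← Polynomial.coeff_coe, h1, map_add, map_sub, PowerSeries.coeff_smul,
    PowerSeries.coeff_mul_X_pow', PowerSeries.coeff_mul_X_pow', PowerSeries.coeff_mk,
    PowerSeries.coeff_mk, PowerSeries.coeff_mk, if_neg (show ¬ (2*N+2 ≤ k) by omega)]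
  simp

lemma coeff_P1G (P P1 : ℝ[X]) (h : P = P1 * (1 - X)) (N k : ℕ) (hk : k ≤ N) :
    (P1 * GG N).coeff k = TS P k := by
  have hp : (P1 : PowerSeries ℝ) = PowerSeries.mk (TS P) * (1 - PowerSeries.X) := by
    have h1 := ps_T P
    have h2 := congrArg (fun p : ℝ[X] => (p : PowerSeries ℝ)) h
    simp only [Polynomial.coe_mul, Polynomial.coe_sub, Polynomial.coe_one, Polynomial.coe_X] at h2
    rw [h2, sq, ← mul_assoc] at h1
    refine mul_right_cancel₀ ?_ h1
    intro h0
    have := congrArg (PowerSeries.coeff 0) h0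
    simp at this
  have h1 : ((P1 * GG N : ℝ[X]) : PowerSeries ℝ)
      = PowerSeries.mk (TS P) - PowerSeries.mk (TS P) * PowerSeries.X ^ (N+1) := by
    have hG := congrArg (fun p : ℝ[X] => (p : PowerSeries ℝ)) (GG_mul N)
    simp only [Polynomial.coe_mul, Polynomial.coe_sub, Polynomial.coe_one, Polynomial.coe_X,
      Polynomial.coe_pow] at hG
    rw [Polynomial.coe_mul, hp]
    calc _ = PowerSeries.mk (TS P) * ((GG N : PowerSeries ℝ) * (1 - PowerSeries.X)) := by ring
      _ = _ := by rw [hG]; ring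
  rw [← Polynomial.coeff_coe, h1, map_sub, 
    PowerSeries.coeff_mul_X_pow', PowerSeries.coeff_mk, if_neg (show ¬ (N+1 ≤ k) by omega)]
  simp

lemma countP_mul_le (P G : ℝ[X]) (hP : P ≠ 0) (hG : G ≠ 0) :
    P.roots.countP (0 < ·) ≤ (P * G).roots.countP (0 < ·) := by
  rw [roots_mul (mul_ne_zero hP hG), Multiset.countP_add]; omega

lemma half_ne (P : ℝ[X]) (n : ℕ) (hP : P.natDegree ≤ n) (hS : P.eval 1 ≠ 0) :
    ∃ N0 : ℕ, ∀ N ≥ N0, ((Finset.Ioc 0 (N+n)).filter (XX (P * GG N * GG N).coeff)).card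
      ≤ 2 + ((Finset.Ioc 0 n).filter (WW P)).card := by
  classical
  set S := P.eval 1 with hSd
  have hS2 : 0 < S ^ 2 := by positivity
  set D : ℝ := |TS P n * S| + ∑ i ∈ Finset.range (n+1), 2 * |TS P i * S| with hD
  obtain ⟨N1, hN1⟩ := exists_nat_gt (D / S ^ 2)
  rw [div_lt_iff₀ hS2] at hN1
  refine ⟨N1 + n, fun N hN => ?_⟩
  set q := (P * GG N * GG N).coeff with hq
  have hlow : ∀ k ≤ N, q k = TS P k := by
    intro k hk
    rw [hq, coeff_PGG P N k (by omega), if_neg (by omega)]; ring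
  have hlin : ∀ k, n ≤ k → TS P k * S = TS P n * S + (k - n : ℝ) * S ^ 2 := by
    intro k hk
    obtain ⟨i, rfl⟩ : ∃ i, k = n + i := ⟨k - n, by omega⟩
    rw [TS_lin P hP]; push_cast; ring
  have hmid : ∀ k, N ≤ k → k ≤ N + n → 0 < q k * S := by
    intro k hk1 hk2
    have h1 : TS P k * S ≥ -|TS P n * S| + N1 * S ^ 2 := by
      rw [hlin k (by omega)]
      have : (N1:ℝ) ≤ k - n := by
        have : ((N1 + n : ℕ):ℝ) ≤ k := by exact_mod_cast hN.trans hk1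
        push_cast at this; linarith
      have := mul_le_mul_of_nonneg_right this hS2.le
      linarith [neg_abs_le (TS P n * S)]
    rw [hq, coeff_PGG P N k (by omega), sub_mul]
    have hsum0 : 0 ≤ ∑ i ∈ Finset.range (n+1), 2 * |TS P i * S| :=
      Finset.sum_nonneg fun _ _ => by positivity
    split_ifs with hc
    · have h2 := Finset.single_le_sum (f := fun i => 2 * |TS P i * S|)
        (fun _ _ => by positivity) (show k - (N+1) ∈ Finset.range (n+1) by
          rw [Finset.mem_range]; omega)
      have := le_abs_self (TS P (k - (N+1)) * S)
      nlinarith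
    · nlinarith
  have hsub : (Finset.Ioc 0 (N+n)).filter (XX q) ⊆ (Finset.Ioc n N).filter (XX q)
      ∪ (Finset.Ioc 0 n).filter (WW P) := by
    intro k hk
    simp only [Finset.mem_filter, Finset.mem_Ioc, Finset.mem_union] at hk ⊢
    obtain ⟨⟨hk1, hk2⟩, hk3⟩ := hk
    rcases Nat.lt_or_ge n k with h | h
    · rcases Nat.lt_or_ge N k with h' | h'
      · exfalso
        have a1 := hmid k (by omega) hk2
        have a2 := hmid (k-1) (by omega) (by omega)
        have := mul_pos a1 a2
        nlinarith [hk3.1]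
      · left; exact ⟨⟨h, h'⟩, hk3⟩
    · right
      exact ⟨⟨hk1, h⟩, WW_of_XX P q k hk1 (hlow k (by omega)) (hlow (k-1) (by omega)) hk3⟩
  refine (Finset.card_le_card hsub).trans ((Finset.card_union_le _ _).trans ?_)
  refine Nat.add_le_add_right ?_ _
  -- at most two
  by_cases hne : ((Finset.Ioc n N).filter (XX q)).Nonempty
  · set k0 := ((Finset.Ioc n N).filter (XX q)).min' hne with hk0
    have hk0m := Finset.min'_mem _ hne
    rw [← hk0] at hk0m
    have hfact : ∀ k ∈ (Finset.Ioc n N).filter (XX q), TS P (k-1) * S ≤ 0 ∧ 0 ≤ TS P k * S := by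
      intro k hk
      simp only [Finset.mem_filter, Finset.mem_Ioc] at hk
      obtain ⟨⟨hk1, hk2⟩, hk3, -⟩ := hk
      rw [hlow k (by omega), hlow (k-1) (by omega)] at hk3
      have a1 := hlin k (by omega)
      have a2 := hlin (k-1) (by omega)
      rw [Nat.cast_sub (by omega)] at a2
      have a3 : TS P k * S = TS P (k-1) * S + S ^ 2 := by rw [a1, a2]; push_cast; ring
      have a4 : (TS P (k-1) * S) * (TS P k * S) ≤ 0 := by
        have : (TS P (k-1) * S) * (TS P k * S) = (TS P (k-1) * TS P k) * S ^ 2 := by ring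
        rw [this]; exact mul_nonpos_of_nonpos_of_nonneg hk3 hS2.le
      constructor
      · by_contra hcon; push Not at hcon
        have : 0 < TS P k * S := by linarith
        have := mul_pos hcon this
        linarith
      · by_contra hcon; push Not at hcon
        have : TS P (k-1) * S < 0 := by linarith
        have := mul_pos_of_neg_of_neg this hcon
        linarith
    have hsub2 : (Finset.Ioc n N).filter (XX q) ⊆ {k0, k0+1} := by
      intro k hk
      have hle : k0 ≤ k := Finset.min'_le _ _ hk
      have f1 := (hfact k hk).1
      have f2 := (hfact k0 hk0m).2
      have hkm := hk
      simp only [Finset.mem_filter, Finset.mem_Ioc] at hkm hk0m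
      rw [hlin (k-1) (by omega)] at f1
      rw [hlin k0 (by omega)] at f2
      have h3 : ((k-1 : ℕ):ℝ) ≤ k0 := by
        by_contra hcon; push Not at hcon
        have : ((k0:ℝ) - n) * S ^ 2 < (((k-1:ℕ):ℝ) - n) * S ^ 2 := by
          apply mul_lt_mul_of_pos_right _ hS2; linarith
        linarith
      have h4 : k - 1 ≤ k0 := by exact_mod_cast h3
      simp only [Finset.mem_insert, Finset.mem_singleton]
      omega
    exact (Finset.card_le_card hsub2).trans Finset.card_le_two
  · rw [Finset.not_nonempty_iff_eq_empty.1 hne]; simp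

lemma reflect_deg (P : ℝ[X]) (n : ℕ) (hP : P.natDegree ≤ n) : (reflect n P).natDegree ≤ n := by
  rw [natDegree_le_iff_coeff_eq_zero]
  intro k hk
  rw [coeff_reflect, revAt_eq_self_of_lt hk]
  exact coeff_eq_zero_of_natDegree_lt (by omega)

lemma reflect_eval_one (P : ℝ[X]) (n : ℕ) (hP : P.natDegree ≤ n) :
    (reflect n P).eval 1 = P.eval 1 := by
  letI : Invertible (1:ℝ) := invertibleOne
  have := eval₂_reflect_mul_pow (RingHom.id ℝ) (1:ℝ) n P hP
  simpa using this

theorem pos_roots_le (P : ℝ[X]) (n : ℕ) (hP : P.natDegree ≤ n) (h0 : P ≠ 0) :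
    P.roots.countP (0 < ·) ≤ 4 + ((Finset.Ioc 0 n).filter (WW P)).card
      + ((Finset.Ioc 0 n).filter (WW (reflect n P))).card := by
  by_cases hS : P.eval 1 = 0
  · obtain ⟨P2, hP2⟩ := dvd_iff_isRoot.2 (show IsRoot P 1 from hS)
    set P1 := -P2 with hP1
    have hPP : P = P1 * (1 - X) := by rw [hP2, hP1]; simp; ring
    have hP1ne : P1 ≠ 0 := by rintro h; rw [h] at hPP; simp at hPP; exact h0 hPP
    have hXne : (1 - X : ℝ[X]) ≠ 0 := by
      intro h
      have := congrArg (eval 0) h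
      simp at this
    have hXd : (1 - X : ℝ[X]).natDegree = 1 := by
      have : (1 - X : ℝ[X]) = -(X - C 1) := by simp
      rw [this, natDegree_neg, natDegree_X_sub_C]
    have hdeg : P.natDegree = P1.natDegree + 1 := by
      conv_lhs => rw [hPP]
      rw [natDegree_mul hP1ne hXne, hXd]
    obtain ⟨n', rfl⟩ : ∃ n', n = n' + 1 := ⟨n - 1, by omega⟩
    have hP1d : P1.natDegree ≤ n' := by omega
    have hroots : P.roots.countP (0 < ·) ≤ 1 + P1.roots.countP (0 < ·) := by
      conv_lhs => rw [hPP]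
      rw [roots_mul (mul_ne_zero hP1ne hXne), Multiset.countP_add]
      have h1 := Multiset.countP_le_card (0 < ·) (1 - X : ℝ[X]).roots
      have h2 := (1 - X : ℝ[X]).card_roots'
      omega
    have hr2 := countP_mul_le P1 (GG (n'+1)) hP1ne (GG_ne _)
    have hr3 := (P1 * GG (n'+1)).roots_countP_pos_le_signVariations
    have hdegQ : (P1 * GG (n'+1)).natDegree ≤ n' + (n'+1) :=
      natDegree_mul_le.trans (Nat.add_le_add hP1d (GG_deg _))
    have hr4 := signVar_le _ _ hdegQ
    have hr5 := XX_split (n' + (n'+1)) (n'+1) (n'+1) (by omega) (P1 * GG (n'+1))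
    rw [reflect_mul _ _ hP1d (GG_deg _), GG_reflect] at hr5
    have hrefl : -(reflect (n'+1) P) = reflect n' P1 * (1 - X) := by
      conv_lhs => rw [hPP]
      rw [reflect_mul _ _ hP1d hXd.le, reflect_sub, reflect_one_X]
      have : reflect 1 (1 : ℝ[X]) = X := by
        simp
      rw [this]; ring
    have hrefl2 : reflect (n'+1) P = (-(reflect n' P1)) * (1 - X) := by
      rw [neg_mul, ← hrefl, neg_neg]
    have w1 : ((Finset.Ioc 0 (n'+1)).filter (XX (P1 * GG (n'+1)).coeff)).card
        ≤ ((Finset.Ioc 0 (n'+1)).filter (WW P)).card := by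
      apply Finset.card_le_card
      intro k hk
      simp only [Finset.mem_filter, Finset.mem_Ioc] at hk ⊢
      exact ⟨hk.1, WW_of_XX P _ k hk.1.1 (coeff_P1G P P1 hPP _ _ (by omega))
        (coeff_P1G P P1 hPP _ _ (by omega)) hk.2⟩
    have w2 : ((Finset.Ioc 0 (n'+1)).filter (XX (reflect n' P1 * GG (n'+1)).coeff)).card
        ≤ ((Finset.Ioc 0 (n'+1)).filter (WW (reflect (n'+1) P))).card := by
      apply Finset.card_le_card
      intro k hk
      simp only [Finset.mem_filter, Finset.mem_Ioc] at hk ⊢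
      refine ⟨hk.1, WW_of_XX _ (-(reflect n' P1) * GG (n'+1)).coeff k hk.1.1
        (coeff_P1G _ _ hrefl2 _ _ (by omega)) (coeff_P1G _ _ hrefl2 _ _ (by omega)) ?_⟩
      obtain ⟨-, h1, h2⟩ := hk
      unfold XX
      rw [neg_mul, coeff_neg, coeff_neg]
      exact ⟨by linarith, by simpa using h2⟩
    omega
  · have hS' : (reflect n P).eval 1 ≠ 0 := by rwa [reflect_eval_one P n hP]
    obtain ⟨N1, hN1⟩ := half_ne P n hP hS
    obtain ⟨N2, hN2⟩ := half_ne (reflect n P) n (reflect_deg P n hP) hS'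
    set N := max N1 N2 with hN
    have k1 := hN1 N (le_max_left _ _)
    have k2 := hN2 N (le_max_right _ _)
    have hd1 : (P * GG N).natDegree ≤ n + N := natDegree_mul_le.trans (Nat.add_le_add hP (GG_deg _))
    have hd2 : (P * GG N * GG N).natDegree ≤ n + N + N :=
      natDegree_mul_le.trans (Nat.add_le_add hd1 (GG_deg _))
    have hr1 := countP_mul_le P (GG N) h0 (GG_ne _)
    have hr2 := countP_mul_le (P * GG N) (GG N) (mul_ne_zero h0 (GG_ne _)) (GG_ne _)
    have hr3 := (P * GG N * GG N).roots_countP_pos_le_signVariations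
    have hr4 := signVar_le _ _ hd2
    have hr5 := XX_split (n + N + N) (N + n) (N + n) (by omega) (P * GG N * GG N)
    rw [reflect_mul _ _ hd1 (GG_deg _), reflect_mul _ _ hP (GG_deg _), GG_reflect] at hr5
    omega

end PartB1

lemma TS_eq (P : ℝ[X]) (k : ℕ) :
    TS P k = ∑ j ∈ Finset.range (k+1), (((k+1:ℕ):ℝ) - j) * P.coeff j := by
  induction k with
  | zero => simp [TS, SS]
  | succ k ih =>
    rw [TS_succ, ih, Finset.sum_range_succ _ (k+1)]
    unfold SS
    rw [Finset.sum_range_succ _ (k+1), ← add_assoc, ← Finset.sum_add_distrib]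
    congr 1
    · refine Finset.sum_congr rfl fun j _ => by push_cast; ring
    · push_cast; ring

/-- signed random polynomial -/
noncomputable def PE (n : ℕ) (e : ℝ) (lam : Fin (n+1) → ℝ) : ℝ[X] :=
  ∑ k : Fin (n+1), C (e ^ (k:ℕ) * lam k) * X ^ (k:ℕ)

lemma PE_coeff (n : ℕ) (e : ℝ) (lam : Fin (n+1) → ℝ) (k : Fin (n+1)) :
    (PE n e lam).coeff k = e ^ (k:ℕ) * lam k := by
  unfold PE
  simp only [finsetSum_coeff, coeff_C_mul, coeff_X_pow]
  rw [Finset.sum_eq_single k]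
  · simp
  · intro j _ hj
    rw [if_neg, mul_zero]
    intro h; exact hj (Fin.ext h.symm)
  · simp

lemma PE_deg (n : ℕ) (e : ℝ) (lam : Fin (n+1) → ℝ) : (PE n e lam).natDegree ≤ n := by
  unfold PE
  refine natDegree_sum_le_of_forall_le _ _ fun i hi => ?_
  exact (natDegree_C_mul_X_pow_le _ _).trans (by have := i.2; omega)

lemma PE_ne (n : ℕ) (e : ℝ) (he : e ≠ 0) (lam : Fin (n+1) → ℝ) (h : lam ≠ 0) : PE n e lam ≠ 0 := by
  intro h0
  apply h
  ext k
  have := PE_coeff n e lam k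
  rw [h0, coeff_zero] at this
  have := (mul_eq_zero.1 this.symm).resolve_left (pow_ne_zero _ he)
  simpa using this

lemma PE_reflect (n : ℕ) (e : ℝ) (he : e ^ 2 = 1) (lam : Fin (n+1) → ℝ) :
    reflect n (PE n e lam) = C (e ^ n) * PE n e (lam ∘ Fin.revPerm) := by
  ext k
  rw [coeff_C_mul]
  by_cases hk : k ≤ n
  · rw [coeff_reflect, revAt_le hk]
    have h1 := PE_coeff n e lam (Fin.rev ⟨k, by omega⟩)
    have h2 := PE_coeff n e (lam ∘ Fin.revPerm) ⟨k, by omega⟩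
    simp only [Fin.val_rev] at h1
    simp only at h2
    have e1 : n + 1 - (k + 1) = n - k := by omega
    rw [e1] at h1
    rw [h1, h2]
    simp only [Function.comp_apply, Fin.revPerm_apply]
    rw [← mul_assoc, ← pow_add]
    congr 1
    have : n + k = (n - k) + 2 * k := by omega
    rw [this, pow_add, pow_mul, he, one_pow, mul_one]
  · rw [coeff_eq_zero_of_natDegree_lt, coeff_eq_zero_of_natDegree_lt, mul_zero]
    · have := PE_deg n e (lam ∘ Fin.revPerm); omega
    · have := reflect_deg _ n (PE_deg n e lam); omega

lemma WW_C_mul (P : ℝ[X]) (c : ℝ) (hc : c ≠ 0) (k : ℕ) : WW (C c * P) k ↔ WW P k := by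
  have h1 : ∀ k, SS (C c * P) k = c * SS P k := by
    intro k; unfold SS; simp only [coeff_C_mul, Finset.mul_sum]
  have h2 : TS (C c * P) k = c * TS P k := by
    unfold TS; simp only [h1, Finset.mul_sum]
  unfold WW
  rw [h1, h2, abs_mul, abs_mul, mul_le_mul_iff_right₀ (abs_pos.2 hc)]
  simp [hc]

/-- event probability -/
lemma count_WW (n k : ℕ) (hk0 : 0 < k) (hk : k ≤ n) (e : ℝ) (he : e = 1 ∨ e = -1)
    (lam : Fin (n+1) → ℝ) :
    ((k+1:ℕ):ℝ) * ∑ σ : Equiv.Perm (Fin (n+1)), (if WW (PE n e (lam ∘ σ)) k then (1:ℝ) else 0)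
      ≤ 10 ^ 11 * Fintype.card (Equiv.Perm (Fin (n+1))) := by
  classical
  set ι : Fin (k+1) ↪ Fin (n+1) := (Fin.castLEEmb (by omega)) with hι
  have hιv : ∀ p, ((ι p : Fin (n+1)) : ℕ) = p := fun p => rfl
  have hiff : ∀ μ : Fin (n+1) → ℝ, WW (PE n e μ) k ↔
      (∑ p : Fin (k+1), e ^ (p:ℕ) * μ (ι p)) ≠ 0 ∧
        |∑ p : Fin (k+1), (((k+1:ℕ):ℝ) - (p:ℕ)) * e ^ (p:ℕ) * μ (ι p)|
          ≤ |∑ p : Fin (k+1), e ^ (p:ℕ) * μ (ι p)| := by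
    intro μ
    have c1 : ∀ p : Fin (k+1), (PE n e μ).coeff p = e ^ (p:ℕ) * μ (ι p) := fun p => by
      have := PE_coeff n e μ (ι p)
      rwa [hιv] at this
    unfold WW
    rw [TS_eq]
    unfold SS
    rw [Finset.sum_range, Finset.sum_range]
    simp only [c1, mul_assoc]
  set h : Equiv.Perm (Fin (n+1)) → ℝ := fun σ => if WW (PE n e (lam ∘ σ)) k then (1:ℝ) else 0 with hh
  have hav : ∀ π : Equiv.Perm (Fin (k+1)), ∑ σ, h (σ * π.viaEmbedding ι) = ∑ σ, h σ := fun π =>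
    Equiv.sum_comp (Equiv.mulRight (π.viaEmbedding ι)) h
  have hin : ∀ σ : Equiv.Perm (Fin (n+1)), ((k+1:ℕ):ℝ) * ∑ π : Equiv.Perm (Fin (k+1)), h (σ * π.viaEmbedding ι)
      ≤ 10 ^ 11 * Fintype.card (Equiv.Perm (Fin (k+1))) := by
    intro σ
    refine le_trans (le_of_eq ?_) (main_count (k+1) (by omega) (fun p => lam (σ (ι p))) e he)
    congr 1
    rw [Finset.card_filter]
    push_cast
    refine Finset.sum_congr rfl fun π _ => ?_
    simp only [hh, hiff]
    simp only [Function.comp_apply, Equiv.Perm.mul_apply, Equiv.Perm.viaEmbedding_apply]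
    push_cast
    rfl
  have hsum := Finset.sum_le_sum fun σ (_ : σ ∈ (Finset.univ : Finset (Equiv.Perm (Fin (n+1))))) => hin σ
  rw [← Finset.mul_sum, Finset.sum_comm, Finset.sum_congr rfl (fun π _ => hav π),
    Finset.sum_const, Finset.sum_const, nsmul_eq_mul, nsmul_eq_mul, Finset.card_univ, Finset.card_univ] at hsum
  have hpos : (0:ℝ) < Fintype.card (Equiv.Perm (Fin (k+1))) := by exact_mod_cast Fintype.card_pos
  refine le_of_mul_le_mul_left ?_ hpos
  linarith

/-- number of nonzero roots -/
lemma nz_roots (P : ℝ[X]) : (P.roots.filter (fun x => x ≠ 0)).card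
    = P.roots.countP (0 < ·) + (P.comp (-X)).roots.countP (0 < ·) := by
  rw [roots_comp_neg_X, Multiset.countP_map]
  induction P.roots using Multiset.induction_on with
  | empty => simp
  | cons a s ih =>
    rw [Multiset.filter_cons, Multiset.card_add, ih, Multiset.countP_cons, Multiset.filter_cons,
      Multiset.card_add]
    rcases lt_trichotomy a 0 with h | h | h
    · rw [if_pos h.ne, if_neg (not_lt.2 h.le), if_pos (by linarith : 0 < -a),
        Multiset.card_singleton]; omega
    · rw [if_neg (not_not.2 h), if_neg (by linarith), if_neg (by linarith : ¬ 0 < -a),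
        Multiset.card_zero]; omega
    · rw [if_pos h.ne', if_pos h, if_neg (by linarith : ¬ 0 < -a),
        Multiset.card_singleton, Multiset.card_zero]; omega

lemma PE_comp (n : ℕ) (lam : Fin (n+1) → ℝ) : (PE n 1 lam).comp (-X) = PE n (-1) lam := by
  ext k
  have h0 : (-X : ℝ[X]) = C (-1) * X := by simp
  rw [h0, comp_C_mul_X_coeff]
  by_cases hk : k ≤ n
  · have h1 := PE_coeff n 1 lam ⟨k, by omega⟩
    have h2 := PE_coeff n (-1) lam ⟨k, by omega⟩
    simp only at h1 h2
    rw [h1, h2]; simp [mul_comm]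
  · rw [coeff_eq_zero_of_natDegree_lt, coeff_eq_zero_of_natDegree_lt, zero_mul]
    · have := PE_deg n (-1) lam; omega
    · have := PE_deg n 1 lam; omega

lemma harm_bound (n : ℕ) (hn : 2 ≤ n) : ∑ k ∈ Finset.Ioc 0 n, (((k+1:ℕ):ℝ))⁻¹ ≤ 3 * Real.log n := by
  have h1 := harmonic_le_one_add_log n
  rw [harmonic_eq_sum_Icc] at h1
  push_cast at h1
  have h2 : ∑ k ∈ Finset.Ioc 0 n, (((k+1:ℕ):ℝ))⁻¹ ≤ ∑ k ∈ Finset.Icc 1 n, ((k:ℝ))⁻¹ := by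
    have : Finset.Ioc 0 n = Finset.Icc 1 n := by ext; simp [Nat.succ_le_iff]
    rw [this]
    refine Finset.sum_le_sum fun k hk => ?_
    have : (0:ℝ) < k := by
      have := (Finset.mem_Icc.1 hk).1
      exact_mod_cast this
    apply inv_anti₀ this
    push_cast; linarith
  have h3 : Real.log 2 ≤ Real.log n := Real.log_le_log (by norm_num) (by exact_mod_cast hn)
  have := Real.log_two_gt_d9
  linarith

lemma half_count (n : ℕ) (hn : 2 ≤ n) (e : ℝ) (he : e = 1 ∨ e = -1) (lam : Fin (n+1) → ℝ) (h : lam ≠ 0) :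
    ∑ σ : Equiv.Perm (Fin (n+1)), ((PE n e (lam ∘ σ)).roots.countP (0 < ·) : ℝ)
      ≤ 10 ^ 12 * Real.log n * Fintype.card (Equiv.Perm (Fin (n+1))) := by
  have he0 : e ≠ 0 := by rcases he with rfl | rfl <;> norm_num
  have he2 : e ^ 2 = 1 := by rcases he with rfl | rfl <;> norm_num
  set N : ℝ := ((Fintype.card (Equiv.Perm (Fin (n+1))) : ℕ) : ℝ) with hN
  have hN0 : 0 ≤ N := by positivity
  have hb : ∀ σ : Equiv.Perm (Fin (n+1)), ((PE n e (lam ∘ σ)).roots.countP (0 < ·) : ℝ)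
      ≤ 4 + ∑ k ∈ Finset.Ioc 0 n, (if WW (PE n e (lam ∘ σ)) k then (1:ℝ) else 0)
        + ∑ k ∈ Finset.Ioc 0 n, (if WW (PE n e (lam ∘ (σ * Fin.revPerm : Equiv.Perm (Fin (n+1))))) k then (1:ℝ) else 0) := by
    intro σ
    have hne : lam ∘ σ ≠ 0 := by
      intro h0; apply h; ext x
      have := congrFun h0 (σ.symm x)
      simpa using this
    have h1 := pos_roots_le (PE n e (lam ∘ σ)) n (PE_deg _ _ _) (PE_ne n e he0 _ hne)
    have h2 : (Finset.Ioc 0 n).filter (WW (reflect n (PE n e (lam ∘ σ))))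
        = (Finset.Ioc 0 n).filter (WW (PE n e (lam ∘ (σ * Fin.revPerm : Equiv.Perm (Fin (n+1)))))) := by
      apply Finset.filter_congr
      intro k _
      rw [PE_reflect n e he2, WW_C_mul _ _ (pow_ne_zero _ he0)]
      rfl
    rw [h2, Finset.card_filter, Finset.card_filter] at h1
    exact_mod_cast h1
  have hs := Finset.sum_le_sum fun σ (_ : σ ∈ (Finset.univ : Finset (Equiv.Perm (Fin (n+1))))) => hb σ
  rw [Finset.sum_add_distrib, Finset.sum_add_distrib] at hs
  have hrev : ∑ σ : Equiv.Perm (Fin (n+1)), ∑ k ∈ Finset.Ioc 0 n, (if WW (PE n e (lam ∘ (σ * Fin.revPerm : Equiv.Perm (Fin (n+1))))) k then (1:ℝ) else 0)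
      = ∑ σ : Equiv.Perm (Fin (n+1)), ∑ k ∈ Finset.Ioc 0 n, (if WW (PE n e (lam ∘ σ)) k then (1:ℝ) else 0) :=
    Equiv.sum_comp (Equiv.mulRight (Fin.revPerm : Equiv.Perm (Fin (n+1))))
      (fun σ : Equiv.Perm (Fin (n+1)) => ∑ k ∈ Finset.Ioc 0 n, (if WW (PE n e (lam ∘ σ)) k then (1:ℝ) else 0))
  rw [hrev] at hs
  have hm : ∑ σ : Equiv.Perm (Fin (n+1)), ∑ k ∈ Finset.Ioc 0 n, (if WW (PE n e (lam ∘ σ)) k then (1:ℝ) else 0)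
      ≤ 10 ^ 11 * N * (3 * Real.log n) := by
    rw [Finset.sum_comm]
    refine le_trans (Finset.sum_le_sum (g := fun k => 10 ^ 11 * N * (((k+1:ℕ):ℝ))⁻¹) fun k hk => ?_) ?_
    · rw [Finset.mem_Ioc] at hk
      rw [← div_eq_mul_inv, le_div_iff₀ (by positivity), mul_comm]
      exact count_WW n k hk.1 hk.2 e he lam
    · rw [← Finset.mul_sum]
      exact mul_le_mul_of_nonneg_left (harm_bound n hn) (by positivity)
  rw [Finset.sum_const, Finset.card_univ, nsmul_eq_mul, ← hN] at hs
  have h3 : Real.log 2 ≤ Real.log n := Real.log_le_log (by norm_num) (by exact_mod_cast hn)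
  have h4 := Real.log_two_gt_d9
  have h5 : N * 1 ≤ N * (2 * Real.log n) := mul_le_mul_of_nonneg_left (by linarith) hN0
  nlinarith

lemma sum_lintegral_le {α ι : Type*} [MeasurableSpace α] (μ : Measure α) (s : Finset ι)
    (f : ι → α → ℝ≥0∞) : ∑ i ∈ s, ∫⁻ x, f i x ∂μ ≤ ∫⁻ x, ∑ i ∈ s, f i x ∂μ := by
  classical
  induction s using Finset.induction_on with
  | empty => simp
  | insert a s ha ih =>
    simp only [Finset.sum_insert ha]
    exact (add_le_add le_rfl ih).trans (le_lintegral_add _ _)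

lemma lintegral_perm {n : ℕ} (μ : Measure (Fin (n+1) → ℝ)) (σ : Equiv.Perm (Fin (n+1)))
    (h : μ.map (fun lam => lam ∘ σ) = μ) (f : (Fin (n+1) → ℝ) → ℝ≥0∞) :
    ∫⁻ lam, f (lam ∘ σ) ∂μ = ∫⁻ lam, f lam ∂μ := by
  let g : (Fin (n+1) → ℝ) ≃ᵐ (Fin (n+1) → ℝ) :=
    { toFun := fun lam => lam ∘ σ
      invFun := fun lam => lam ∘ σ.symm
      left_inv := fun lam => by ext; simp
      right_inv := fun lam => by ext; simp
      measurable_toFun := measurable_pi_lambda _ fun i => measurable_pi_apply _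
      measurable_invFun := measurable_pi_lambda _ fun i => measurable_pi_apply _ }
  have h1 := lintegral_map_equiv (μ := μ) f g
  have h2 : μ.map g = μ := h
  rw [h2] at h1
  exact h1.symm

open scoped Classical in
theorem stmt_1 :
    ∃ C > (0:ℝ), ∀ (n : ℕ), 2 ≤ n →
      ∀ (μ : Measure (Fin (n+1) → ℝ)), IsProbabilityMeasure μ →
      (∀ σ : Equiv.Perm (Fin (n+1)), μ.map (fun lam => lam ∘ σ) = μ) →
      (∫⁻ lam, (if lam ≠ 0 then
          ((((∑ k : Fin (n+1), Polynomial.C (lam k) * Polynomial.X ^ (k:ℕ)).roots.filter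
              (fun x => x ≠ 0)).card : ℝ≥0∞)) else 0) ∂μ)
        ≤ ENNReal.ofReal (C * Real.log n) := by
  refine ⟨2 * 10 ^ 12, by norm_num, ?_⟩
  intro n hn μ hμ hex
  set f : (Fin (n+1) → ℝ) → ℝ≥0∞ := fun lam => (if lam ≠ 0 then
          ((((∑ k : Fin (n+1), Polynomial.C (lam k) * Polynomial.X ^ (k:ℕ)).roots.filter
              (fun x => x ≠ 0)).card : ℝ≥0∞)) else 0) with hf
  set N : ℕ := Fintype.card (Equiv.Perm (Fin (n+1))) with hN
  have hlog : 0 ≤ Real.log n := Real.log_natCast_nonneg n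
  have hpt : ∀ lam, ∑ σ : Equiv.Perm (Fin (n+1)), f (lam ∘ σ)
      ≤ (N : ℝ≥0∞) * ENNReal.ofReal (2 * 10 ^ 12 * Real.log n) := by
    intro lam
    by_cases h0 : lam = 0
    · have : ∀ σ : Equiv.Perm (Fin (n+1)), f (lam ∘ σ) = 0 := by
        intro σ
        have : lam ∘ σ = 0 := by rw [h0]; rfl
        simp only [hf, this]; simp
      simp [this]
    · have hv : ∀ σ : Equiv.Perm (Fin (n+1)), f (lam ∘ σ)
          ≤ ENNReal.ofReal (((PE n 1 (lam ∘ σ)).roots.countP (0 < ·) : ℝ)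
            + ((PE n (-1) (lam ∘ σ)).roots.countP (0 < ·) : ℝ)) := by
        intro σ
        simp only [hf]
        split_ifs
        · have hP : (∑ k : Fin (n+1), Polynomial.C ((lam ∘ σ) k) * Polynomial.X ^ (k:ℕ)) = PE n 1 (lam ∘ σ) := by
            unfold PE; simp
          rw [hP]
          have := nz_roots (PE n 1 (lam ∘ σ))
          rw [PE_comp] at this
          rw [← Nat.cast_add, ENNReal.ofReal_natCast, Nat.cast_le]
          refine le_of_eq ?_
          convert this
        · exact zero_le
      refine (Finset.sum_le_sum fun σ _ => hv σ).trans ?_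
      rw [← ENNReal.ofReal_sum_of_nonneg (fun _ _ => by positivity), ← ENNReal.ofReal_natCast,
        ← ENNReal.ofReal_mul (by positivity)]
      apply ENNReal.ofReal_le_ofReal
      rw [Finset.sum_add_distrib]
      have a1 := half_count n hn 1 (Or.inl rfl) lam h0
      have a2 := half_count n hn (-1) (Or.inr rfl) lam h0
      rw [← hN] at a1 a2
      linarith
  have h1 := sum_lintegral_le μ (Finset.univ : Finset (Equiv.Perm (Fin (n+1))))
    (fun σ lam => f (lam ∘ σ))
  have h2 : ∑ σ : Equiv.Perm (Fin (n+1)), ∫⁻ lam, f (lam ∘ σ) ∂μ = (N : ℝ≥0∞) * ∫⁻ lam, f lam ∂μ := by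
    rw [Finset.sum_congr rfl (fun σ _ => lintegral_perm μ σ (hex σ) f), Finset.sum_const,
      Finset.card_univ, nsmul_eq_mul]
  have h3 : ∫⁻ lam, ∑ σ : Equiv.Perm (Fin (n+1)), f (lam ∘ σ) ∂μ
      ≤ (N : ℝ≥0∞) * ENNReal.ofReal (2 * 10 ^ 12 * Real.log n) := by
    refine (lintegral_mono hpt).trans ?_
    rw [lintegral_const, measure_univ, mul_one]
  have h4 : (N : ℝ≥0∞) * ∫⁻ lam, f lam ∂μ ≤ (N : ℝ≥0∞) * ENNReal.ofReal (2 * 10 ^ 12 * Real.log n) := by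
    rw [← h2]; exact h1.trans h3
  have hN0 : (N : ℝ≥0∞) ≠ 0 := by
    rw [hN]; exact_mod_cast Fintype.card_ne_zero
  exact (ENNReal.mul_le_mul_iff_right hN0 (ENNReal.natCast_ne_top N)).1 h4
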